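/- For activated random walk on ℤ² with simple symmetric nearest-neighbor jumps, there exist constants c > 0 and λ₀ ∈ (0,1) such that for all 0 < λ ≤ λ₀, ρ_c(ℤ², λ) ≥ c · λ · log(1/λ); that is, ρ_c(ℤ², λ) = Ω(λ log(λ^{−1})) as λ → 0. -/

import Mathlib

/-!
Common framework for the activated random walk (ARW) model on `ℤ^d`,
via the site-wise (Diaconis–Fulton) representation.
-/

open MeasureTheory ENNReal Filter

namespace ARW

noncomputable section
open scoped Classical

/-- A site of the lattice `ℤ^d`. -/
abbrev Site (d : ℕ) := Fin d → ℤ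

/-- An instruction: `none` is a sleep instruction, `some z` is a jump instruction
with displacement `z`. -/
abbrev Instr (d : ℕ) := Option (Site d)

instance (d : ℕ) : MeasurableSpace (Instr d) := ⊤

/-- The array of instruction stacks: `I (x, k)` is the `k`-th instruction at site `x`. -/
abbrev Stacks (d : ℕ) := Site d × ℕ → Instr d

/-- The state of a site: `active n` means `n` active particles (and no sleeping one),
`sleeping` means a single sleeping particle. -/
inductive SiteState : Type
  | active : ℕ → SiteState
  | sleeping : SiteState
  deriving DecidableEq

/-- A particle configuration. -/
abbrev Config (d : ℕ) := Site d → SiteState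

/-- Number of active particles at a site state. -/
def numActive : SiteState → ℕ
  | .active n => n
  | .sleeping => 0

/-- Adding one (active) particle to a site: a sleeping particle is reactivated. -/
def addParticle : SiteState → SiteState
  | .active n => .active (n + 1)
  | .sleeping => .active 2

/-- A state of the system: a configuration together with an odometer
(number of instructions already used at each site). -/
abbrev State (d : ℕ) := Config d × (Site d → ℕ)

/-- Initial state on `V` obtained from an all-active particle count `η` (particles
outside `V` are discarded), with odometer `0`. -/
def initState (d : ℕ) (V : Finset (Site d)) (η : Site d → ℕ) : State d :=
  (fun x => .active (if x ∈ V then η x else 0), fun _ => 0)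

/-- Toppling the site `x` (inside `V`, particles jumping out of `V` are killed):
the next unused instruction at `x` is executed and the odometer at `x` increases by one.
A sleep instruction puts the particle at `x` to sleep if it is alone (otherwise it has
no effect), and a jump instruction moves one particle from `x` to `x + z`
(reactivating a sleeping particle there), killing it if `x + z ∉ V`. -/
def topple {d : ℕ} (V : Finset (Site d)) (I : Stacks d) (x : Site d) (s : State d) :
    State d :=
  let σ := s.1
  let m := s.2
  let σ' : Config d :=
    match I (x, m x) with
    | none => if numActive (σ x) = 1 then Function.update σ x .sleeping else σ
    | some z =>
        let σ₁ := Function.update σ x (SiteState.active (numActive (σ x) - 1))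
        if x + z ∈ V then Function.update σ₁ (x + z) (addParticle (σ₁ (x + z))) else σ₁
  (σ', Function.update m x (m x + 1))

/-- Running a sequence of topplings. -/
def run {d : ℕ} (V : Finset (Site d)) (I : Stacks d) : State d → List (Site d) → State d
  | s, [] => s
  | s, x :: l => run V I (topple V I x s) l

/-- Legality of a toppling sequence: every toppled site lies in `V` and holds at least one
active particle when toppled. -/
def Legal {d : ℕ} (V : Finset (Site d)) (I : Stacks d) : State d → List (Site d) → Prop
  | _, [] => True
  | s, x :: l => x ∈ V ∧ 1 ≤ numActive (s.1 x) ∧ Legal V I (topple V I x s) l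

/-- A configuration is stable in `V` if no site of `V` holds an active particle. -/
def Stable {d : ℕ} (V : Finset (Site d)) (σ : Config d) : Prop :=
  ∀ x ∈ V, numActive (σ x) = 0

/-- The stabilization of `η` in `V` terminates. -/
def StabCompletes {d : ℕ} (V : Finset (Site d)) (I : Stacks d) (η : Site d → ℕ) : Prop :=
  ∃ l, Legal V I (initState d V η) l ∧ Stable V (run V I (initState d V η) l).1

/-- The stable configuration `Stab_V η` (well defined, independently of the chosen legal
toppling sequence, by the abelian property), when stabilization terminates. -/
def stabConfig {d : ℕ} (V : Finset (Site d)) (I : Stacks d) (η : Site d → ℕ) : Config d :=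
  if h : StabCompletes V I η then (run V I (initState d V η) h.choose).1
  else fun _ => .active 0

/-- The event `0 ∈ Stab_V η`: stabilization of `η` in `V` ends with a sleeping particle
at the origin. -/
def SleepAt0 {d : ℕ} (V : Finset (Site d)) (I : Stacks d) (η : Site d → ℕ) : Prop :=
  StabCompletes V I η ∧ stabConfig V I η 0 = .sleeping

/-- The event `0 ∉ Stab_V η`: stabilization of `η` in `V` ends with the origin empty. -/
def EmptyAt0 {d : ℕ} (V : Finset (Site d)) (I : Stacks d) (η : Site d → ℕ) : Prop :=
  StabCompletes V I η ∧ stabConfig V I η 0 ≠ .sleeping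

/-- The limiting odometer of `η` at the origin: the supremum, over finite volumes `V` and
legal toppling sequences in `V`, of the number of topplings performed at the origin. -/
def odom0 {d : ℕ} (I : Stacks d) (η : Site d → ℕ) : ℕ∞ :=
  ⨆ (V : Finset (Site d)) (l : List (Site d)) (_ : Legal V I (initState d V η) l),
    (l.count 0 : ℕ∞)

/-! ### The random instructions -/

/-- The normalized sleep rate `λ_s = λ/(1+λ)`. -/
def lamS (lam : ℝ) : ℝ := lam / (1 + lam)

/-- The normalized jump rate `λ_J = 1/(1+λ)`. -/
def lamJ (lam : ℝ) : ℝ := 1 / (1 + lam)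

/-- The distribution of a single instruction: sleep with probability `λ_s`, jump by `z`
with probability `λ_J · step z`. -/
def instrWeight {d : ℕ} (step : Site d → ℝ) (lam : ℝ) : Instr d → ℝ≥0∞
  | none => ENNReal.ofReal (lamS lam)
  | some z => ENNReal.ofReal (lamJ lam) * ENNReal.ofReal (step z)

/-- `μ` is the law of the i.i.d. instruction stacks: a probability measure whose
finite-dimensional cylinder probabilities are the products of the `instrWeight`s. -/
def IsStackLaw (d : ℕ) (step : Site d → ℝ) (lam : ℝ) (μ : Measure (Stacks d)) : Prop :=
  IsProbabilityMeasure μ ∧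
    ∀ (F : Finset (Site d × ℕ)) (g : Site d × ℕ → Instr d),
      μ {I | ∀ i ∈ F, I i = g i} = ∏ i ∈ F, instrWeight step lam (g i)

/-- The law of the i.i.d. instruction stacks (uniquely determined by its cylinder
probabilities; it exists whenever `step` is a probability distribution and `λ > 0`). -/
def stackLaw (d : ℕ) (step : Site d → ℝ) (lam : ℝ) : Measure (Stacks d) :=
  if h : ∃ μ, IsStackLaw d step lam μ then h.choose else 0

/-! ### Fixation and the critical density -/

/-- Translation of a particle count by `z`. -/
def shift {d : ℕ} (z : Site d) (η : Site d → ℕ) : Site d → ℕ := fun x => η (x + z)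

/-- A translation-ergodic distribution of particles: invariant under all translations,
and every translation-invariant event is trivial. -/
def IsTransErgodic {d : ℕ} (ν : Measure (Site d → ℕ)) : Prop :=
  (∀ z, Measure.map (shift z) ν = ν) ∧
    ∀ s : Set (Site d → ℕ), MeasurableSet s → (∀ z, shift z ⁻¹' s = s) → ν s = 0 ∨ ν s = 1

/-- Almost sure fixation of the initial distribution `ν`: for `ν`-almost every initial
configuration and almost every instructions, the limiting odometer at the origin is
finite (equivalently, by Amir–Gurel-Gurevich, every particle eventually sleeps forever). -/
def Fixates (d : ℕ) (step : Site d → ℝ) (lam : ℝ) (ν : Measure (Site d → ℕ)) : Prop :=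
  ∀ᵐ η ∂ν, ∀ᵐ I ∂(stackLaw d step lam), odom0 I η ≠ ⊤

/-- The critical density `ρ_c(ℤ^d, P, λ)`: the supremum of the densities `ρ` such that
every translation-ergodic probability distribution of active particles with mean `ρ`
particles per site fixates almost surely. -/
def critDensity (d : ℕ) (step : Site d → ℝ) (lam : ℝ) : ℝ :=
  sSup {ρ : ℝ | 0 ≤ ρ ∧
    ∀ ν : Measure (Site d → ℕ), IsProbabilityMeasure ν → IsTransErgodic ν →
      (∫⁻ η, (η 0 : ℝ≥0∞) ∂ν) = ENNReal.ofReal ρ → Fixates d step lam ν}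

/-! ### Random walk quantities -/

/-- Simple symmetric nearest-neighbour step distribution on `ℤ^d`. -/
def ssrwStep (d : ℕ) : Site d → ℝ :=
  fun z => if (∑ i, (z i).natAbs) = 1 then (1 : ℝ) / (2 * d) else 0

/-- `psum w k` : position after the first `k` steps with increments `w`. -/
def psum {d n : ℕ} (w : Fin n → Site d) (k : ℕ) : Site d :=
  ∑ i ∈ Finset.univ.filter (fun i : Fin n => (i : ℕ) < k), w i

/-- Probability of a given sequence of increments. -/
def pathProb {d n : ℕ} (step : Site d → ℝ) (w : Fin n → Site d) : ℝ := ∏ i, step (w i)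

/-- `P(S_n = 0)` for the discrete-time walk started at `0`. -/
def probAt0 {d : ℕ} (step : Site d → ℝ) (n : ℕ) : ℝ :=
  ∑' w : Fin n → Site d, if psum w n = 0 then pathProb step w else 0

/-- The Green's function `G = Σ_{n ≥ 0} P(S_n = 0)` of the walk, valued in `[0, ∞]`.
The walk is transient iff `greenE step < ∞`. -/
def greenE {d : ℕ} (step : Site d → ℝ) : ℝ≥0∞ :=
  ∑' n : ℕ, ENNReal.ofReal (probAt0 step n)

/-- Probability that the walk returns to `0` for the first time at time `n`, having
stayed inside `A` at all intermediate times. -/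
def returnIn {d : ℕ} (step : Site d → ℝ) (A : Set (Site d)) (n : ℕ) : ℝ :=
  ∑' w : Fin n → Site d,
    if (∀ k, 0 < k → k < n → psum w k ≠ 0 ∧ psum w k ∈ A) ∧ psum w n = 0
    then pathProb step w else 0

/-- `P(τ = n)` where `τ` is the first return time to the origin. -/
def firstReturn {d : ℕ} (step : Site d → ℝ) (n : ℕ) : ℝ := returnIn step Set.univ n

/-- The probability that the walk started at `0` exits `A` strictly before returning
to `0`. -/
def escProb {d : ℕ} (step : Site d → ℝ) (A : Set (Site d)) : ℝ :=
  ∑' n : ℕ, ∑' w : Fin (n + 1) → Site d,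
    if (∀ k, 0 < k → k ≤ n → psum w k ≠ 0 ∧ psum w k ∈ A) ∧ psum w (n + 1) ∉ A
    then pathProb step w else 0

/-- `q(ℤ^d, P, λ)`: the probability that a single particle started at the origin falls
asleep at the origin, i.e. that the walk is at `0` after `N` steps where
`P(N = n) = λ_s λ_J^n`. -/
def qProb {d : ℕ} (step : Site d → ℝ) (lam : ℝ) : ℝ :=
  ∑' n : ℕ, lamS lam * lamJ lam ^ n * probAt0 step n

/-- The ball `B_r = {x : ‖x‖₁ ≤ r}`. -/
def ball (d : ℕ) (r : ℝ) : Set (Site d) := {x | ((∑ i, (x i).natAbs : ℕ) : ℝ) ≤ r}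

/-- `η` fills `A`: at least one particle at each site of `A`. -/
def Fills {d : ℕ} (η : Site d → ℕ) (A : Set (Site d)) : Prop := ∀ x ∈ A, 1 ≤ η x

/-! ### Weak stabilization, strong stabilization and the number of chances -/

/-- Legality of a weak toppling sequence (with respect to the origin): off the origin as
usual, while the origin may only be toppled if it holds at least two active particles. -/
def WLegal {d : ℕ} (V : Finset (Site d)) (I : Stacks d) : State d → List (Site d) → Prop
  | _, [] => True
  | s, x :: l => x ∈ V ∧ (if x = 0 then 2 else 1) ≤ numActive (s.1 x) ∧
      WLegal V I (topple V I x s) l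

/-- Weak stability in `V` with respect to the origin. -/
def WStable {d : ℕ} (V : Finset (Site d)) (σ : Config d) : Prop :=
  numActive (σ 0) ≤ 1 ∧ ∀ x ∈ V, x ≠ 0 → numActive (σ x) = 0

/-- The weak stabilization of a state (well defined by the abelian property whenever it
terminates). -/
def weakStab {d : ℕ} (V : Finset (Site d)) (I : Stacks d) (s : State d) : State d :=
  if h : ∃ l, WLegal V I s l ∧ WStable V (run V I s l).1 then run V I s h.choose else s

/-- The jump-out step: the particle at the origin is acceptably toppled (consuming
instructions at the origin, ignoring the sleep instructions) until it jumps out. -/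
def jumpOut {d : ℕ} (V : Finset (Site d)) (I : Stacks d) (s : State d) : State d :=
  if h : ∃ k, (I (0, s.2 0 + k)).isSome then
    let k := Nat.find h
    let z := (I (0, s.2 0 + k)).get (Nat.find_spec h)
    let σ₁ := Function.update s.1 0 (SiteState.active (numActive (s.1 0) - 1))
    let σ' := if (0 : Site d) + z ∈ V then
        Function.update σ₁ ((0 : Site d) + z) (addParticle (σ₁ ((0 : Site d) + z)))
      else σ₁
    (σ', Function.update s.2 0 (s.2 0 + k + 1))
  else s

/-- The states of the strong stabilization of `η` on `V` with respect to the origin via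
successive weak stabilizations: `procState j` is the state after the `(j+1)`-st weak
stabilization; as long as the origin holds an active particle, it is jumped out and the
configuration is weakly stabilized again. -/
def procState {d : ℕ} (V : Finset (Site d)) (I : Stacks d) (η : Site d → ℕ) :
    ℕ → State d
  | 0 => weakStab V I (initState d V η)
  | j + 1 =>
      let s := procState V I η j
      if 1 ≤ numActive (s.1 0) then weakStab V I (jumpOut V I s) else s

/-- The number of chances `Ch(η, V)`: the number of completed iterations of the strong
stabilization procedure, i.e. the first `j` such that the origin is empty after the
`(j+1)`-st weak stabilization. -/
def chances {d : ℕ} (V : Finset (Site d)) (I : Stacks d) (η : Site d → ℕ) : ℕ∞ :=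
  if h : ∃ j, numActive ((procState V I η j).1 0) = 0 then (Nat.find h : ℕ∞) else ⊤

/-- The `j`-th weakly stable configuration `η^W_j` (for `1 ≤ j`). -/
def weakConfig {d : ℕ} (V : Finset (Site d)) (I : Stacks d) (η : Site d → ℕ) (j : ℕ) :
    Config d :=
  (procState V I η (j - 1)).1

/-- The `j`-th sleep trial `b_j` (for `1 ≤ j`): whether the first instruction used in the
`j`-th jump-out step is a sleep instruction. -/
def sleepTrial {d : ℕ} (V : Finset (Site d)) (I : Stacks d) (η : Site d → ℕ) (j : ℕ) :
    Prop :=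
  I (0, (procState V I η (j - 1)).2 0) = none

/-- `a^n` for `n ∈ ℕ∞`, with `a^∞ = 0` (appropriate for `a < 1`). -/
def enpow (a : ℝ≥0∞) : ℕ∞ → ℝ≥0∞
  | ⊤ => 0
  | (n : ℕ) => a ^ n

end
end ARW


section
open MeasureTheory ENNReal Filter
set_option linter.unusedSimpArgs false

namespace ARW

noncomputable section
open scoped Classical

/-! ### Deterministic facts -/

/-- Number of particles. -/
def cnt : SiteState → ℕ
  | .active n => n
  | .sleeping => 1

/-- effect of an instruction at the site itself -/
def dep {d : ℕ} : Instr d → SiteState → SiteState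
  | none, s => if numActive s = 1 then .sleeping else s
  | some _, s => .active (numActive s - 1)

/-- site receiving a particle -/
def tgt {d : ℕ} (V : Finset (Site d)) (x : Site d) : Instr d → Option (Site d)
  | none => none
  | some z => if x + z ∈ V then some (x + z) else none

/-- applying an instruction -/
def app {d : ℕ} (V : Finset (Site d)) (x : Site d) (i : Instr d) (σ : Config d) : Config d :=
  fun w => if tgt V x i = some w then addParticle (if w = x then dep i (σ x) else σ w)
    else (if w = x then dep i (σ x) else σ w)

/-- toppling with a prescribed instruction -/
def topI {d : ℕ} (V : Finset (Site d)) (x : Site d) (i : Instr d) (s : State d) : State d :=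
  (app V x i s.1, Function.update s.2 x (s.2 x + 1))

theorem topple_eq {d : ℕ} (V : Finset (Site d)) (I : Stacks d) (x : Site d) (s : State d) :
    topple V I x s = topI V x (I (x, s.2 x)) s := by
  unfold topple topI
  dsimp only
  generalize I (x, s.2 x) = i
  rcases i with _ | z
  · simp only [Prod.mk.injEq, and_true]
    funext w
    simp only [app, tgt, dep, reduceCtorEq, if_false]
    by_cases hw : w = x
    · subst hw; simp only [if_true]; split_ifs <;> simp
    · split_ifs <;> simp [hw]
  · simp only [Prod.mk.injEq, and_true]
    funext w
    simp only [app, tgt, dep]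
    by_cases hV : x + z ∈ V
    · simp only [hV, if_true, Option.some.injEq]
      by_cases hw : x + z = w
      · subst hw
        simp only [Function.update_self, if_true]
        simp only [Function.update_apply]
      · have : w ≠ x + z := fun h => hw h.symm
        simp only [Function.update_apply, this, hw, if_false]
    · simp only [hV, if_false, reduceCtorEq, Function.update_apply]

theorem dep_add {d : ℕ} (i : Instr d) (s : SiteState) (h : 1 ≤ numActive s) :
    dep i (addParticle s) = addParticle (dep i s) := by
  rcases s with n | _
  · rcases i with _ | z
    · simp only [numActive] at h
      simp only [dep, addParticle, numActive]
      by_cases h1 : n = 1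
      · subst h1; simp [addParticle]
      · have : n ≠ 0 := by omega
        simp [h1, this, addParticle]
    · simp only [numActive] at h
      simp only [dep, addParticle, numActive]
      congr 1; omega
  · simp [numActive] at h

theorem numActive_add (s : SiteState) : numActive s + 1 ≤ numActive (addParticle s) := by
  rcases s with n | _ <;> simp [numActive, addParticle]

theorem numActive_add_pos (s : SiteState) : 1 ≤ numActive (addParticle s) := by
  have := numActive_add s; omega

theorem numActive_app_of_ne {d : ℕ} (V : Finset (Site d)) (x w : Site d) (i : Instr d)
    (σ : Config d) (h : w ≠ x) : numActive (σ w) ≤ numActive (app V x i σ w) := by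
  simp only [app, h, if_false]
  split_ifs
  · have := numActive_add (σ w); omega
  · exact le_rfl

theorem app_comm {d : ℕ} (V : Finset (Site d)) (x y : Site d) (i j : Instr d)
    (σ : Config d) (hxy : x ≠ y) (hx : 1 ≤ numActive (σ x)) (hy : 1 ≤ numActive (σ y)) :
    app V x i (app V y j σ) = app V y j (app V x i σ) := by
  funext w
  have hyx : y ≠ x := hxy.symm
  by_cases hwx : w = x
  · subst hwx
    simp only [app, if_true, hxy, if_false, hyx]
    split_ifs <;> simp_all [dep_add]
  · by_cases hwy : w = y
    · subst hwy
      simp only [app, if_true, hxy, if_false, hyx]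
      split_ifs <;> simp_all [dep_add]
    · simp only [app, hwx, hwy, if_false]
      split_ifs <;> rfl

theorem topple_comm {d : ℕ} (V : Finset (Site d)) (I : Stacks d) (x y : Site d) (s : State d)
    (hxy : x ≠ y) (hx : 1 ≤ numActive (s.1 x)) (hy : 1 ≤ numActive (s.1 y)) :
    topple V I x (topple V I y s) = topple V I y (topple V I x s) := by
  simp only [topple_eq, topI, Function.update_of_ne hxy, Function.update_of_ne hxy.symm]
  rw [app_comm V x y _ _ _ hxy hx hy]
  rw [Function.update_comm hxy.symm]

theorem numActive_topple_of_ne {d : ℕ} (V : Finset (Site d)) (I : Stacks d) (x w : Site d)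
    (s : State d) (h : w ≠ x) : numActive (s.1 w) ≤ numActive ((topple V I x s).1 w) := by
  rw [topple_eq]; exact numActive_app_of_ne _ _ _ _ _ h

theorem exchange {d : ℕ} (V : Finset (Site d)) (I : Stacks d) (x : Site d) (hxV : x ∈ V) :
    ∀ (l : List (Site d)) (s : State d), Legal V I s l → Stable V (run V I s l).1 →
      1 ≤ numActive (s.1 x) → x ∈ l ∧ Legal V I (topple V I x s) (l.erase x) ∧
        run V I (topple V I x s) (l.erase x) = run V I s l := by
  intro l
  induction l with
  | nil =>
    intro s _ hst hx
    have := hst x hxV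
    simp only [run] at this
    omega
  | cons y t ih =>
    intro s hl hst hx
    by_cases hyx : y = x
    · subst hyx
      simp only [List.erase_cons_head, List.mem_cons, true_or, true_and]
      exact ⟨hl.2.2, rfl⟩
    · obtain ⟨hyV, hy, hl'⟩ := hl
      have hx' : 1 ≤ numActive ((topple V I y s).1 x) :=
        hx.trans (numActive_topple_of_ne V I y x s (fun h => hyx h.symm))
      obtain ⟨h1, h2, h3⟩ := ih (topple V I y s) hl' hst hx'
      have hc := topple_comm V I x y s (fun h => hyx h.symm) hx hy
      rw [List.erase_cons_tail (by simpa using hyx)]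
      refine ⟨List.mem_cons_of_mem _ h1, ⟨hyV, ?_, ?_⟩, ?_⟩
      · exact hy.trans (numActive_topple_of_ne V I x y s hyx)
      · rw [← hc]; exact h2
      · simp only [run]; rw [← hc]; exact h3

theorem legal_stable_nil {d : ℕ} (V : Finset (Site d)) (I : Stacks d) (s : State d)
    (l : List (Site d)) (hl : Legal V I s l) (hs : Stable V s.1) : l = [] := by
  cases l with
  | nil => rfl
  | cons x t => exact absurd (hs x hl.1) (by have := hl.2.1; omega)

/-- least action principle and abelian property -/
theorem abelian {d : ℕ} (V : Finset (Site d)) (I : Stacks d) :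
    ∀ (l l' : List (Site d)) (s : State d), Legal V I s l → Legal V I s l' →
      Stable V (run V I s l').1 → (∀ x, l.count x ≤ l'.count x) ∧
        (Stable V (run V I s l).1 → run V I s l = run V I s l') := by
  intro l
  induction l with
  | nil =>
    intro l' s _ hl' hst
    refine ⟨by simp, fun h => ?_⟩
    have := legal_stable_nil V I s l' hl' h
    subst this; rfl
  | cons x t ih =>
    intro l' s hl hl' hst
    obtain ⟨h1, h2, h3⟩ := exchange V I x hl.1 l' s hl' hst hl.2.1
    obtain ⟨h4, h5⟩ := ih (l'.erase x) (topple V I x s) hl.2.2 h2 (by rw [h3]; exact hst)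
    refine ⟨fun w => ?_, fun h => ?_⟩
    · rw [(List.perm_cons_erase h1).count_eq w, List.count_cons, List.count_cons]
      have := h4 w; omega
    · simp only [run]; rw [h5 h, h3]

/-! Order on states and monotonicity in the volume. -/

def rk : SiteState → ℕ
  | .active 0 => 0
  | .active (n + 1) => n + 2
  | .sleeping => 1

theorem rk_numActive {a b : SiteState} (h : rk a ≤ rk b) : numActive a ≤ numActive b := by
  rcases a with (_ | n) | _ <;> rcases b with (_ | m) | _ <;> simp_all [rk, numActive]

theorem rk_add {a b : SiteState} (h : rk a ≤ rk b) : rk (addParticle a) ≤ rk (addParticle b) := by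
  rcases a with (_ | n) | _ <;> rcases b with (_ | m) | _ <;> simp_all [rk, addParticle]

theorem rk_add_self (a : SiteState) : rk a ≤ rk (addParticle a) := by
  rcases a with (_ | n) | _ <;> simp_all [rk, addParticle]

theorem rk_dep {d : ℕ} (i : Instr d) {a b : SiteState} (h : rk a ≤ rk b) (ha : 1 ≤ numActive a) :
    rk (dep i a) ≤ rk (dep i b) := by
  rcases a with (_ | n) | _
  · simp [numActive] at ha
  · rcases b with (_ | m) | _
    · simp [rk] at h
    · simp only [rk] at h
      rcases i with _ | z
      · simp only [dep, numActive]
        rcases n with _ | n <;> rcases m with _ | m <;> simp_all [rk]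
      · simp only [dep, numActive, Nat.add_sub_cancel]
        rcases n with _ | n <;> rcases m with _ | m <;> simp_all [rk]
    · simp [rk] at h
  · simp [numActive] at ha

theorem rk_app {d : ℕ} (V V' : Finset (Site d)) (hV : V ⊆ V') (x : Site d) (i : Instr d)
    (σ σ' : Config d) (h : ∀ w, rk (σ w) ≤ rk (σ' w)) (hx : 1 ≤ numActive (σ x)) (w : Site d) :
    rk (app V x i σ w) ≤ rk (app V' x i σ' w) := by
  have hb : rk (if w = x then dep i (σ x) else σ w) ≤ rk (if w = x then dep i (σ' x) else σ' w) := by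
    split_ifs
    · exact rk_dep i (h x) hx
    · exact h w
  have ht : tgt V x i = some w → tgt V' x i = some w := by
    rcases i with _ | z
    · simp [tgt]
    · simp only [tgt]
      by_cases h1 : x + z ∈ V
      · simp [h1, hV h1]
      · simp [h1]
  simp only [app]
  by_cases h1 : tgt V x i = some w
  · rw [if_pos h1, if_pos (ht h1)]; exact rk_add hb
  · rw [if_neg h1]
    by_cases h2 : tgt V' x i = some w
    · rw [if_pos h2]; exact hb.trans (rk_add_self _)
    · rw [if_neg h2]; exact hb

theorem legal_mono {d : ℕ} (V V' : Finset (Site d)) (hV : V ⊆ V') (I : Stacks d) :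
    ∀ (l : List (Site d)) (s s' : State d), (∀ w, rk (s.1 w) ≤ rk (s'.1 w)) → s.2 = s'.2 →
      Legal V I s l → Legal V' I s' l := by
  intro l
  induction l with
  | nil => intro s s' _ _ _; trivial
  | cons x t ih =>
    intro s s' h h2 hl
    refine ⟨hV hl.1, hl.2.1.trans (rk_numActive (h x)), ih _ _ ?_ ?_ hl.2.2⟩
    · intro w
      rw [topple_eq, topple_eq, h2]
      exact rk_app V V' hV x _ _ _ h hl.2.1 w
    · rw [topple_eq, topple_eq]; simp [topI, h2]

theorem legal_init_mono {d : ℕ} {V V' : Finset (Site d)} (hV : V ⊆ V') (I : Stacks d)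
    (η : Site d → ℕ) (l : List (Site d)) (h : Legal V I (initState d V η) l) :
    Legal V' I (initState d V' η) l := by
  refine legal_mono V V' hV I l (initState d V η) (initState d V' η) (fun w => ?_) rfl h
  simp only [initState]
  by_cases h1 : w ∈ V
  · rw [if_pos h1, if_pos (hV h1)]
  · rw [if_neg h1]; simp [rk]

/-! Run lemmas -/

theorem run_append {d : ℕ} (V : Finset (Site d)) (I : Stacks d) :
    ∀ (l l' : List (Site d)) (s : State d), run V I s (l ++ l') = run V I (run V I s l) l' := by
  intro l; induction l with
  | nil => intro l' s; rfl
  | cons x t ih => intro l' s; simp only [List.cons_append, run]; exact ih _ _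

theorem legal_append {d : ℕ} (V : Finset (Site d)) (I : Stacks d) :
    ∀ (l l' : List (Site d)) (s : State d),
      Legal V I s (l ++ l') ↔ Legal V I s l ∧ Legal V I (run V I s l) l' := by
  intro l; induction l with
  | nil => intro l' s; simp [Legal, run]
  | cons x t ih => intro l' s; simp only [List.cons_append, run, Legal, ih]; tauto

theorem run_snd {d : ℕ} (V : Finset (Site d)) (I : Stacks d) :
    ∀ (l : List (Site d)) (s : State d) (x : Site d), (run V I s l).2 x = s.2 x + l.count x := by
  intro l; induction l with
  | nil => intro s x; simp [run]
  | cons y t ih =>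
    intro s x
    simp only [run, ih, topple_eq, topI, List.count_cons]
    by_cases h : x = y
    · subst h; simp; omega
    · have : y ≠ x := fun h' => h h'.symm
      simp [Function.update_of_ne h, this]

/-! Finite dependence -/

theorem legal_congr {d : ℕ} (V : Finset (Site d)) (I J : Stacks d) :
    ∀ (l : List (Site d)) (s : State d),
      (∀ x ∈ V, ∀ k, s.2 x ≤ k → k < s.2 x + l.length → I (x, k) = J (x, k)) →
      (Legal V I s l → Legal V J s l) := by
  intro l; induction l with
  | nil => intro s _ _; trivial
  | cons x t ih =>
    intro s h hl
    have h0 : topple V J x s = topple V I x s := by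
      rw [topple_eq, topple_eq, h x hl.1 (s.2 x) le_rfl (by simp)]
    refine ⟨hl.1, hl.2.1, ?_⟩
    rw [h0]
    refine ih _ (fun y hy k hk1 hk2 => h y hy k ?_ ?_) hl.2.2
    · refine le_trans ?_ hk1
      rw [topple_eq]; simp only [topI, Function.update_apply]; split_ifs with hh
      · subst hh; omega
      · exact le_rfl
    · rw [topple_eq] at hk2
      simp only [topI, Function.update_apply] at hk2
      simp only [List.length_cons]
      split_ifs at hk2 with hh
      · subst hh; omega
      · omega

/-! Translation -/

/-- translation of stacks -/
def shiftI {d : ℕ} (z : Site d) (I : Stacks d) : Stacks d := fun p => I (p.1 + z, p.2)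

def shiftS {d : ℕ} (z : Site d) (s : State d) : State d :=
  (fun x => s.1 (x + z), fun x => s.2 (x + z))

theorem app_shift {d : ℕ} (V V' : Finset (Site d)) (z : Site d) (hV : ∀ x, x ∈ V' ↔ x + z ∈ V)
    (x : Site d) (i : Instr d) (σ : Config d) (w : Site d) :
    app V' x i (fun y => σ (y + z)) w = app V (x + z) i σ (w + z) := by
  have ht : tgt V' x i = some w ↔ tgt V (x + z) i = some (w + z) := by
    rcases i with _ | u
    · simp [tgt]
    · have e : x + u + z = x + z + u := by abel
      have : x + u = w ↔ x + z + u = w + z := by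
        rw [← e]; exact (add_left_inj z).symm
      simp only [tgt, hV, e]
      split_ifs <;> simp [this]
  have hc : (w + z = x + z) ↔ w = x := add_left_inj z
  simp only [app, ht, hc]

theorem topple_shift {d : ℕ} (V V' : Finset (Site d)) (z : Site d)
    (hV : ∀ x, x ∈ V' ↔ x + z ∈ V) (I : Stacks d) (x : Site d) (s : State d) :
    topple V' (shiftI z I) x (shiftS z s) = shiftS z (topple V I (x + z) s) := by
  rw [topple_eq, topple_eq]
  simp only [topI, shiftS, shiftI, Prod.mk.injEq]
  constructor
  · funext w; exact app_shift V V' z hV x _ _ w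
  · funext w
    have hc : (w + z = x + z) ↔ w = x := add_left_inj z
    simp only [Function.update_apply, hc]

theorem legal_shift {d : ℕ} (V V' : Finset (Site d)) (z : Site d)
    (hV : ∀ x, x ∈ V' ↔ x + z ∈ V) (I : Stacks d) :
    ∀ (l : List (Site d)) (s : State d),
      Legal V' (shiftI z I) (shiftS z s) l ↔ Legal V I s (l.map (· + z)) := by
  intro l; induction l with
  | nil => intro s; simp [Legal]
  | cons x t ih =>
    intro s
    simp only [Legal, List.map_cons, topple_shift V V' z hV, ih, hV]
    rfl

theorem initState_shift {d : ℕ} (V V' : Finset (Site d)) (z : Site d)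
    (hV : ∀ x, x ∈ V' ↔ x + z ∈ V) (η : Site d → ℕ) :
    initState d V' (shift z η) = shiftS z (initState d V η) := by
  simp only [initState, shiftS, shift, hV]

/-! Mass -/

theorem cnt_dep {d : ℕ} (i : Instr d) (s : SiteState) (h : 1 ≤ numActive s) :
    cnt (dep i s) + (if i = none then 0 else 1) = cnt s := by
  rcases s with n | _
  · simp only [numActive] at h
    rcases i with _ | z
    · simp only [dep, numActive]; split_ifs <;> simp_all [cnt]
    · simp only [dep, numActive, cnt, reduceCtorEq, if_false]; omega
  · simp [numActive] at h

theorem cnt_add (s : SiteState) : cnt (addParticle s) = cnt s + 1 := by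
  rcases s with n | _ <;> simp [cnt, addParticle]

/-- linear statistics -/
def lin {d : ℕ} (V : Finset (Site d)) (g : Site d → ℝ) (σ : Config d) : ℝ :=
  ∑ y ∈ V, (cnt (σ y) : ℝ) * g y

theorem lin_app_none {d : ℕ} (V : Finset (Site d)) (g : Site d → ℝ) (σ : Config d) (x : Site d)
    (h : 1 ≤ numActive (σ x)) : lin V g (app V x none σ) = lin V g σ := by
  refine Finset.sum_congr rfl fun y _ => ?_
  congr 2
  simp only [app, tgt, reduceCtorEq, if_false]
  split_ifs with hy
  · subst hy; simpa using cnt_dep (d := d) none (σ y) h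
  · rfl

theorem lin_app_some {d : ℕ} (V : Finset (Site d)) (g : Site d → ℝ) (σ : Config d) (x z : Site d)
    (hx : x ∈ V) (h : 1 ≤ numActive (σ x)) :
    lin V g (app V x (some z) σ) = lin V g σ - g x + (if x + z ∈ V then g (x + z) else 0) := by
  have key : ∀ y, (cnt (app V x (some z) σ y) : ℝ) * g y = (cnt (σ y) : ℝ) * g y
      - (if y = x then g y else 0) + (if y = x + z then (if x + z ∈ V then g y else 0) else 0) := by
    intro y
    have h1 : (cnt (if y = x then dep (some z) (σ x) else σ y) : ℝ) =
        cnt (σ y) - (if y = x then 1 else 0) := by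
      split_ifs with hy
      · subst hy
        have := cnt_dep (d := d) (some z) (σ y) h
        simp only [reduceCtorEq, if_false] at this
        rw [← this]; push_cast; ring
      · simp
    simp only [app, tgt]
    by_cases hV : x + z ∈ V
    · simp only [hV, if_true, Option.some.injEq]
      by_cases hy : y = x + z
      · rw [if_pos hy.symm, cnt_add, if_pos hy]
        push_cast
        rw [h1]; split_ifs <;> ring
      · rw [if_neg (fun h => hy h.symm), if_neg hy, h1]
        split_ifs <;> ring
    · simp only [hV, if_false, reduceCtorEq, h1]
      split_ifs <;> ring
  unfold lin
  rw [Finset.sum_congr rfl (fun y _ => key y), Finset.sum_add_distrib, Finset.sum_sub_distrib]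
  rw [Finset.sum_ite_eq' V x, if_pos hx, Finset.sum_ite_eq' V (x + z)]
  split_ifs <;> simp

theorem cnt_eq_one_of_sleeping {s : SiteState} (h : s = .sleeping) : cnt s = 1 := by
  subst h; rfl

theorem cnt_le_one_of_stable {s : SiteState} (h : numActive s = 0) : cnt s ≤ 1 := by
  rcases s with n | _
  · simp only [numActive] at h; simp [cnt, h]
  · simp [cnt]

theorem numActive_le_cnt (s : SiteState) : numActive s ≤ cnt s := by
  rcases s with n | _ <;> simp [cnt, numActive]

theorem lin_one_topple {d : ℕ} (V : Finset (Site d)) (I : Stacks d) (x : Site d) (s : State d)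
    (hx : x ∈ V) (h : 1 ≤ numActive (s.1 x)) :
    lin V (fun _ => 1) (topple V I x s).1 ≤ lin V (fun _ => 1) s.1 := by
  rw [topple_eq]
  simp only [topI]
  rcases I (x, s.2 x) with _ | z
  · rw [lin_app_none _ _ _ _ h]
  · rw [lin_app_some _ _ _ _ _ hx h]; split_ifs <;> norm_num

theorem lin_one_run {d : ℕ} (V : Finset (Site d)) (I : Stacks d) :
    ∀ (l : List (Site d)) (s : State d), Legal V I s l →
      lin V (fun _ => 1) (run V I s l).1 ≤ lin V (fun _ => 1) s.1 := by
  intro l; induction l with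
  | nil => intro s _; exact le_rfl
  | cons x t ih =>
    intro s hl
    exact (ih _ hl.2.2).trans (lin_one_topple V I x s hl.1 hl.2.1)

/-- the final configuration has a sleeping particle at `x` -/
def Fin_ {d : ℕ} (V : Finset (Site d)) (I : Stacks d) (η : Site d → ℕ) (x : Site d) : Prop :=
  ∃ l, Legal V I (initState d V η) l ∧ Stable V (run V I (initState d V η) l).1 ∧
    (run V I (initState d V η) l).1 x = .sleeping

theorem sum_Fin_le {d : ℕ} (V : Finset (Site d)) (I : Stacks d) (η : Site d → ℕ) :
    (∑ x ∈ V, if Fin_ V I η x then (1 : ℝ≥0∞) else 0) ≤ ∑ x ∈ V, (η x : ℝ≥0∞) := by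
  by_cases h : ∃ x, Fin_ V I η x
  · obtain ⟨x0, l, hl, hst, _⟩ := h
    have h1 : ∀ x, Fin_ V I η x → (run V I (initState d V η) l).1 x = .sleeping := by
      rintro x ⟨l', hl', hst', hx⟩
      rw [(abelian V I l l' _ hl hl' hst').2 hst]; exact hx
    have h2 := lin_one_run V I l _ hl
    have h3 : (∑ x ∈ V, cnt ((run V I (initState d V η) l).1 x)) ≤ ∑ x ∈ V, η x := by
      have h4 : lin V (fun _ => 1) (initState d V η).1 = ∑ x ∈ V, (η x : ℝ) := by
        refine Finset.sum_congr rfl fun y hy => ?_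
        simp [initState, hy, cnt]
      rw [h4] at h2
      simp only [lin, mul_one] at h2
      exact_mod_cast h2
    have h5 : (∑ x ∈ V, if Fin_ V I η x then (1 : ℕ) else 0) ≤ ∑ x ∈ V, η x := by
      refine le_trans (Finset.sum_le_sum fun x _ => ?_) h3
      split_ifs with hx
      · rw [cnt_eq_one_of_sleeping (h1 x hx)]
      · exact Nat.zero_le _
    have := (Nat.cast_le (α := ℝ≥0∞)).2 h5
    push_cast at this
    exact this
  · push Not at h
    simp [h]

/-! Neighbour argument -/

theorem cnt_app_of_ne {d : ℕ} (V : Finset (Site d)) (x w : Site d) (i : Instr d)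
    (σ : Config d) (h : w ≠ x) : cnt (app V x i σ w) = cnt (σ w) + (if tgt V x i = some w then 1 else 0) := by
  simp only [app, h, if_false]
  split_ifs
  · exact cnt_add _
  · rfl

theorem cnt_le_app {d : ℕ} (V : Finset (Site d)) (x w : Site d) (i : Instr d)
    (σ : Config d) (hx : 1 ≤ numActive (σ x)) : cnt (σ w) ≤ cnt (app V x i σ w) + (if w = x then 1 else 0) := by
  have h1 : cnt (σ w) ≤ cnt (if w = x then dep i (σ x) else σ w) + (if w = x then 1 else 0) := by
    split_ifs with h
    · subst h; rw [← cnt_dep i (σ w) hx]; split_ifs <;> omega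
    · omega
  simp only [app]
  split_ifs at h1 ⊢ <;> (try simp only [cnt_add]) <;> omega

/-- number of the first `n` instructions at `x` that jump by `z` -/
def nj {d : ℕ} (I : Stacks d) (x z : Site d) (m n : ℕ) : ℕ :=
  ((Finset.Ico m n).filter (fun k => I (x, k) = some z)).card

theorem cnt_run {d : ℕ} (V : Finset (Site d)) (I : Stacks d) (x z : Site d) (hz : z ≠ 0)
    (hV : x + z ∈ V) : ∀ (l : List (Site d)) (s : State d), Legal V I s l →
      cnt (s.1 (x + z)) + nj I x z (s.2 x) (s.2 x + l.count x) ≤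
        cnt ((run V I s l).1 (x + z)) + l.count (x + z) := by
  intro l; induction l with
  | nil => intro s _; simp [nj, run]
  | cons y t ih =>
    intro s hl
    have := ih _ hl.2.2
    simp only [run]
    have hne : x + z ≠ x := by simpa using hz
    rw [topple_eq] at this ⊢
    simp only [topI] at this ⊢
    by_cases hy : y = x
    · subst hy
      simp only [Function.update_self] at this
      have hc : List.count (y + z) (y :: t) = List.count (y + z) t := by
        rw [List.count_cons_of_ne]; exact hne.symm
      rw [hc, List.count_cons_self]
      refine le_trans ?_ this
      rw [cnt_app_of_ne _ _ _ _ _ hne]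
      have e : nj I y z (s.2 y) (s.2 y + (t.count y + 1)) =
          (if I (y, s.2 y) = some z then 1 else 0) + nj I y z (s.2 y + 1) (s.2 y + 1 + t.count y) := by
        unfold nj
        rw [← Finset.insert_Ico_add_one_left_eq_Ico (by omega : s.2 y < s.2 y + (t.count y + 1)), Finset.filter_insert]
        have e2 : s.2 y + (t.count y + 1) = s.2 y + 1 + t.count y := by omega
        rw [e2]
        split_ifs
        · rw [Finset.card_insert_of_notMem (by simp)]; omega
        · omega
      rw [e]
      by_cases h1 : I (y, s.2 y) = some z
      · simp only [h1, tgt, hV, if_true]; omega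
      · simp only [h1, if_false]; omega
    · have hyx : x ≠ y := fun h => hy h.symm
      simp only [Function.update_of_ne hyx] at this
      rw [List.count_cons_of_ne hy]
      have h2 := cnt_le_app V y (x + z) (I (y, s.2 y)) s.1 hl.2.1
      rw [List.count_cons]
      by_cases h3 : x + z = y
      · rw [if_pos h3] at h2
        simp only [h3, beq_self_eq_true, if_true] at h2 this ⊢; omega
      · have h4 : ¬ y = x + z := fun h => h3 h.symm
        simp only [h3, h4, beq_iff_eq, if_false] at h2 ⊢; omega

/-- `y` can be toppled at least `n` times in `V`. -/
def Top {d : ℕ} (V : Finset (Site d)) (I : Stacks d) (η : Site d → ℕ) (y : Site d) (n : ℕ) : Prop :=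
  ∃ l, Legal V I (initState d V η) l ∧ n ≤ l.count y

theorem Top_neighbour {d : ℕ} (V : Finset (Site d)) (I : Stacks d) (η : Site d → ℕ) (x z : Site d)
    (hz : z ≠ 0) (hV : x + z ∈ V) (n m : ℕ) (hn : Top V I η x n) (hm : m + 1 ≤ nj I x z 0 n) :
    Top V I η (x + z) m := by
  obtain ⟨l, hl, hc⟩ := hn
  have hj : m + 1 ≤ nj I x z 0 (l.count x) := hm.trans (by
    unfold nj; exact Finset.card_le_card (Finset.filter_subset_filter _ (Finset.Ico_subset_Ico_right hc)))
  have : ∀ k, k ≤ m → ∃ l', Legal V I (initState d V η) l' ∧ l'.count x = l.count x ∧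
      k ≤ l'.count (x + z) := by
    intro k
    induction k with
    | zero => intro _; exact ⟨l, hl, rfl, Nat.zero_le _⟩
    | succ k ih =>
      intro hk
      obtain ⟨l', h1, h2, h3⟩ := ih (by omega)
      by_cases h4 : k + 1 ≤ l'.count (x + z)
      · exact ⟨l', h1, h2, h4⟩
      · have h5 := cnt_run V I x z hz hV l' _ h1
        simp only [initState, zero_add] at h5
        rw [h2] at h5
        have h6 : 2 ≤ cnt ((run V I (initState d V η) l').1 (x + z)) := by
          simp only [initState]; omega
        have h7 : 1 ≤ numActive ((run V I (initState d V η) l').1 (x + z)) := by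
          revert h6
          rcases (run V I (initState d V η) l').1 (x + z) with a | _
          · simp only [cnt, numActive]; omega
          · simp [cnt]
        refine ⟨l' ++ [x + z], (legal_append _ _ _ _ _).2 ⟨h1, hV, h7, trivial⟩, ?_, ?_⟩
        · rw [List.count_append, h2, List.count_cons_of_ne (by simpa using hz)]; simp
        · rw [List.count_append]; simp; omega
  obtain ⟨l', h1, _, h3⟩ := this m le_rfl
  exact ⟨l', h1, h3⟩

theorem Top_mono {d : ℕ} {V V' : Finset (Site d)} (hV : V ⊆ V') {I : Stacks d} {η : Site d → ℕ}
    {y : Site d} {n : ℕ} (h : Top V I η y n) : Top V' I η y n := by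
  obtain ⟨l, hl, hc⟩ := h
  exact ⟨l, legal_init_mono hV I η l hl, hc⟩

theorem Top_anti {d : ℕ} {V : Finset (Site d)} {I : Stacks d} {η : Site d → ℕ}
    {y : Site d} {n m : ℕ} (hnm : m ≤ n) (h : Top V I η y n) : Top V I η y m := by
  obtain ⟨l, hl, hc⟩ := h
  exact ⟨l, hl, hnm.trans hc⟩

theorem Top_shift {d : ℕ} (V V' : Finset (Site d)) (z : Site d)
    (hV : ∀ x, x ∈ V' ↔ x + z ∈ V) (I : Stacks d) (η : Site d → ℕ) (y : Site d) (n : ℕ) :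
    Top V' (shiftI z I) (shift z η) y n ↔ Top V I η (y + z) n := by
  unfold Top
  rw [initState_shift V V' z hV]
  constructor
  · rintro ⟨l, hl, hc⟩
    refine ⟨l.map (· + z), (legal_shift V V' z hV I l _).1 hl, ?_⟩
    rw [List.count_map_of_injective l (· + z) (add_left_injective z)]; exact hc
  · rintro ⟨l, hl, hc⟩
    have e : (l.map (· + -z)).map (· + z) = l := by simp [Function.comp_def]
    refine ⟨l.map (· + -z), (legal_shift V V' z hV I _ _).2 (by rw [e]; exact hl), ?_⟩
    rw [← List.count_map_of_injective _ (· + z) (add_left_injective z), e]; exact hc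

end
end ARW

end


section
open MeasureTheory ENNReal Filter
set_option linter.unusedSimpArgs false

namespace ARW

noncomputable section
open scoped Classical

/-! ### The stack law -/

instance instMSCInstr (d : ℕ) : MeasurableSingletonClass (Instr d) := ⟨fun _ => trivial⟩
instance instDMSInstr (d : ℕ) : DiscreteMeasurableSpace (Instr d) := ⟨fun _ => trivial⟩
instance instCountInstr (d : ℕ) : Countable (Instr d) := by unfold Instr Site; infer_instance

/-- unit vectors -/
def nbrs : Finset (Site 2) := {![1, 0], ![-1, 0], ![0, 1], ![0, -1]}

theorem site_ext {x y : Site 2} : x = y ↔ x 0 = y 0 ∧ x 1 = y 1 := by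
  constructor
  · rintro rfl; exact ⟨rfl, rfl⟩
  · rintro ⟨h0, h1⟩; funext i; fin_cases i
    · exact h0
    · exact h1

theorem mem_nbrs (z : Site 2) : z ∈ nbrs ↔ (∑ i, (z i).natAbs) = 1 := by
  simp only [nbrs, Finset.mem_insert, Finset.mem_singleton, site_ext, Fin.sum_univ_two]
  simp only [Matrix.cons_val_zero, Matrix.cons_val_one]
  omega

theorem sum_nbrs {M : Type*} [AddCommMonoid M] (f : Site 2 → M) :
    ∑ z ∈ nbrs, f z = f ![1, 0] + (f ![-1, 0] + (f ![0, 1] + f ![0, -1])) := by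
  unfold nbrs
  rw [Finset.sum_insert, Finset.sum_insert, Finset.sum_insert, Finset.sum_singleton] <;>
    simp [site_ext]

theorem step_nbrs {z : Site 2} (h : z ∈ nbrs) : ssrwStep 2 z = 1 / 4 := by
  rw [mem_nbrs] at h; simp [ssrwStep, h]; norm_num

theorem step_not_nbrs {z : Site 2} (h : z ∉ nbrs) : ssrwStep 2 z = 0 := by
  rw [mem_nbrs] at h; unfold ssrwStep; rw [if_neg h]

theorem ne_zero_of_nbrs {z : Site 2} (h : z ∈ nbrs) : z ≠ 0 := by
  rintro rfl; rw [mem_nbrs] at h; simp at h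

theorem card_nbrs : nbrs.card = 4 := by
  have := sum_nbrs (fun _ => 1); simpa using this

theorem lamJ_pos {lam : ℝ} (h : 0 < lam) : 0 < lamJ lam := by unfold lamJ; positivity
theorem lamS_pos {lam : ℝ} (h : 0 < lam) : 0 < lamS lam := by unfold lamS; positivity
theorem lamS_add_lamJ {lam : ℝ} (h : 0 < lam) : lamS lam + lamJ lam = 1 := by
  unfold lamS lamJ; field_simp; ring

/-- weights of instructions -/
def wt (lam : ℝ) (i : Instr 2) : ℝ := match i with
  | none => lamS lam
  | some _ => lamJ lam / 4

theorem wt_pos {lam : ℝ} (h : 0 < lam) (i : Instr 2) : 0 < wt lam i := by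
  rcases i with _ | z
  · exact lamS_pos h
  · have := lamJ_pos h; simp only [wt]; positivity

/-- possible instructions -/
def instrs : Finset (Instr 2) := Finset.insertNone nbrs

theorem instrWeight_of_mem {lam : ℝ} (h : 0 < lam) {i : Instr 2} (hi : i ∈ instrs) :
    instrWeight (ssrwStep 2) lam i = ENNReal.ofReal (wt lam i) := by
  rcases i with _ | z
  · rfl
  · have : z ∈ nbrs := by simpa [instrs] using hi
    simp only [instrWeight, wt, step_nbrs this]
    rw [← ENNReal.ofReal_mul (lamJ_pos h).le]; congr 1; ring

theorem instrWeight_of_not_mem {lam : ℝ} {i : Instr 2} (hi : i ∉ instrs) :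
    instrWeight (ssrwStep 2) lam i = 0 := by
  rcases i with _ | z
  · simp [instrs] at hi
  · have : z ∉ nbrs := by simpa [instrs] using hi
    simp [instrWeight, step_not_nbrs this]

theorem sum_instrs (f : Instr 2 → ℝ) : ∑ i ∈ instrs, f i = f none + ∑ z ∈ nbrs, f (some z) := by
  unfold instrs; rw [Finset.sum_insertNone]

theorem sum_wt {lam : ℝ} (h : 0 < lam) : ∑ i ∈ instrs, wt lam i = 1 := by
  rw [sum_instrs]; simp only [wt, Finset.sum_const, card_nbrs]
  rw [← lamS_add_lamJ h]; simp; ring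

theorem sum_instrWeight {lam : ℝ} (h : 0 < lam) :
    ∑ i ∈ instrs, instrWeight (ssrwStep 2) lam i = 1 := by
  rw [Finset.sum_congr rfl (fun i hi => instrWeight_of_mem h hi),
    ← ENNReal.ofReal_sum_of_nonneg (fun i _ => (wt_pos h i).le), sum_wt h, ENNReal.ofReal_one]

/-- law of one instruction -/
def kap (lam : ℝ) (h : 0 < lam) : Measure (Instr 2) :=
  (PMF.ofFinset (instrWeight (ssrwStep 2) lam) instrs (sum_instrWeight h)
    (fun _ ha => instrWeight_of_not_mem ha)).toMeasure

instance instProbKap (lam : ℝ) (h : 0 < lam) : IsProbabilityMeasure (kap lam h) := by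
  unfold kap; infer_instance

theorem kap_singleton (lam : ℝ) (h : 0 < lam) (i : Instr 2) :
    kap lam h {i} = instrWeight (ssrwStep 2) lam i := by
  unfold kap; rw [PMF.toMeasure_apply_singleton _ _ (measurableSet_singleton i)]; rfl

/-- product law -/
def muP (lam : ℝ) (h : 0 < lam) : Measure (Stacks 2) :=
  Measure.infinitePi (fun _ : Site 2 × ℕ => kap lam h)

instance instProbMuP (lam : ℝ) (h : 0 < lam) : IsProbabilityMeasure (muP lam h) := by
  unfold muP; infer_instance

theorem muP_isStackLaw (lam : ℝ) (h : 0 < lam) : IsStackLaw 2 (ssrwStep 2) lam (muP lam h) := by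
  refine ⟨inferInstance, fun F g => ?_⟩
  have : {I : Stacks 2 | ∀ i ∈ F, I i = g i} = Set.pi (F : Set (Site 2 × ℕ)) (fun i => {g i}) := by
    ext I; simp [Set.mem_pi]
  rw [this, muP, Measure.infinitePi_pi _ (fun i _ => measurableSet_singleton _)]
  exact Finset.prod_congr rfl fun i _ => kap_singleton lam h _

theorem stackLaw_unique (lam : ℝ) (h : 0 < lam) (μ : Measure (Stacks 2))
    (hμ : IsStackLaw 2 (ssrwStep 2) lam μ) : μ = muP lam h := by
  have hmu : ∀ (F : Finset (Site 2 × ℕ)), μ.map F.restrict = (muP lam h).map F.restrict := by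
    intro F
    apply Measure.ext_of_singleton
    intro a
    rw [Measure.map_apply (Finset.measurable_restrict F) (measurableSet_singleton a),
      Measure.map_apply (Finset.measurable_restrict F) (measurableSet_singleton a)]
    have : (F.restrict : Stacks 2 → (F → Instr 2)) ⁻¹' {a} = {I : Stacks 2 | ∀ i ∈ F, I i = (if hi : i ∈ F then a ⟨i, hi⟩ else none)} := by
      ext I
      simp only [Set.mem_preimage, Set.mem_singleton_iff, Set.mem_ofPred_eq]
      constructor
      · rintro rfl i hi; simp [hi]
      · intro hI; funext i; have := hI i i.2; simpa using this
    rw [this, hμ.2, (muP_isStackLaw lam h).2]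
  have h1 := Measure.isProjectiveLimit_infinitePi (fun _ : Site 2 × ℕ => kap lam h)
  refine IsProjectiveLimit.unique ?_ h1
  intro F
  rw [hmu F]; exact h1 F

theorem stackLaw_eq (lam : ℝ) (h : 0 < lam) : stackLaw 2 (ssrwStep 2) lam = muP lam h := by
  have hex : ∃ μ, IsStackLaw 2 (ssrwStep 2) lam μ := ⟨_, muP_isStackLaw lam h⟩
  unfold stackLaw
  rw [dif_pos hex]
  exact stackLaw_unique lam h _ hex.choose_spec

/-- dependence on finitely many coordinates -/
def DepOn (F : Finset (Site 2 × ℕ)) (A : Set (Stacks 2)) : Prop :=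
  ∀ I J : Stacks 2, (∀ p ∈ F, I p = J p) → I ∈ A → J ∈ A

theorem DepOn.eq {F : Finset (Site 2 × ℕ)} {A : Set (Stacks 2)} (h : DepOn F A) :
    A = (fun (I : Stacks 2) (i : F) => I i) ⁻¹' ((fun (I : Stacks 2) (i : F) => I i) '' A) := by
  refine Set.Subset.antisymm (Set.subset_preimage_image _ _) ?_
  rintro J ⟨I, hI, hIJ⟩
  exact h I J (fun p hp => congrFun hIJ ⟨p, hp⟩) hI

theorem DepOn.measurableSet {F : Finset (Site 2 × ℕ)} {A : Set (Stacks 2)} (h : DepOn F A) :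
    MeasurableSet A := by
  rw [h.eq]
  refine measurableSet_preimage ?_ (Set.to_countable _).measurableSet
  exact measurable_pi_lambda _ fun i => measurable_pi_apply _

theorem DepOn.mono {F G : Finset (Site 2 × ℕ)} (hFG : F ⊆ G) {A : Set (Stacks 2)} (h : DepOn F A) :
    DepOn G A := fun I J hIJ => h I J (fun p hp => hIJ p (hFG hp))

theorem DepOn.indep {lam : ℝ} {h : 0 < lam} {F G : Finset (Site 2 × ℕ)} {A B : Set (Stacks 2)}
    (hA : DepOn F A) (hB : DepOn G B) (hFG : Disjoint F G) :
    muP lam h (A ∩ B) = muP lam h A * muP lam h B := by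
  have h1 : ProbabilityTheory.iIndepFun (fun (p : Site 2 × ℕ) (I : Stacks 2) => I p) (muP lam h) :=
    ProbabilityTheory.iIndepFun_infinitePi (P := fun _ : Site 2 × ℕ => kap lam h)
      (X := fun _ i => i) (fun _ => measurable_id)
  have h2 := h1.indepFun_finset F G hFG (fun p => measurable_pi_apply p)
  rw [ProbabilityTheory.indepFun_iff_measure_inter_preimage_eq_mul] at h2
  have := h2 ((fun (I : Stacks 2) (i : F) => I i) '' A) ((fun (I : Stacks 2) (i : G) => I i) '' B)
    (Set.to_countable _).measurableSet (Set.to_countable _).measurableSet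
  rw [← hA.eq, ← hB.eq] at this
  exact this

theorem muP_coord (lam : ℝ) (h : 0 < lam) (p : Site 2 × ℕ) (i : Instr 2) :
    muP lam h {I | I p = i} = instrWeight (ssrwStep 2) lam i := by
  have := (muP_isStackLaw lam h).2 {p} (fun _ => i)
  simpa using this

theorem ae_instrs (lam : ℝ) (h : 0 < lam) : ∀ᵐ I ∂(muP lam h), ∀ p, I p ∈ instrs := by
  rw [ae_all_iff]; intro p
  have : {I : Stacks 2 | ¬ I p ∈ instrs} = ⋃ i ∈ ((instrs : Set (Instr 2))ᶜ), {I | I p = i} := by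
    ext I; simp
  rw [ae_iff, this, measure_biUnion_null_iff (Set.to_countable _)]
  intro i hi
  rw [muP_coord, instrWeight_of_not_mem (by simpa using hi)]

/-- one step decomposition -/
theorem muP_step (lam : ℝ) (h : 0 < lam) (p : Site 2 × ℕ) (F : Finset (Site 2 × ℕ)) (hp : p ∉ F)
    (A : Instr 2 → Set (Stacks 2)) (hA : ∀ i, DepOn F (A i)) :
    muP lam h {I | I ∈ A (I p)} = ∑ i ∈ instrs, ENNReal.ofReal (wt lam i) * muP lam h (A i) := by
  have hd : ∀ i, DepOn {p} {I : Stacks 2 | I p = i} := by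
    intro i I J hIJ hI
    simp only [Set.mem_ofPred_eq] at hI ⊢
    rw [← hIJ p (by simp)]; exact hI
  have h1 : muP lam h {I | I ∈ A (I p)} = muP lam h (⋃ i ∈ instrs, ({I | I p = i} ∩ A i)) := by
    refine measure_congr ?_
    filter_upwards [ae_instrs lam h] with I hI
    apply propext
    change I ∈ A (I p) ↔ I ∈ ⋃ i ∈ instrs, ({I | I p = i} ∩ A i)
    simp only [Set.mem_iUnion, Set.mem_inter_iff, Set.mem_ofPred_eq, exists_prop]
    constructor
    · intro hh; exact ⟨_, hI p, rfl, hh⟩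
    · rintro ⟨i, _, rfl, hh⟩; exact hh
  rw [h1, measure_biUnion_finset]
  · refine Finset.sum_congr rfl fun i hi => ?_
    rw [DepOn.indep (hd i) (hA i) (by simpa using hp), muP_coord, instrWeight_of_mem h hi]
  · intro i _ j _ hij
    refine Set.disjoint_left.2 ?_
    rintro I ⟨h1, _⟩ ⟨h2, _⟩
    exact hij (h1.symm.trans h2)
  · intro i _; exact (hd i).measurableSet.inter (hA i).measurableSet

theorem measurable_shiftI (z : Site 2) : Measurable (shiftI (d := 2) z) :=
  measurable_pi_lambda _ fun _ => measurable_pi_apply _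

theorem muP_shift (lam : ℝ) (h : 0 < lam) (z : Site 2) :
    (muP lam h).map (shiftI z) = muP lam h := by
  apply stackLaw_unique
  refine ⟨Measure.isProbabilityMeasure_map (measurable_shiftI z).aemeasurable, fun F g => ?_⟩
  have hm : MeasurableSet {I : Stacks 2 | ∀ i ∈ F, I i = g i} := by
    refine DepOn.measurableSet (F := F) ?_
    intro I J hIJ hI i hi
    rw [← hIJ i hi]; exact hI i hi
  rw [Measure.map_apply (measurable_shiftI z) hm]
  have hinj : Function.Injective (fun p : Site 2 × ℕ => (p.1 + z, p.2)) := by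
    rintro ⟨a, b⟩ ⟨c, e⟩ hh
    simp only [Prod.mk.injEq, add_left_inj] at hh
    obtain ⟨h1, h2⟩ := hh
    have := add_right_cancel h1
    simp [this, h2]
  have := (muP_isStackLaw lam h).2 (F.map ⟨_, hinj⟩) (fun p => g (p.1 - z, p.2))
  rw [Finset.prod_map] at this
  simp only [Function.Embedding.coeFn_mk, add_sub_cancel_right] at this
  rw [← this]
  congr 1
  ext I
  simp only [shiftI, Finset.mem_map, Set.mem_preimage, Set.mem_ofPred_eq, Function.Embedding.coeFn_mk]
  constructor
  · rintro hI _ ⟨p, hp, rfl⟩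
    simpa using hI p hp
  · intro hI p hp
    simpa using hI _ ⟨p, hp, rfl⟩

theorem muP_shift_apply (lam : ℝ) (h : 0 < lam) (z : Site 2) {A : Set (Stacks 2)} (hA : MeasurableSet A) :
    muP lam h {I | shiftI z I ∈ A} = muP lam h A := by
  conv_rhs => rw [← muP_shift lam h z, Measure.map_apply (measurable_shiftI z) hA]
  rfl

/-- infinitely many jumps -/
theorem ae_jumps (lam : ℝ) (h : 0 < lam) (x z : Site 2) (hz : z ∈ nbrs) :
    ∀ᵐ I ∂(muP lam h), ∀ n, ∃ k ≥ n, I (x, k) = some z := by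
  rw [ae_all_iff]; intro n
  have hw : kap lam h {some z}ᶜ < 1 := by
    rw [measure_compl (measurableSet_singleton _) (measure_ne_top _ _), measure_univ, kap_singleton,
      instrWeight_of_mem h (by simpa [instrs] using hz)]
    refine ENNReal.sub_lt_self (by simp) (by simp) ?_
    have := wt_pos h (some z)
    simpa using this
  have hb : ∀ N : ℕ, muP lam h {I | ¬ ∃ k ≥ n, I (x, k) = some z} ≤ (kap lam h {some z}ᶜ) ^ N := by
    intro N
    have hinj : Function.Injective (fun k : ℕ => (x, n + k)) := by
      intro a b hab; simp only [Prod.mk.injEq] at hab; omega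
    have := Measure.infinitePi_pi (fun _ : Site 2 × ℕ => kap lam h)
      (s := (Finset.range N).map ⟨_, hinj⟩) (t := fun _ => {some z}ᶜ) (fun _ _ => (measurableSet_singleton _).compl)
    rw [Finset.prod_const, Finset.card_map, Finset.card_range] at this
    rw [← this]
    refine measure_mono ?_
    intro I hI
    simp only [Set.mem_ofPred_eq, not_exists, not_and] at hI
    rw [Set.mem_pi]
    rintro p hp
    simp only [Finset.coe_map, Function.Embedding.coeFn_mk, Set.mem_image, Finset.mem_coe] at hp
    obtain ⟨k, _, rfl⟩ := hp
    exact hI (n + k) (by omega)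
  rw [ae_iff]
  refine le_antisymm ?_ (by simp)
  exact ge_of_tendsto' (ENNReal.tendsto_pow_atTop_nhds_zero_of_lt_one hw) hb

theorem nj_unbounded (I : Stacks 2) (x z : Site 2) (h : ∀ n, ∃ k ≥ n, I (x, k) = some z) (m : ℕ) :
    ∃ n, m ≤ nj I x z 0 n := by
  induction m with
  | zero => exact ⟨0, Nat.zero_le _⟩
  | succ m ih =>
    obtain ⟨n, hn⟩ := ih
    obtain ⟨k, hk, hk2⟩ := h n
    refine ⟨k + 1, ?_⟩
    have : insert k ((Finset.Ico 0 n).filter (fun k => I (x, k) = some z)) ⊆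
        (Finset.Ico 0 (k + 1)).filter (fun k => I (x, k) = some z) := by
      intro j hj
      rw [Finset.mem_insert] at hj
      rcases hj with rfl | hj
      · simp [hk2]
      · simp only [Finset.mem_filter, Finset.mem_Ico] at hj ⊢
        exact ⟨⟨by omega, by omega⟩, hj.2⟩
    have h2 := Finset.card_le_card this
    rw [Finset.card_insert_of_notMem (by simp; omega)] at h2
    unfold nj at hn ⊢; omega

end
end ARW

end


section
open MeasureTheory ENNReal Filter
set_option linter.unusedSimpArgs false

namespace ARW

noncomputable section
open scoped Classical

/-! ### The chain of topplings -/

/-- states with a tag -/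
abbrev CS := State 2 × Option (Site 2)

/-- toppleable -/
def okT (V : Finset (Site 2)) (c : CS) (x : Site 2) : Prop := x ∈ V ∧ 1 ≤ numActive (c.1.1 x)

/-- policy, ignoring the tag -/
def pol0 (V : Finset (Site 2)) (o : Site 2) (c : CS) : Option (Site 2) :=
  if h : ∃ x, x ≠ o ∧ okT V c x then some h.choose
  else if okT V c o then some o else none

/-- policy -/
def pol (V : Finset (Site 2)) (o : Site 2) (c : CS) : Option (Site 2) :=
  match c.2 with
  | none => pol0 V o c
  | some y => if okT V c y then some y else pol0 V o c

theorem pol0_some {V : Finset (Site 2)} {o : Site 2} {c : CS} {x : Site 2} (h : pol0 V o c = some x) :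
    okT V c x ∧ (x = o → ∀ y, y ≠ o → ¬ okT V c y) := by
  unfold pol0 at h
  split_ifs at h with h1 h2
  · have := h1.choose_spec
    simp only [Option.some.injEq] at h
    rw [h] at this
    exact ⟨this.2, fun hx => absurd hx this.1⟩
  · simp only [Option.some.injEq] at h
    subst h
    push Not at h1
    exact ⟨h2, fun _ y hy => h1 y hy⟩

theorem pol0_none {V : Finset (Site 2)} {o : Site 2} {c : CS} (h : pol0 V o c = none) (x : Site 2) :
    ¬ okT V c x := by
  unfold pol0 at h
  split_ifs at h with h1 h2
  push Not at h1
  by_cases hx : x = o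
  · subst hx; exact h2
  · exact h1 x hx

theorem pol_some {V : Finset (Site 2)} {o : Site 2} {c : CS} {x : Site 2} (h : pol V o c = some x) :
    okT V c x := by
  unfold pol at h
  split at h
  · exact (pol0_some h).1
  · split_ifs at h with h1
    · simp only [Option.some.injEq] at h; subst h; exact h1
    · exact (pol0_some h).1

theorem pol_none {V : Finset (Site 2)} {o : Site 2} {c : CS} (h : pol V o c = none) :
    Stable V c.1.1 := by
  have : pol0 V o c = none := by
    unfold pol at h
    split at h
    · exact h
    · split_ifs at h with h1
      exact h
  intro x hx
  have := pol0_none this x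
  unfold okT at this
  push Not at this
  have := this hx; omega

/-- walking steps -/
def walking (o : Site 2) (c : CS) (x : Site 2) : Prop :=
  c.2 = some x ∨ (c.2 = none ∧ x = o ∧ numActive (c.1.1 o) = 1)

/-- new tag -/
def ntag (V : Finset (Site 2)) (o x : Site 2) : Instr 2 → Option (Site 2)
  | none => none
  | some z => if x + z ≠ o ∧ x + z ∈ V then some (x + z) else none

/-- update -/
def upd (V : Finset (Site 2)) (o : Site 2) (c : CS) (x : Site 2) (i : Instr 2) : CS :=
  (topI V x i c.1, if walking o c x then ntag V o x i else none)

/-- the transition operator -/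
def TT (lam : ℝ) (V : Finset (Site 2)) (o : Site 2) (Φ : CS → ℝ) (c : CS) : ℝ :=
  match pol V o c with
  | none => Φ c
  | some x => ∑ i ∈ instrs, wt lam i * Φ (upd V o c x i)

theorem TT_none {lam : ℝ} {V : Finset (Site 2)} {o : Site 2} {Φ : CS → ℝ} {c : CS}
    (h : pol V o c = none) : TT lam V o Φ c = Φ c := by
  unfold TT; rw [h]

theorem TT_some {lam : ℝ} {V : Finset (Site 2)} {o : Site 2} {Φ : CS → ℝ} {c : CS} {x : Site 2}
    (h : pol V o c = some x) : TT lam V o Φ c = ∑ i ∈ instrs, wt lam i * Φ (upd V o c x i) := by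
  unfold TT; rw [h]

/-- iterated operator -/
def EE (lam : ℝ) (V : Finset (Site 2)) (o : Site 2) (Φ : CS → ℝ) : ℕ → CS → ℝ
  | 0 => Φ
  | n + 1 => TT lam V o (EE lam V o Φ n)

/-- the path -/
def ch (V : Finset (Site 2)) (o : Site 2) (I : Stacks 2) : ℕ → CS → CS
  | 0, c => c
  | n + 1, c => match pol V o c with
    | none => c
    | some x => ch V o I n (upd V o c x (I (x, c.1.2 x)))

theorem TT_add (lam : ℝ) (V : Finset (Site 2)) (o : Site 2) (Φ Ψ : CS → ℝ) (c : CS) :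
    TT lam V o (fun c => Φ c + Ψ c) c = TT lam V o Φ c + TT lam V o Ψ c := by
  rcases h : pol V o c with _ | x
  · simp only [TT_none h]
  · simp only [TT_some h, mul_add, Finset.sum_add_distrib]

theorem TT_smul (lam : ℝ) (V : Finset (Site 2)) (o : Site 2) (a : ℝ) (Φ : CS → ℝ) (c : CS) :
    TT lam V o (fun c => a * Φ c) c = a * TT lam V o Φ c := by
  rcases h : pol V o c with _ | x
  · simp only [TT_none h]
  · simp only [TT_some h, Finset.mul_sum]
    exact Finset.sum_congr rfl fun i _ => by ring

theorem TT_const {lam : ℝ} (hl : 0 < lam) (V : Finset (Site 2)) (o : Site 2) (a : ℝ) (c : CS) :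
    TT lam V o (fun _ => a) c = a := by
  rcases h : pol V o c with _ | x
  · simp only [TT_none h]
  · simp only [TT_some h, ← Finset.sum_mul, sum_wt hl, one_mul]

/-- invariance of a set of states -/
def Inv (V : Finset (Site 2)) (o : Site 2) (S : CS → Prop) : Prop :=
  ∀ c x, S c → pol V o c = some x → ∀ i ∈ instrs, S (upd V o c x i)

theorem TT_mono {lam : ℝ} (hl : 0 < lam) {V : Finset (Site 2)} {o : Site 2} {S : CS → Prop}
    (hS : Inv V o S) {Φ Ψ : CS → ℝ} (h : ∀ c, S c → Φ c ≤ Ψ c) (c : CS) (hc : S c) :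
    TT lam V o Φ c ≤ TT lam V o Ψ c := by
  rcases hp : pol V o c with _ | x
  · simp only [TT_none hp]; exact h c hc
  · simp only [TT_some hp]
    exact Finset.sum_le_sum fun i hi =>
      mul_le_mul_of_nonneg_left (h _ (hS c x hc hp i hi)) (wt_pos hl i).le

theorem EE_mono {lam : ℝ} (hl : 0 < lam) {V : Finset (Site 2)} {o : Site 2} {S : CS → Prop}
    (hS : Inv V o S) {Φ Ψ : CS → ℝ} (h : ∀ c, S c → Φ c ≤ Ψ c) (n : ℕ) :
    ∀ (c : CS) (_ : S c), EE lam V o Φ n c ≤ EE lam V o Ψ n c := by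
  induction n with
  | zero => exact h
  | succ n ih => exact fun c hc => TT_mono hl hS ih c hc

theorem EE_add (lam : ℝ) (V : Finset (Site 2)) (o : Site 2) (Φ Ψ : CS → ℝ) (n : ℕ) :
    EE lam V o (fun c => Φ c + Ψ c) n = fun c => EE lam V o Φ n c + EE lam V o Ψ n c := by
  induction n with
  | zero => rfl
  | succ n ih => funext c; simp only [EE, ih]; exact TT_add _ _ _ _ _ _

theorem EE_smul (lam : ℝ) (V : Finset (Site 2)) (o : Site 2) (a : ℝ) (Φ : CS → ℝ) (n : ℕ) :
    EE lam V o (fun c => a * Φ c) n = fun c => a * EE lam V o Φ n c := by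
  induction n with
  | zero => rfl
  | succ n ih => funext c; simp only [EE, ih]; exact TT_smul _ _ _ _ _ _

theorem EE_const {lam : ℝ} (hl : 0 < lam) (V : Finset (Site 2)) (o : Site 2) (a : ℝ) (n : ℕ) :
    EE lam V o (fun _ => a) n = fun _ => a := by
  induction n with
  | zero => rfl
  | succ n ih => funext c; simp only [EE, ih]; exact TT_const hl _ _ _ _

theorem EE_sum {ι : Type*} (lam : ℝ) (hl : 0 < lam) (V : Finset (Site 2)) (o : Site 2) (s : Finset ι)
    (Φ : ι → CS → ℝ) (n : ℕ) (c : CS) :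
    EE lam V o (fun c => ∑ j ∈ s, Φ j c) n c = ∑ j ∈ s, EE lam V o (Φ j) n c := by
  induction s using Finset.induction_on with
  | empty => simp only [Finset.sum_empty, EE_const hl]
  | insert a s ha ih => simp only [Finset.sum_insert ha, EE_add, ih]

theorem EE_sub {lam : ℝ} (hl : 0 < lam) {V : Finset (Site 2)} {o : Site 2} {S : CS → Prop}
    (hS : Inv V o S) {Φ : CS → ℝ} (h : ∀ c, S c → Φ c ≤ TT lam V o Φ c) (n : ℕ) :
    ∀ (c : CS) (_ : S c), Φ c ≤ EE lam V o Φ n c := by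
  induction n with
  | zero => exact fun c _ => le_rfl
  | succ n ih => exact fun c hc => (h c hc).trans (TT_mono hl hS ih c hc)

theorem EE_super {lam : ℝ} (hl : 0 < lam) {V : Finset (Site 2)} {o : Site 2} {S : CS → Prop}
    (hS : Inv V o S) {Φ : CS → ℝ} (h : ∀ c, S c → TT lam V o Φ c ≤ Φ c) (n : ℕ) :
    ∀ (c : CS) (_ : S c), EE lam V o Φ n c ≤ Φ c := by
  induction n with
  | zero => exact fun c _ => le_rfl
  | succ n ih => exact fun c hc => (TT_mono hl hS ih c hc).trans (h c hc)

/-- coordinates used -/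
def box2 (V : Finset (Site 2)) (m : Site 2 → ℕ) (n : ℕ) : Finset (Site 2 × ℕ) :=
  V.biUnion fun y => (Finset.Ico (m y) (m y + n)).map ⟨fun k => (y, k), fun a b h => by simpa using h⟩

theorem mem_box2 {V : Finset (Site 2)} {m : Site 2 → ℕ} {n : ℕ} {p : Site 2 × ℕ} :
    p ∈ box2 V m n ↔ p.1 ∈ V ∧ m p.1 ≤ p.2 ∧ p.2 < m p.1 + n := by
  rcases p with ⟨y, k⟩
  simp only [box2, Finset.mem_biUnion, Finset.mem_map, Finset.mem_Ico, Function.Embedding.coeFn_mk]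
  constructor
  · rintro ⟨a, ha, b, hb, hab⟩
    cases hab
    exact ⟨ha, hb⟩
  · rintro ⟨h1, h2⟩; exact ⟨y, h1, k, h2, rfl⟩

theorem ch_congr (V : Finset (Site 2)) (o : Site 2) (I J : Stacks 2) (n : ℕ) :
    ∀ c : CS, (∀ p ∈ box2 V c.1.2 n, I p = J p) → ch V o I n c = ch V o J n c := by
  induction n with
  | zero => intro c _; rfl
  | succ n ih =>
    intro c hc
    simp only [ch]
    rcases hp : pol V o c with _ | x
    · rfl
    · have hx := pol_some hp
      have h0 : I (x, c.1.2 x) = J (x, c.1.2 x) :=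
        hc _ (mem_box2.2 ⟨hx.1, le_rfl, by simp⟩)
      simp only [h0]
      refine ih _ fun p hp => hc p ?_
      rw [mem_box2] at hp ⊢
      obtain ⟨h1, h2, h3⟩ := hp
      refine ⟨h1, ?_, ?_⟩
      · simp only [upd, topI, Function.update_apply] at h2
        split_ifs at h2 with hh
        · rw [hh]; omega
        · exact h2
      · simp only [upd, topI, Function.update_apply] at h3
        split_ifs at h3 with hh
        · rw [hh]; omega
        · omega

theorem ch_depOn (V : Finset (Site 2)) (o : Site 2) (n : ℕ) (c : CS) (Q : CS → Prop) :
    DepOn (box2 V c.1.2 n) {I | Q (ch V o I n c)} := by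
  intro I J h hI
  simp only [Set.mem_ofPred_eq] at hI ⊢
  rw [← ch_congr V o I J n c h]; exact hI

theorem EE_nonneg {lam : ℝ} (hl : 0 < lam) (V : Finset (Site 2)) (o : Site 2) {Φ : CS → ℝ}
    (h : ∀ c, 0 ≤ Φ c) (n : ℕ) (c : CS) : 0 ≤ EE lam V o Φ n c := by
  have := EE_mono hl (V := V) (o := o) (S := fun _ => True) (fun _ _ _ _ _ _ => trivial)
    (Φ := fun _ => 0) (Ψ := Φ) (fun c _ => h c) n c trivial
  rwa [EE_const hl] at this

/-- indicator -/
def ind (Q : CS → Prop) (c : CS) : ℝ := if Q c then 1 else 0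

theorem ind_nonneg (Q : CS → Prop) (c : CS) : 0 ≤ ind Q c := by unfold ind; split_ifs <;> norm_num
theorem ind_le_one (Q : CS → Prop) (c : CS) : ind Q c ≤ 1 := by unfold ind; split_ifs <;> norm_num

theorem bridge (lam : ℝ) (hl : 0 < lam) (V : Finset (Site 2)) (o : Site 2) (Q : CS → Prop) (n : ℕ) :
    ∀ c : CS, muP lam hl {I | Q (ch V o I n c)} = ENNReal.ofReal (EE lam V o (ind Q) n c) := by
  induction n with
  | zero =>
    intro c
    simp only [ch, EE, ind]
    split_ifs with h
    · simp [h]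
    · simp [h]
  | succ n ih =>
    intro c
    rcases hp : pol V o c with _ | x
    · simp only [ch, EE, hp, TT_none hp]
      clear ih
      have : EE lam V o (ind Q) n c = ind Q c := by
        induction n with
        | zero => rfl
        | succ n ih2 => simp only [EE, TT_none hp, ih2]
      rw [this]
      unfold ind
      split_ifs with h
      · simp [h]
      · simp [h]
    · simp only [ch, EE, hp, TT_some hp]
      have := muP_step lam hl (x, c.1.2 x) (box2 V (Function.update c.1.2 x (c.1.2 x + 1)) n)
        (by rw [mem_box2]; simp) (fun i => {I | Q (ch V o I n (upd V o c x i))})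
        (fun i => ch_depOn V o n (upd V o c x i) Q)
      simp only [Set.mem_ofPred_eq] at this
      rw [this, ENNReal.ofReal_sum_of_nonneg]
      · refine Finset.sum_congr rfl fun i _ => ?_
        rw [ih, ENNReal.ofReal_mul (wt_pos hl i).le]
      · intro i _
        exact mul_nonneg (wt_pos hl i).le (EE_nonneg hl V o (ind_nonneg Q) n _)

/-- paths of the chain are legal toppling sequences -/
theorem ch_legal (V : Finset (Site 2)) (o : Site 2) (I : Stacks 2) (n : ℕ) :
    ∀ c : CS, ∃ l, Legal V I c.1 l ∧ run V I c.1 l = (ch V o I n c).1 := by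
  induction n with
  | zero => intro c; exact ⟨[], trivial, rfl⟩
  | succ n ih =>
    intro c
    simp only [ch]
    rcases hp : pol V o c with _ | x
    · exact ⟨[], trivial, rfl⟩
    · have hx := pol_some hp
      obtain ⟨l, h1, h2⟩ := ih (upd V o c x (I (x, c.1.2 x)))
      have e : (upd V o c x (I (x, c.1.2 x))).1 = topple V I x c.1 := by rw [topple_eq]; rfl
      rw [e] at h1 h2
      exact ⟨x :: l, ⟨hx.1, hx.2, h1⟩, h2⟩

/-- initial state of the chain -/
def c0 (V : Finset (Site 2)) (η : Site 2 → ℕ) : CS := (initState 2 V η, none)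

/-- not stopped -/
def ns (V : Finset (Site 2)) (o : Site 2) (c : CS) : Prop := pol V o c ≠ none

/-- average over neighbours -/
def Pav (f : Site 2 → ℝ) (x : Site 2) : ℝ := (∑ z ∈ nbrs, f (x + z)) / 4

/-- killing outside `V` -/
def kil (V : Finset (Site 2)) (g : Site 2 → ℝ) (x : Site 2) : ℝ := if x ∈ V then g x else 0

theorem exp_lin {lam : ℝ} (hl : 0 < lam) (V : Finset (Site 2)) (g : Site 2 → ℝ) (σ : Config 2)
    (x : Site 2) (hx : x ∈ V) (h : 1 ≤ numActive (σ x)) :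
    ∑ i ∈ instrs, wt lam i * lin V g (app V x i σ) =
      lin V g σ + lamJ lam * (Pav (kil V g) x - g x) := by
  rw [sum_instrs, lin_app_none V g σ x h]
  simp only [lin_app_some V g σ x _ hx h, wt, Pav, kil]
  rw [← Finset.mul_sum, Finset.sum_add_distrib, Finset.sum_const, card_nbrs]
  have := lamS_add_lamJ hl
  have e : lamS lam = 1 - lamJ lam := by linarith
  rw [e]; simp only [nsmul_eq_mul]; push_cast; ring

/-- F1 -/
theorem ns_bound {lam : ℝ} (hl : 0 < lam) (V : Finset (Site 2)) (o : Site 2) (w : Site 2 → ℝ)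
    (hw2 : ∀ x, x ∈ V → Pav (kil V w) x ≤ w x - 1) (n : ℕ) :
    ∀ c : CS, EE lam V o (fun c => lin V w c.1.1) n c + n * lamJ lam * EE lam V o (ind (ns V o)) n c ≤
      lin V w c.1.1 := by
  induction n with
  | zero => intro c; simp [EE]
  | succ n ih =>
    intro c
    rcases hp : pol V o c with _ | x
    · have h0 : ∀ (Φ : CS → ℝ) n, EE lam V o Φ n c = Φ c := by
        intro Φ n
        induction n with
        | zero => rfl
        | succ n ih2 => simp only [EE, TT_none hp, ih2]
      rw [h0, h0]
      simp [ind, ns, hp]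
    · have h1 := TT_mono hl (V := V) (o := o) (S := fun _ => True) (fun _ _ _ _ _ _ => trivial)
        (fun c _ => ih c) c trivial
      rw [TT_add, TT_smul] at h1
      have h2 : TT lam V o (fun c => lin V w c.1.1) c ≤ lin V w c.1.1 - lamJ lam := by
        have hx := pol_some hp
        rw [TT_some hp]
        simp only [upd, topI]
        rw [exp_lin hl V w _ x hx.1 hx.2]
        have := hw2 x hx.1
        have := lamJ_pos hl
        nlinarith
      have h3 : EE lam V o (ind (ns V o)) (n + 1) c ≤ 1 := by
        have := EE_mono hl (V := V) (o := o) (S := fun _ => True) (fun _ _ _ _ _ _ => trivial)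
          (fun c _ => ind_le_one (ns V o) c) (n + 1) c trivial
        rwa [EE_const hl] at this
      have h4 := lamJ_pos hl
      simp only [EE] at h3 ⊢
      push_cast
      nlinarith

/-- the standard choice of `w` -/
def wq (C : ℝ) (x : Site 2) : ℝ := C - ((x 0 : ℝ) ^ 2 + (x 1 : ℝ) ^ 2)

theorem Pav_eq (f : Site 2 → ℝ) (x : Site 2) :
    Pav f x = (f (x + ![1, 0]) + (f (x + ![-1, 0]) + (f (x + ![0, 1]) + f (x + ![0, -1])))) / 4 := by
  unfold Pav; rw [sum_nbrs]

theorem Pav_mono {f g : Site 2 → ℝ} {x : Site 2} (h : ∀ z ∈ nbrs, f (x + z) ≤ g (x + z)) : Pav f x ≤ Pav g x := by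
  unfold Pav
  have := Finset.sum_le_sum h
  linarith

theorem Pav_wq (C : ℝ) (x : Site 2) : Pav (wq C) x = wq C x - 1 := by
  rw [Pav_eq]; simp only [wq, Pi.add_apply, Matrix.cons_val_zero, Matrix.cons_val_one]
  push_cast; ring

theorem exists_wq (V : Finset (Site 2)) : ∃ C, (∀ x ∈ V, 0 ≤ wq C x) ∧
    ∀ x ∈ V, Pav (kil V (wq C)) x ≤ wq C x - 1 := by
  obtain ⟨C, hC⟩ : ∃ C : ℝ, ∀ x ∈ V, ∀ z ∈ insert 0 nbrs,
      (((x + z) 0 : ℤ) : ℝ) ^ 2 + (((x + z) 1 : ℤ) : ℝ) ^ 2 ≤ C := by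
    obtain ⟨C, hC⟩ := ((V ×ˢ insert 0 nbrs).image (fun p : Site 2 × Site 2 =>
      (((p.1 + p.2) 0 : ℤ) : ℝ) ^ 2 + (((p.1 + p.2) 1 : ℤ) : ℝ) ^ 2)).bddAbove
    refine ⟨C, fun x hx z hz => hC ?_⟩
    simp only [Finset.coe_image]
    exact ⟨(x, z), by simpa [hx] using hz, rfl⟩
  refine ⟨C, fun x hx => ?_, fun x hx => ?_⟩
  · have := hC x hx 0 (by simp)
    simp only [add_zero] at this
    unfold wq; linarith
  · rw [← Pav_wq]
    refine Pav_mono fun z hz => ?_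
    unfold kil
    split_ifs with h
    · exact le_rfl
    · have := hC x hx z (by simp [hz])
      unfold wq; linarith

theorem EE_ns_tendsto {lam : ℝ} (hl : 0 < lam) (V : Finset (Site 2)) (o : Site 2) (c : CS) :
    Tendsto (fun n => EE lam V o (ind (ns V o)) n c) atTop (nhds 0) := by
  obtain ⟨C, h1, h2⟩ := exists_wq V
  have hJ := lamJ_pos hl
  have hb : ∀ n : ℕ, 0 < n → EE lam V o (ind (ns V o)) n c ≤ (lin V (wq C) c.1.1 / lamJ lam) / n := by
    intro n hn
    have h3 := ns_bound hl V o (wq C) h2 n c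
    have h4 : 0 ≤ EE lam V o (fun c => lin V (wq C) c.1.1) n c := by
      refine EE_nonneg hl V o (fun c => Finset.sum_nonneg fun y hy => mul_nonneg (Nat.cast_nonneg _) (h1 y hy)) n c
    have hn' : (0 : ℝ) < n := by exact_mod_cast hn
    rw [le_div_iff₀ hn', le_div_iff₀ hJ]
    linarith
  refine squeeze_zero' (g := fun n : ℕ => (lin V (wq C) c.1.1 / lamJ lam) / n)
    (Eventually.of_forall fun n => EE_nonneg hl V o (ind_nonneg _) n c) ?_ ?_
  · filter_upwards [eventually_gt_atTop 0] with n hn using hb n hn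
  · exact tendsto_const_div_atTop_nhds_zero_nat _

end
end ARW

end


section
open MeasureTheory ENNReal Filter
set_option linter.unusedSimpArgs false

namespace ARW

noncomputable section
open scoped Classical

/-! ### The walk from the origin -/

/-- invariant -/
def SS (V : Finset (Site 2)) (o : Site 2) (c : CS) : Prop :=
  (∀ y, c.2 = some y → okT V c y ∧ y ≠ o ∧ c.1.1 o = .active 0 ∧ 1 ≤ c.1.2 o) ∧
    (c.1.1 o = .sleeping → Stable V c.1.1 ∧ c.2 = none)

theorem pol_cases {V : Finset (Site 2)} {o : Site 2} {c : CS} {x : Site 2} (hS : SS V o c)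
    (h : pol V o c = some x) :
    (c.2 = some x ∧ x ≠ o ∧ c.1.1 o = .active 0 ∧ 1 ≤ c.1.2 o) ∨
    (c.2 = none ∧ x ≠ o ∧ ∃ k, c.1.1 o = .active k) ∨
    (c.2 = none ∧ x = o ∧ ∃ k, c.1.1 o = .active (k + 2)) ∨
    (c.2 = none ∧ x = o ∧ c.1.1 o = .active 1 ∧ ∀ y, y ≠ o → ¬ okT V c y) := by
  have hx := pol_some h
  rcases hc : c.2 with _ | y
  · right
    have hns : c.1.1 o ≠ .sleeping := by
      intro hs
      have := (hS.2 hs).1 x hx.1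
      have := hx.2; omega
    obtain ⟨k, hk⟩ : ∃ k, c.1.1 o = .active k := by
      rcases hh : c.1.1 o with k | _
      · exact ⟨k, rfl⟩
      · exact absurd hh hns
    have hp : pol0 V o c = some x := by unfold pol at h; rw [hc] at h; exact h
    by_cases hxo : x = o
    · right
      subst hxo
      have h1 : 1 ≤ k := by have := hx.2; rw [hk] at this; exact this
      rcases k with _ | _ | k
      · omega
      · right; exact ⟨rfl, rfl, hk, (pol0_some hp).2 rfl⟩
      · left; exact ⟨rfl, rfl, k, hk⟩
    · left; exact ⟨rfl, hxo, k, hk⟩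
  · left
    obtain ⟨h1, h2, h3, h4⟩ := hS.1 y hc
    have : pol V o c = some y := by unfold pol; rw [hc]; simp [h1]
    rw [h] at this
    simp only [Option.some.injEq] at this
    subst this
    exact ⟨rfl, h2, h3, h4⟩

theorem app_at_other {V : Finset (Site 2)} {o x : Site 2} (i : Instr 2) (σ : Config 2) (hxo : x ≠ o) :
    app V x i σ o = if tgt V x i = some o then addParticle (σ o) else σ o := by
  have : o ≠ x := fun h => hxo h.symm
  simp only [app, this, if_false]

theorem app_at_self {V : Finset (Site 2)} {o : Site 2} (i : Instr 2) (hi : i ∈ instrs) (σ : Config 2) :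
    app V o i σ o = dep i (σ o) := by
  have : tgt V o i ≠ some o := by
    rcases i with _ | z
    · simp [tgt]
    · have hz : z ∈ nbrs := by simpa [instrs] using hi
      have := ne_zero_of_nbrs hz
      simp only [tgt]
      split_ifs
      · simpa using this
      · simp
  simp only [app, this, if_false, if_true]

/-- value -/
def Val (ψ : Site 2 → ℝ) (o : Site 2) (c : CS) : ℝ :=
  match c.2 with
  | some y => ψ (y - o)
  | none => if c.1.1 o = .sleeping then 1 else if 1 ≤ numActive (c.1.1 o) then ψ 0 else 0

/-- origin visited -/
def Vis (o : Site 2) (c : CS) : Prop := 1 ≤ c.1.2 o ∨ 1 ≤ numActive (c.1.1 o)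

/-- submartingale -/
def VV (ψ : Site 2 → ℝ) (o : Site 2) (c : CS) : ℝ := Val ψ o c - ψ 0 * ind (Vis o) c

theorem SS_tag {V : Finset (Site 2)} {o x z : Site 2} {c : CS} (hw : walking o c x)
    (h1 : x + z ≠ o) (h2 : x + z ∈ V) (h3 : (app V x (some z) c.1.1) o = .active 0)
    (h4 : 1 ≤ (upd V o c x (some z)).1.2 o) : SS V o (upd V o c x (some z)) := by
  have e : (upd V o c x (some z)).2 = some (x + z) := by
    simp only [upd, hw, ntag, h1, h2, if_true, ne_eq, not_false_eq_true, and_self]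
  have e2 : (upd V o c x (some z)).1.1 = app V x (some z) c.1.1 := rfl
  refine ⟨?_, ?_⟩
  · intro y hy
    rw [e] at hy
    simp only [Option.some.injEq] at hy
    subst hy
    refine ⟨⟨h2, ?_⟩, h1, by rw [e2]; exact h3, h4⟩
    rw [e2]
    simp only [app, tgt, h2, if_true]
    exact numActive_add_pos _
  · intro hs
    rw [e2, h3] at hs
    simp at hs

theorem SS_none {V : Finset (Site 2)} {o : Site 2} {c : CS} (h : c.2 = none) (h2 : c.1.1 o ≠ .sleeping) :
    SS V o c := ⟨fun y hy => by rw [h] at hy; simp at hy, fun hs => absurd hs h2⟩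

theorem inv_SS {V : Finset (Site 2)} {o : Site 2} (ho : o ∈ V) : Inv V o (SS V o) := by
  intro c x hS hp i hi
  rcases pol_cases hS hp with ⟨h1, h2, h3, h4⟩ | ⟨h1, h2, k, h3⟩ | ⟨h1, h2, k, h3⟩ | ⟨h1, h2, h3, h4⟩
  · have hw : walking o c x := Or.inl h1
    rcases i with _ | z
    · refine SS_none ?_ ?_
      · simp only [upd, hw, if_true, ntag]
      · simp only [upd, topI, app_at_other _ _ h2, tgt, h3]; simp
    · by_cases hz : x + z ≠ o ∧ x + z ∈ V
      · refine SS_tag hw hz.1 hz.2 ?_ ?_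
        · rw [app_at_other _ _ h2]
          simp [tgt, hz.1, hz.2, h3]
        · simp only [upd, topI, Function.update_of_ne (fun h => h2 h.symm : o ≠ x)]; exact h4
      · refine SS_none ?_ ?_
        · simp only [upd, hw, if_true, ntag, hz, if_false]
        · simp only [upd, topI, app_at_other _ _ h2, h3]
          split_ifs <;> simp [addParticle]
  · have hw : ¬ walking o c x := by unfold walking; rw [h1]; simp [h2]
    refine SS_none ?_ ?_
    · simp only [upd, hw, if_false]
    · simp only [upd, topI, app_at_other _ _ h2, h3]
      split_ifs <;> simp [addParticle]
  · subst h2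
    have hw : ¬ walking x c x := by unfold walking; rw [h1, h3]; simp [numActive]
    refine SS_none ?_ ?_
    · simp only [upd, hw, if_false]
    · simp only [upd, topI, app_at_self i hi, h3]
      rcases i with _ | z <;> simp [dep, numActive]
  · subst h2
    have hw : walking x c x := Or.inr ⟨h1, rfl, by rw [h3]; rfl⟩
    rcases i with _ | z
    · have e : (upd V x c x none).2 = none := by simp only [upd, hw, if_true, ntag]
      refine ⟨fun y hy => by rw [e] at hy; simp at hy, fun _ => ⟨?_, e⟩⟩
      intro y hy
      by_cases hyx : y = x
      · subst hyx
        simp only [upd, topI, app_at_self none hi, h3, dep, numActive]; simp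
      · have := h4 y hyx
        unfold okT at this
        push Not at this
        have := this hy
        simp only [upd, topI, app, tgt, hyx]; simp; omega
    · by_cases hz : x + z ≠ x ∧ x + z ∈ V
      · refine SS_tag hw hz.1 hz.2 ?_ ?_
        · rw [app_at_self _ hi, h3]; rfl
        · simp only [upd, topI, Function.update_self]; omega
      · refine SS_none ?_ ?_
        · simp only [upd, hw, if_true, ntag, hz, if_false]
        · simp only [upd, topI, app_at_self _ hi, h3, dep]; simp

theorem Val_nonneg {ψ : Site 2 → ℝ} (hψ : ∀ x, 0 ≤ ψ x) (o : Site 2) (c : CS) : 0 ≤ Val ψ o c := by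
  unfold Val
  split
  · exact hψ _
  · split_ifs
    · norm_num
    · exact hψ 0
    · exact le_rfl

theorem Val_le {ψ : Site 2 → ℝ} (hψ : ∀ x, ψ x ≤ 1) (o : Site 2) (c : CS) : Val ψ o c ≤ 1 := by
  unfold Val
  split
  · exact hψ _
  · split_ifs
    · exact le_rfl
    · exact hψ 0
    · norm_num

theorem sum_wt_ge {lam : ℝ} (hl : 0 < lam) (f : Instr 2 → ℝ) (a : ℝ) (h : ∀ i ∈ instrs, a ≤ f i) :
    a ≤ ∑ i ∈ instrs, wt lam i * f i := by
  calc a = ∑ i ∈ instrs, wt lam i * a := by rw [← Finset.sum_mul, sum_wt hl, one_mul]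
    _ ≤ _ := Finset.sum_le_sum fun i hi => mul_le_mul_of_nonneg_left (h i hi) (wt_pos hl i).le

theorem VV_sub {lam : ℝ} (hl : 0 < lam) {V : Finset (Site 2)} {o : Site 2} (ho : o ∈ V)
    {ψ : Site 2 → ℝ} (h0 : ∀ x, 0 ≤ ψ x) (hV : ∀ x, x ∉ V → ψ (x - o) = 0)
    (hs : ∀ x, x ≠ 0 → ψ x ≤ lamJ lam * Pav ψ x) (hs0 : ψ 0 ≤ lamJ lam * Pav ψ 0 + lamS lam)
    (c : CS) (hc : SS V o c) : VV ψ o c ≤ TT lam V o (VV ψ o) c := by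
  rcases hp : pol V o c with _ | x
  · rw [TT_none hp]
  rw [TT_some hp]
  have hind : ∀ c, ψ 0 * ind (Vis o) c ≤ ψ 0 := fun c =>
    mul_le_of_le_one_right (h0 0) (ind_le_one _ _)
  rcases pol_cases hc hp with ⟨h1, h2, h3, h4⟩ | ⟨h1, h2, k, h3⟩ | ⟨h1, h2, k, h3⟩ | ⟨h1, h2, h3, h4⟩
  · have hw : walking o c x := Or.inl h1
    have e1 : VV ψ o c = ψ (x - o) - ψ 0 := by
      simp only [VV, Val, h1, ind, Vis, h4, true_or, if_true, mul_one]
    have hxo : x - o ≠ 0 := sub_ne_zero.2 h2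
    rw [e1, sum_instrs]
    have hb : ∀ z ∈ nbrs, ψ (x - o + z) - ψ 0 ≤ VV ψ o (upd V o c x (some z)) := by
      intro z hz
      refine sub_le_sub ?_ (hind _)
      have exz : x - o + z = x + z - o := by abel
      rw [exz]
      by_cases hz2 : x + z ∈ V
      · by_cases hz1 : x + z = o
        · have et : (upd V o c x (some z)).2 = none := by
            simp only [upd, hw, if_true, ntag, hz1]; simp
          have es : (upd V o c x (some z)).1.1 o = .active 1 := by
            simp only [upd, topI, app_at_other _ _ h2, h3, tgt, hz1, ho, if_true]; rfl
          unfold Val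
          rw [et, hz1, sub_self]
          simp only [es]; simp [numActive]
        · have et : (upd V o c x (some z)).2 = some (x + z) := by
            simp only [upd, hw, if_true, ntag, hz1, hz2]; simp [hz1]
          unfold Val; rw [et]
      · rw [hV _ hz2]; exact Val_nonneg h0 _ _
    have hn : 0 - ψ 0 ≤ VV ψ o (upd V o c x none) := sub_le_sub (Val_nonneg h0 _ _) (hind _)
    have hsum := Finset.sum_le_sum fun z hz => mul_le_mul_of_nonneg_left (hb z hz) (wt_pos hl (some z)).le
    simp only [wt] at hsum ⊢
    rw [← Finset.mul_sum, Finset.sum_sub_distrib, Finset.sum_const, card_nbrs] at hsum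
    have h5 := hs _ hxo
    unfold Pav at h5
    have h6 := mul_le_mul_of_nonneg_left hn (lamS_pos hl).le
    have h7 := lamS_add_lamJ hl
    simp only [nsmul_eq_mul] at hsum
    push_cast at hsum
    have h8 : lamS lam = 1 - lamJ lam := by linarith
    rw [h8] at h6 ⊢
    nlinarith
  · have hw : ¬ walking o c x := by unfold walking; rw [h1]; simp [h2]
    refine sum_wt_ge hl _ _ fun i hi => ?_
    have et : (upd V o c x i).2 = none := by simp only [upd, hw, if_false]
    have em : (upd V o c x i).1.2 o = c.1.2 o := by
      simp only [upd, topI, Function.update_of_ne (fun h => h2 h.symm : o ≠ x)]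
    by_cases ht : tgt V x i = some o
    · have es : (upd V o c x i).1.1 o = .active (k + 1) := by
        simp only [upd, topI, app_at_other _ _ h2, h3, ht, if_true]; rfl
      have h5 : VV ψ o (upd V o c x i) = 0 := by
        simp only [VV, Val, et, ind, Vis, es, numActive]; simp
      rw [h5]
      unfold VV Val ind Vis
      rw [h1, h3]
      simp only [numActive]
      have := h0 0
      rcases k with _ | k
      · simp; split_ifs <;> linarith
      · simp
    · have es : (upd V o c x i).1.1 o = c.1.1 o := by
        simp only [upd, topI, app_at_other _ _ h2, ht, if_false]
      apply le_of_eq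
      simp only [VV, Val, ind, Vis, et, h1, es, em]
      congr
  · subst h2
    have hw : ¬ walking x c x := by unfold walking; rw [h1, h3]; simp [numActive]
    refine sum_wt_ge hl _ _ fun i hi => ?_
    have et : (upd V x c x i).2 = none := by simp only [upd, hw, if_false]
    have es : ∃ j, (upd V x c x i).1.1 x = .active (j + 1) := by
      simp only [upd, topI, app_at_self i hi, h3]
      rcases i with _ | z
      · exact ⟨k + 1, by simp [dep, numActive]⟩
      · exact ⟨k, by simp [dep, numActive]⟩
    obtain ⟨j, hj⟩ := es
    have h5 : VV ψ x (upd V x c x i) = 0 := by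
      simp only [VV, Val, et, ind, Vis, hj, numActive]; simp
    rw [h5]
    apply le_of_eq
    simp only [VV, Val, h1, ind, Vis, h3, numActive]; simp
  · subst h2
    have hw : walking x c x := Or.inr ⟨h1, rfl, by rw [h3]; rfl⟩
    have e1 : VV ψ x c = 0 := by
      simp only [VV, Val, h1, ind, Vis, h3, numActive]; simp
    rw [e1, sum_instrs]
    have hb : ∀ z ∈ nbrs, ψ (0 + z) - ψ 0 ≤ VV ψ x (upd V x c x (some z)) := by
      intro z hz
      refine sub_le_sub ?_ (hind _)
      have exz : 0 + z = x + z - x := by abel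
      rw [exz]
      by_cases hz2 : x + z ∈ V
      · have hz1 : x + z ≠ x := by simpa using ne_zero_of_nbrs hz
        have et : (upd V x c x (some z)).2 = some (x + z) := by
          simp only [upd, hw, if_true, ntag, hz1, hz2]; simp [ne_zero_of_nbrs hz]
        unfold Val; rw [et]
      · rw [hV _ hz2]; exact Val_nonneg h0 _ _
    have hn : 1 - ψ 0 ≤ VV ψ x (upd V x c x none) := by
      refine sub_le_sub (le_of_eq ?_) (hind _)
      have et : (upd V x c x none).2 = none := by simp only [upd, hw, if_true, ntag]
      have es : (upd V x c x none).1.1 x = .sleeping := by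
        simp only [upd, topI, app_at_self none (by simp [instrs]), h3, dep, numActive]; simp
      unfold Val; rw [et]; simp [es]
    have hsum := Finset.sum_le_sum fun z hz => mul_le_mul_of_nonneg_left (hb z hz) (wt_pos hl (some z)).le
    simp only [wt] at hsum ⊢
    rw [← Finset.mul_sum, Finset.sum_sub_distrib, Finset.sum_const, card_nbrs] at hsum
    unfold Pav at hs0
    have h6 := mul_le_mul_of_nonneg_left hn (lamS_pos hl).le
    have h7 := lamS_add_lamJ hl
    simp only [nsmul_eq_mul] at hsum
    push_cast at hsum
    have h8 : lamS lam = 1 - lamJ lam := by linarith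
    rw [h8] at h6 hs0 ⊢
    nlinarith

theorem init_VV {ψ : Site 2 → ℝ} (V : Finset (Site 2)) (o : Site 2) (η : Site 2 → ℕ) :
    VV ψ o (c0 V η) = 0 := by
  simp only [VV, Val, c0, ind, Vis, initState, numActive]
  by_cases h : 1 ≤ (if o ∈ V then η o else 0) <;> simp [h]

theorem init_SS (V : Finset (Site 2)) (o : Site 2) (η : Site 2 → ℕ) : SS V o (c0 V η) :=
  SS_none rfl (by simp [c0, initState])

/-- F2 -/
theorem sleep_bound {lam : ℝ} (hl : 0 < lam) {V : Finset (Site 2)} {o : Site 2} (ho : o ∈ V)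
    {ψ : Site 2 → ℝ} (h0 : ∀ x, 0 ≤ ψ x) (h1 : ∀ x, ψ x ≤ 1) (hV : ∀ x, x ∉ V → ψ (x - o) = 0)
    (hs : ∀ x, x ≠ 0 → ψ x ≤ lamJ lam * Pav ψ x) (hs0 : ψ 0 ≤ lamJ lam * Pav ψ 0 + lamS lam)
    (η : Site 2 → ℕ) :
    ENNReal.ofReal (ψ 0) * muP lam hl {I | Top V I η o 1} ≤ muP lam hl {I | Fin_ V I η o} := by
  set Qs : CS → Prop := fun c => ¬ ns V o c ∧ c.1.1 o = .sleeping with hQs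
  set Qm : CS → Prop := fun c => ¬ ns V o c ∧ 1 ≤ c.1.2 o with hQm
  have key : ∀ n, ψ 0 * EE lam V o (ind Qm) n (c0 V η) ≤
      EE lam V o (ind Qs) n (c0 V η) + EE lam V o (ind (ns V o)) n (c0 V η) := by
    intro n
    have a1 := EE_sub hl (inv_SS ho) (VV_sub hl ho h0 hV hs hs0) n (c0 V η) (init_SS V o η)
    rw [init_VV] at a1
    have a2 : ∀ c, SS V o c → VV ψ o c ≤ (ind Qs c + ind (ns V o) c) + (- ψ 0) * ind Qm c := by
      intro c hc
      by_cases hn : ns V o c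
      · have e1 : ind Qs c = 0 := by simp [ind, hQs, hn]
        have e2 : ind Qm c = 0 := by simp [ind, hQm, hn]
        have e3 : ind (ns V o) c = 1 := by simp [ind, hn]
        rw [e1, e2, e3]
        have := Val_le h1 o c
        have := mul_nonneg (h0 0) (ind_nonneg (Vis o) c)
        unfold VV; linarith
      · have e3 : ind (ns V o) c = 0 := by simp [ind, hn]
        have hst : Stable V c.1.1 := pol_none (by unfold ns at hn; push Not at hn; exact hn)
        have hao := hst o ho
        have hct : c.2 = none := by
          rcases hh : c.2 with _ | y
          · rfl
          · have h5 := (hc.1 y hh).1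
            have := hst y h5.1
            have := h5.2; omega
        apply le_of_eq
        rw [e3]
        simp only [VV, Val, hct, ind, Vis, hQs, hQm, hn, hao]
        simp
        split_ifs <;> ring
    have a3 := EE_mono hl (inv_SS ho) a2 n (c0 V η) (init_SS V o η)
    simp only [EE_add, EE_smul] at a3
    linarith
  -- translate
  have b1 : ∀ n, muP lam hl {I | Top V I η o 1} ≤
      ENNReal.ofReal (EE lam V o (ind Qm) n (c0 V η)) + ENNReal.ofReal (EE lam V o (ind (ns V o)) n (c0 V η)) := by
    intro n
    rw [← bridge lam hl, ← bridge lam hl]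
    refine le_trans (measure_mono ?_) (measure_union_le _ _)
    rintro I ⟨l, hl1, hl2⟩
    by_cases hn : ns V o (ch V o I n (c0 V η))
    · exact Or.inr hn
    · left
      refine ⟨hn, ?_⟩
      obtain ⟨l', hl', hr⟩ := ch_legal V o I n (c0 V η)
      have hst : Stable V (ch V o I n (c0 V η)).1.1 := pol_none (by unfold ns at hn; push Not at hn; exact hn)
      rw [← hr] at hst ⊢
      have h5 := (abelian V I l l' _ hl1 hl' hst).1 o
      rw [run_snd]; omega
  have b2 : ∀ n, ENNReal.ofReal (EE lam V o (ind Qs) n (c0 V η)) ≤ muP lam hl {I | Fin_ V I η o} := by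
    intro n
    rw [← bridge lam hl]
    refine measure_mono ?_
    rintro I ⟨hn, h5⟩
    obtain ⟨l', hl', hr⟩ := ch_legal V o I n (c0 V η)
    have hst : Stable V (ch V o I n (c0 V η)).1.1 := pol_none (by unfold ns at hn; push Not at hn; exact hn)
    rw [← hr] at hst h5
    exact ⟨l', hl', hst, h5⟩
  have b3 : ∀ n, ENNReal.ofReal (ψ 0) * muP lam hl {I | Top V I η o 1} ≤ muP lam hl {I | Fin_ V I η o} +
      ENNReal.ofReal ((1 + ψ 0) * EE lam V o (ind (ns V o)) n (c0 V η)) := by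
    intro n
    have n1 := EE_nonneg hl V o (ind_nonneg (ns V o)) n (c0 V η)
    have n2 := EE_nonneg hl V o (ind_nonneg Qm) n (c0 V η)
    have n3 := EE_nonneg hl V o (ind_nonneg Qs) n (c0 V η)
    calc _ ≤ ENNReal.ofReal (ψ 0) * (ENNReal.ofReal (EE lam V o (ind Qm) n (c0 V η)) +
          ENNReal.ofReal (EE lam V o (ind (ns V o)) n (c0 V η))) := mul_le_mul_right (b1 n) _
      _ = ENNReal.ofReal (ψ 0 * (EE lam V o (ind Qm) n (c0 V η) + EE lam V o (ind (ns V o)) n (c0 V η))) := by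
          rw [← ENNReal.ofReal_add n2 n1, ← ENNReal.ofReal_mul (h0 0)]
      _ ≤ ENNReal.ofReal (EE lam V o (ind Qs) n (c0 V η) + (1 + ψ 0) * EE lam V o (ind (ns V o)) n (c0 V η)) := by
          apply ENNReal.ofReal_le_ofReal
          have := key n
          linarith
      _ = ENNReal.ofReal (EE lam V o (ind Qs) n (c0 V η)) + ENNReal.ofReal ((1 + ψ 0) * EE lam V o (ind (ns V o)) n (c0 V η)) := by
          rw [ENNReal.ofReal_add n3 (mul_nonneg (by linarith [h0 0]) n1)]
      _ ≤ _ := add_le_add_left (b2 n) _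
  have lim : Tendsto (fun n => muP lam hl {I | Fin_ V I η o} +
      ENNReal.ofReal ((1 + ψ 0) * EE lam V o (ind (ns V o)) n (c0 V η))) atTop
      (nhds (muP lam hl {I | Fin_ V I η o} + ENNReal.ofReal ((1 + ψ 0) * 0))) :=
    Tendsto.add tendsto_const_nhds
      ((ENNReal.continuous_ofReal.tendsto _).comp ((EE_ns_tendsto hl V o (c0 V η)).const_mul _))
  have := ge_of_tendsto' lim b3
  simpa using this

end
end ARW

end


section
open MeasureTheory ENNReal Filter
set_option linter.unusedSimpArgs false

namespace ARW

noncomputable section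
open scoped Classical

/-! ### The potential -/

/-- squared norm -/
def qq (x : Site 2) : ℝ := (x 0 : ℝ) ^ 2 + (x 1 : ℝ) ^ 2

theorem qq_add (x z : Site 2) : qq (x + z) = ((x 0 : ℝ) + z 0) ^ 2 + ((x 1 : ℝ) + z 1) ^ 2 := by
  simp [qq]

theorem qq_nonneg (x : Site 2) : 0 ≤ qq x := by unfold qq; positivity

theorem qq_int (x : Site 2) : ∃ k : ℕ, qq x = k := by
  refine ⟨((x 0) ^ 2 + (x 1) ^ 2).toNat, ?_⟩
  have h : 0 ≤ (x 0) ^ 2 + (x 1) ^ 2 := by positivity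
  have := Int.toNat_of_nonneg h
  have h2 : ((((x 0) ^ 2 + (x 1) ^ 2).toNat : ℤ) : ℝ) = (((x 0) ^ 2 + (x 1) ^ 2 : ℤ) : ℝ) := by rw [this]
  unfold qq
  push_cast at h2
  exact h2.symm

theorem qq_pos {x : Site 2} (h : x ≠ 0) : 1 ≤ qq x := by
  obtain ⟨k, hk⟩ := qq_int x
  rw [hk]
  have : k ≠ 0 := by
    rintro rfl
    apply h
    unfold qq at hk
    have h0 : (x 0 : ℝ) = 0 := by
      have := sq_nonneg (x 0 : ℝ); have := sq_nonneg (x 1 : ℝ)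
      have h3 : (x 0 : ℝ) ^ 2 = 0 := by push_cast at hk; linarith
      exact pow_eq_zero_iff (two_ne_zero) |>.1 h3
    have h1 : (x 1 : ℝ) = 0 := by
      have h3 : (x 1 : ℝ) ^ 2 = 0 := by rw [h0] at hk; push_cast at hk; linarith
      exact pow_eq_zero_iff (two_ne_zero) |>.1 h3
    funext i
    fin_cases i
    · exact_mod_cast h0
    · exact_mod_cast h1
  exact_mod_cast Nat.one_le_iff_ne_zero.2 this

theorem qq_zero : qq 0 = 0 := by simp [qq]

theorem Pav_add (f g : Site 2 → ℝ) (x : Site 2) : Pav (fun y => f y + g y) x = Pav f x + Pav g x := by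
  unfold Pav; rw [Finset.sum_add_distrib, add_div]

theorem Pav_smul (a : ℝ) (g : Site 2 → ℝ) (x : Site 2) : Pav (fun y => a * g y) x = a * Pav g x := by
  unfold Pav; rw [← Finset.mul_sum, mul_div_assoc]

theorem Pav_const (a : ℝ) (x : Site 2) : Pav (fun _ => a) x = a := by
  rw [Pav_eq]; ring

theorem Pav_qq (x : Site 2) : Pav qq x = qq x + 1 := by
  rw [Pav_eq]; simp only [qq_add]; simp [qq]; ring

theorem Pav_nonneg {f : Site 2 → ℝ} (h : ∀ x, 0 ≤ f x) (x : Site 2) : 0 ≤ Pav f x := by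
  unfold Pav; exact div_nonneg (Finset.sum_nonneg fun z _ => h _) (by norm_num)

theorem mem4 {z : Site 2} : z ∈ nbrs ↔ z = ![1, 0] ∨ z = ![-1, 0] ∨ z = ![0, 1] ∨ z = ![0, -1] := by
  unfold nbrs; simp

theorem qq_nbr {x z : Site 2} (hz : z ∈ nbrs) : qq (x + z) ≤ 2 * qq x + 2 := by
  have h : qq z = 1 := by
    rw [mem4] at hz
    rcases hz with h | h | h | h <;> subst h <;> simp [qq]
  rw [qq_add]
  unfold qq at h ⊢
  nlinarith [sq_nonneg ((x 0 : ℝ) - z 0), sq_nonneg ((x 1 : ℝ) - z 1)]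

/-- the constant at the origin -/
def Cz : ℝ := 7 * Real.log 4

/-- logarithmic potential -/
def fl (x : Site 2) : ℝ := if x = 0 then Cz else - Real.log (qq x - 3 / 4)

theorem fl_ne {x : Site 2} (h : x ≠ 0) : fl x = - Real.log (qq x - 3 / 4) := by simp [fl, h]

theorem four_logs {a b c d s : ℝ} (ha : 0 < a) (hb : 0 < b) (hc : 0 < c) (hd : 0 < d)
    (h : a * b * (c * d) ≤ s ^ 4) :
    Real.log a + (Real.log b + (Real.log c + Real.log d)) ≤ 4 * Real.log s := by
  have e : Real.log a + (Real.log b + (Real.log c + Real.log d)) = Real.log (a * b * (c * d)) := by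
    rw [Real.log_mul (by positivity) (by positivity), Real.log_mul ha.ne' hb.ne', Real.log_mul hc.ne' hd.ne']
    ring
  have e2 : 4 * Real.log s = Real.log (s ^ 4) := by rw [Real.log_pow]; norm_num
  rw [e, e2]
  exact Real.log_le_log (by positivity) h

theorem log4_pos : 0 < Real.log 4 := Real.log_pos (by norm_num)

theorem fl_one {x : Site 2} (h : qq x = 1) : fl x = Real.log 4 := by
  have : x ≠ 0 := by rintro rfl; rw [qq_zero] at h; norm_num at h
  rw [fl_ne this, h, ← Real.log_inv]; norm_num

theorem fl_sub {x : Site 2} (h : x ≠ 0) : fl x ≤ Pav fl x := by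
  by_cases h1 : qq x = 1
  · rw [fl_one h1]
    have hlow : ∀ y : Site 2, qq y ≤ 4 → - Real.log 4 ≤ fl y := by
      intro y hy
      by_cases hy0 : y = 0
      · simp only [fl, hy0, if_true, Cz]; have := log4_pos; linarith
      · rw [fl_ne hy0]
        have := qq_pos hy0
        have := Real.log_le_log (x := qq y - 3 / 4) (y := 4) (by linarith) (by linarith)
        linarith
    have hx : x ∈ nbrs := by
      have hx0 : (x 0) ^ 2 + (x 1) ^ 2 = 1 := by unfold qq at h1; exact_mod_cast h1
      have ha : -1 ≤ x 0 ∧ x 0 ≤ 1 := by constructor <;> nlinarith [sq_nonneg (x 1)]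
      have hb : -1 ≤ x 1 ∧ x 1 ≤ 1 := by constructor <;> nlinarith [sq_nonneg (x 0)]
      rw [mem4]
      have ex : x = ![x 0, x 1] := by funext i; fin_cases i <;> rfl
      obtain ⟨a1, a2⟩ := ha
      obtain ⟨b1, b2⟩ := hb
      rw [ex]
      generalize x 0 = a at *
      generalize x 1 = b at *
      interval_cases a <;> interval_cases b <;> simp at hx0 ⊢
    have hnx : -x ∈ nbrs := by
      rw [mem4] at hx ⊢
      rcases hx with h | h | h | h <;> subst h <;> simp
    have hle : ∀ z ∈ nbrs, (if z = -x then Cz + Real.log 4 else 0) - Real.log 4 ≤ fl (x + z) := by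
      intro z hz
      split_ifs with hh
      · subst hh; simp [fl]
      · have := hlow (x + z) (by have := qq_nbr (x := x) hz; linarith)
        linarith
    have hs := Finset.sum_le_sum hle
    rw [Finset.sum_sub_distrib, Finset.sum_ite_eq' nbrs (-x), if_pos hnx, Finset.sum_const, card_nbrs] at hs
    unfold Pav
    simp only [nsmul_eq_mul] at hs
    push_cast at hs
    have h5 : 4 * Real.log 4 ≤ Cz + Real.log 4 - 4 * Real.log 4 := by unfold Cz; linarith
    rw [le_div_iff₀ (by norm_num)]
    linarith
  · have h2 : 2 ≤ qq x := by
      have := qq_pos h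
      obtain ⟨k, hk⟩ := qq_int x
      rw [hk] at this h1 ⊢
      have a : 1 ≤ k := by exact_mod_cast this
      have b : k ≠ 1 := by intro hh; apply h1; rw [hh]; norm_num
      exact_mod_cast (by omega : 2 ≤ k)
    have hn : ∀ z ∈ nbrs, x + z ≠ 0 := by
      intro z hz h0
      have : x = -z := by rwa [add_eq_zero_iff_eq_neg] at h0
      apply h1
      rw [mem4] at hz
      rcases hz with h | h | h | h <;> subst h <;> subst this <;> simp [qq]
    have m1 : (![1, 0] : Site 2) ∈ nbrs := by rw [mem4]; simp
    have m2 : (![-1, 0] : Site 2) ∈ nbrs := by rw [mem4]; simp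
    have m3 : (![0, 1] : Site 2) ∈ nbrs := by rw [mem4]; simp
    have m4 : (![0, -1] : Site 2) ∈ nbrs := by rw [mem4]; simp
    rw [Pav_eq, fl_ne (hn _ m1), fl_ne (hn _ m2), fl_ne (hn _ m3), fl_ne (hn _ m4), fl_ne h]
    have p1 := qq_pos (hn _ m1)
    have p2 := qq_pos (hn _ m2)
    have p3 := qq_pos (hn _ m3)
    have p4 := qq_pos (hn _ m4)
    have := four_logs (a := qq (x + ![1, 0]) - 3 / 4) (b := qq (x + ![-1, 0]) - 3 / 4)
      (c := qq (x + ![0, 1]) - 3 / 4) (d := qq (x + ![0, -1]) - 3 / 4) (s := qq x - 3 / 4)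
      (by linarith) (by linarith) (by linarith) (by linarith) (by
        simp only [qq_add]
        simp only [Matrix.cons_val_zero, Matrix.cons_val_one]
        push_cast
        set a : ℝ := (x 0 : ℝ)
        set b : ℝ := (x 1 : ℝ)
        have hs : qq x = a ^ 2 + b ^ 2 := rfl
        rw [hs] at h2 ⊢
        have e : (((a + 1) ^ 2 + (b + 0) ^ 2 - 3 / 4) * ((a + -1) ^ 2 + (b + 0) ^ 2 - 3 / 4) *
            (((a + 0) ^ 2 + (b + 1) ^ 2 - 3 / 4) * ((a + 0) ^ 2 + (b + -1) ^ 2 - 3 / 4))) =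
            (a ^ 2 + b ^ 2 - 3 / 4) ^ 4 - (a ^ 2 + b ^ 2 - 3 / 4) ^ 2 + 1 / 4 - 4 * (a ^ 2 - b ^ 2) ^ 2 := by
          ring
        rw [e]
        nlinarith [sq_nonneg (a ^ 2 - b ^ 2)])
    linarith

/-- unnormalized potential -/
def gp (lam N : ℝ) (x : Site 2) : ℝ :=
  Real.log N + fl x + (Real.log N + Cz) * lam * (qq x - 4 * N)

/-- potential -/
def psi (lam N : ℝ) (x : Site 2) : ℝ :=
  if qq x ≤ N then lam / (6 * Real.log 4) * max (gp lam N x) 0 else 0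

theorem Pav_gp {lam N : ℝ} (x : Site 2) :
    Pav (gp lam N) x = Real.log N + Pav fl x + (Real.log N + Cz) * lam * (qq x + 1 - 4 * N) := by
  have : gp lam N = fun y => (Real.log N + fl y) + (Real.log N + Cz) * lam * (qq y + (- 4 * N)) := by
    funext y; unfold gp; ring
  rw [this, Pav_add, Pav_add, Pav_const, Pav_smul, Pav_add, Pav_const, Pav_qq]; ring

theorem psi_nonneg {lam N : ℝ} (hl : 0 < lam) (x : Site 2) : 0 ≤ psi lam N x := by
  unfold psi
  have := log4_pos
  split_ifs
  · positivity
  · exact le_rfl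

theorem psi_ge {lam N : ℝ} (hl : 0 < lam) (hN : 1 ≤ N) (hNi : ∃ k : ℕ, N = k) (x : Site 2) (hx : qq x ≤ N) (z : Site 2)
    (hz : z ∈ nbrs) : lam / (6 * Real.log 4) * gp lam N (x + z) ≤ psi lam N (x + z) := by
  have h4 := log4_pos
  have hp : 0 < lam / (6 * Real.log 4) := by positivity
  unfold psi
  split_ifs with h
  · exact mul_le_mul_of_nonneg_left (le_max_left _ _) hp.le
  · have hN0 : 0 ≤ Real.log N := Real.log_nonneg hN
    have h1 : qq (x + z) ≤ 4 * N := by have := qq_nbr (x := x) hz; linarith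
    have h2 : N + 1 ≤ qq (x + z) := by
      obtain ⟨k, hk⟩ := hNi
      obtain ⟨m, hm⟩ := qq_int (x + z)
      rw [hk, hm] at h ⊢
      push Not at h
      have : k < m := by exact_mod_cast h
      exact_mod_cast this
    have h3 : x + z ≠ 0 := by
      intro h0; rw [h0, qq_zero] at h2; linarith
    have h5 : gp lam N (x + z) ≤ 0 := by
      unfold gp
      rw [fl_ne h3]
      have := Real.log_le_log (x := N) (y := qq (x + z) - 3 / 4) (by linarith) (by linarith)
      have : (Real.log N + Cz) * lam * (qq (x + z) - 4 * N) ≤ 0 := by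
        apply mul_nonpos_of_nonneg_of_nonpos
        · unfold Cz; positivity
        · linarith
      linarith
    exact mul_nonpos_of_nonneg_of_nonpos hp.le h5

theorem fl_le (x : Site 2) (hx : x ≠ 0) : fl x ≤ Real.log 4 := by
  rw [fl_ne hx, neg_le, ← Real.log_inv]
  have := qq_pos hx
  exact Real.log_le_log (by norm_num) (by norm_num; linarith)

theorem psi_sub {lam N : ℝ} (hl : 0 < lam) (hN : 1 ≤ N) (hNi : ∃ k : ℕ, N = k) (x : Site 2) (hx0 : x ≠ 0) :
    psi lam N x ≤ lamJ lam * Pav (psi lam N) x := by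
  have h4 := log4_pos
  have hp : 0 < lam / (6 * Real.log 4) := by positivity
  have hN0 : 0 ≤ Real.log N := Real.log_nonneg hN
  have hJ := lamJ_pos hl
  have hnn := mul_nonneg hJ.le (Pav_nonneg (psi_nonneg (N := N) hl) x)
  by_cases hx : qq x ≤ N
  · have e : psi lam N x = lam / (6 * Real.log 4) * max (gp lam N x) 0 := by simp [psi, hx]
    rcases le_total (gp lam N x) 0 with h | h
    · rw [e, max_eq_right h, mul_zero]; exact hnn
    · rw [e, max_eq_left h]
      have h1 : lam / (6 * Real.log 4) * Pav (gp lam N) x ≤ Pav (psi lam N) x := by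
        rw [← Pav_smul]; exact Pav_mono fun z hz => psi_ge hl hN hNi x hx z hz
      have h2 : (1 + lam) * gp lam N x ≤ Pav (gp lam N) x := by
        rw [Pav_gp]
        have h5 := fl_sub hx0
        have h6 : gp lam N x ≤ Real.log N + Cz := by
          unfold gp
          have : (Real.log N + Cz) * lam * (qq x - 4 * N) ≤ 0 := by
            apply mul_nonpos_of_nonneg_of_nonpos
            · unfold Cz; positivity
            · linarith
          have := fl_le x hx0
          have : Cz = 7 * Real.log 4 := rfl
          linarith
        have h7 := mul_le_mul_of_nonneg_left h6 hl.le
        have h8 : gp lam N x = Real.log N + fl x + (Real.log N + Cz) * lam * (qq x - 4 * N) := rfl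
        nlinarith
      unfold lamJ at *
      rw [one_div_mul_eq_div, le_div_iff₀ (by linarith)]
      calc _ = lam / (6 * Real.log 4) * ((1 + lam) * gp lam N x) := by ring
        _ ≤ _ := mul_le_mul_of_nonneg_left h2 hp.le
        _ ≤ _ := h1
  · have e : psi lam N x = 0 := by simp [psi, hx]
    rw [e]; exact hnn

theorem psi_sub0 {lam N : ℝ} (hl : 0 < lam) (hN : 1 ≤ N) (hNi : ∃ k : ℕ, N = k) :
    psi lam N 0 ≤ lamJ lam * Pav (psi lam N) 0 + lamS lam := by
  have h4 := log4_pos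
  have hp : 0 < lam / (6 * Real.log 4) := by positivity
  have hN0 : 0 ≤ Real.log N := Real.log_nonneg hN
  have hJ := lamJ_pos hl
  have hS := lamS_pos hl
  have hnn := mul_nonneg hJ.le (Pav_nonneg (psi_nonneg (N := N) hl) 0)
  have hx : qq 0 ≤ N := by rw [qq_zero]; linarith
  have e : psi lam N 0 = lam / (6 * Real.log 4) * max (gp lam N 0) 0 := by simp [psi, hx]
  rcases le_total (gp lam N 0) 0 with h | h
  · rw [e, max_eq_right h, mul_zero]; linarith
  · rw [e, max_eq_left h]
    have h1 : lam / (6 * Real.log 4) * Pav (gp lam N) 0 ≤ Pav (psi lam N) 0 := by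
      rw [← Pav_smul]; exact Pav_mono fun z hz => psi_ge hl hN hNi 0 hx z hz
    have h2 : (1 + lam) * gp lam N 0 ≤ Pav (gp lam N) 0 + 6 * Real.log 4 := by
      rw [Pav_gp]
      have h5 : Pav fl 0 = Real.log 4 := by
        rw [Pav_eq]
        rw [fl_one (by simp [qq]), fl_one (by simp [qq]), fl_one (by simp [qq]), fl_one (by simp [qq])]; ring
      have h8 : gp lam N 0 = Real.log N + Cz + (Real.log N + Cz) * lam * (0 - 4 * N) := by
        unfold gp; rw [qq_zero]; simp [fl]
      have h6 : gp lam N 0 ≤ Real.log N + Cz := by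
        rw [h8]
        have : (Real.log N + Cz) * lam * (0 - 4 * N) ≤ 0 := by
          apply mul_nonpos_of_nonneg_of_nonpos
          · unfold Cz; positivity
          · linarith
        linarith
      have h7 := mul_le_mul_of_nonneg_left h6 hl.le
      have : Cz = 7 * Real.log 4 := rfl
      rw [h5, qq_zero]
      nlinarith
    unfold lamJ lamS at *
    rw [one_div_mul_eq_div, ← add_div, le_div_iff₀ (by linarith)]
    calc _ = lam / (6 * Real.log 4) * ((1 + lam) * gp lam N 0) := by ring
      _ ≤ lam / (6 * Real.log 4) * (Pav (gp lam N) 0 + 6 * Real.log 4) := mul_le_mul_of_nonneg_left h2 hp.le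
      _ = lam / (6 * Real.log 4) * Pav (gp lam N) 0 + lam := by field_simp
      _ ≤ _ := by linarith

theorem log4_lt : Real.log 4 < 1.4 := by
  have : Real.log 4 = 2 * Real.log 2 := by
    rw [show (4:ℝ) = 2 ^ 2 by norm_num, Real.log_pow]; norm_num
  rw [this]; have := Real.log_two_lt_d9; linarith

theorem psi_le_one {lam N : ℝ} (hl : 0 < lam) (hl2 : lam ≤ 1 / 256) (hN : 1 ≤ N) (hN2 : lam * N ≤ 1 / 8)
    (x : Site 2) : psi lam N x ≤ 1 := by
  have h4 := log4_pos
  have h4' : 1 < Real.log 4 := by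
    rw [Real.lt_log_iff_exp_lt (by norm_num)]
    have := Real.exp_one_lt_d9; linarith
  have hN0 : 0 ≤ Real.log N := Real.log_nonneg hN
  unfold psi
  split_ifs with hx
  · have hg : gp lam N x ≤ Real.log N + Cz := by
      unfold gp
      have : (Real.log N + Cz) * lam * (qq x - 4 * N) ≤ 0 := by
        apply mul_nonpos_of_nonneg_of_nonpos
        · unfold Cz; positivity
        · linarith
      have : fl x ≤ Cz := by
        by_cases h : x = 0
        · simp [fl, h]
        · have := fl_le x h; unfold Cz; linarith
      linarith
    have hm : max (gp lam N x) 0 ≤ Real.log N + Cz := max_le hg (by unfold Cz; positivity)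
    have hlog : Real.log N ≤ N := by have := Real.log_le_sub_one_of_pos (x := N) (by linarith); linarith
    rw [div_mul_eq_mul_div, div_le_one (by positivity)]
    have := log4_lt
    have h9 : max (gp lam N x) 0 ≤ N + 10 := by unfold Cz at hm; linarith
    have := mul_le_mul_of_nonneg_left h9 hl.le
    nlinarith
  · norm_num

theorem psi_origin {lam : ℝ} (hl : 0 < lam) (hl2 : lam ≤ 1 / 256) :
    ∃ N : ℝ, 1 ≤ N ∧ (∃ k : ℕ, N = k) ∧ lam * N ≤ 1 / 8 ∧
      1 / 100 * (lam * Real.log (1 / lam)) < psi lam N 0 := by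
  have h4 := log4_pos
  refine ⟨(⌊1 / (8 * lam)⌋₊ : ℝ), ?_, ⟨_, rfl⟩, ?_, ?_⟩
  · have : (1:ℝ) ≤ 1 / (8 * lam) := by rw [le_div_iff₀ (by positivity)]; linarith
    exact_mod_cast (Nat.one_le_floor_iff _).2 this
  · have := Nat.floor_le (a := 1 / (8 * lam)) (by positivity)
    calc lam * (⌊1 / (8 * lam)⌋₊ : ℝ) ≤ lam * (1 / (8 * lam)) := mul_le_mul_of_nonneg_left this hl.le
      _ = _ := by field_simp
  · set N : ℝ := (⌊1 / (8 * lam)⌋₊ : ℝ) with hNd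
    have hN2 : lam * N ≤ 1 / 8 := by
      have := Nat.floor_le (a := 1 / (8 * lam)) (by positivity)
      calc lam * (⌊1 / (8 * lam)⌋₊ : ℝ) ≤ lam * (1 / (8 * lam)) := mul_le_mul_of_nonneg_left this hl.le
        _ = _ := by field_simp
    have hN1 : 1 / (8 * lam) < N + 1 := Nat.lt_floor_add_one _
    have hN3 : 1 / (16 * lam) ≤ N := by
      have : 1 / (8 * lam) = 2 * (1 / (16 * lam)) := by field_simp; norm_num
      have : (1:ℝ) ≤ 1 / (16 * lam) := by rw [le_div_iff₀ (by positivity)]; linarith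
      linarith
    have hL : 0 < Real.log (1 / lam) := Real.log_pos (by rw [lt_div_iff₀ hl]; linarith)
    have hlogN : Real.log (1 / lam) ≤ 2 * Real.log N := by
      have a : 0 < 1 / (16 * lam) := by positivity
      have : Real.log ((1 / (16 * lam)) ^ 2) ≤ Real.log (N ^ 2) :=
        Real.log_le_log (by positivity) (pow_le_pow_left₀ a.le hN3 2)
      rw [Real.log_pow N] at this
      refine le_trans (Real.log_le_log (by positivity) ?_) this
      rw [div_pow, div_le_div_iff₀ hl (by positivity)]
      nlinarith
    have hx : qq 0 ≤ N := by
      rw [qq_zero]; positivity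
    have e : psi lam N 0 = lam / (6 * Real.log 4) * max (gp lam N 0) 0 := by simp [psi, hx]
    have hg : Real.log (1 / lam) / 4 ≤ gp lam N 0 := by
      have h8 : gp lam N 0 = (Real.log N + Cz) * (1 - 4 * (lam * N)) := by
        unfold gp; rw [qq_zero]; simp [fl]; ring
      rw [h8]
      have : 0 < Cz := by unfold Cz; positivity
      nlinarith
    have hc : lam / 9 ≤ lam / (6 * Real.log 4) := by
      have := log4_lt
      exact div_le_div_of_nonneg_left hl.le (by positivity) (by linarith)
    rw [e]
    calc 1 / 100 * (lam * Real.log (1 / lam)) < lam / 9 * (Real.log (1 / lam) / 4) := by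
          have := mul_pos hl hL; nlinarith
      _ ≤ lam / (6 * Real.log 4) * max (gp lam N 0) 0 :=
          mul_le_mul hc (hg.trans (le_max_left _ _)) (by positivity) (by positivity)

end
end ARW

end


section
open MeasureTheory ENNReal Filter
set_option linter.unusedSimpArgs false

namespace ARW

noncomputable section
open scoped Classical

/-! ### Joint measurability and stationarity -/

/-- boxes -/
def Bx (k : ℕ) : Finset (Site 2) := Fintype.piFinset fun _ => Finset.Icc (-(k : ℤ)) k

theorem mem_Bx {k : ℕ} {x : Site 2} : x ∈ Bx k ↔ (-(k : ℤ) ≤ x 0 ∧ x 0 ≤ k) ∧ (-(k : ℤ) ≤ x 1 ∧ x 1 ≤ k) := by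
  simp [Bx, Fintype.mem_piFinset, Fin.forall_fin_two]

theorem Bx_mono {k m : ℕ} (h : k ≤ m) : Bx k ⊆ Bx m := by
  intro x hx
  rw [mem_Bx] at hx ⊢
  omega

theorem card_Bx (k : ℕ) : (Bx k).card = (2 * k + 1) ^ 2 := by
  simp only [Bx, Fintype.card_piFinset, Int.card_Icc, Finset.prod_const, Finset.card_univ, Fintype.card_fin]
  congr 1; omega

theorem exists_Bx (V : Finset (Site 2)) : ∃ k, V ⊆ Bx k := by
  refine ⟨∑ x ∈ V, ((x 0).natAbs + (x 1).natAbs), fun x hx => ?_⟩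
  have h : (x 0).natAbs + (x 1).natAbs ≤ ∑ x ∈ V, ((x 0).natAbs + (x 1).natAbs) :=
    Finset.single_le_sum (f := fun x : Site 2 => (x 0).natAbs + (x 1).natAbs) (fun _ _ => Nat.zero_le _) hx
  rw [mem_Bx]
  omega

theorem joint_meas (V : Finset (Site 2)) (F : Finset (Site 2 × ℕ)) (S : Set ((Site 2 → ℕ) × Stacks 2))
    (h : ∀ η η' I I', (∀ x ∈ V, η x = η' x) → (∀ p ∈ F, I p = I' p) → (η, I) ∈ S → (η', I') ∈ S) :
    MeasurableSet S := by
  set r : ((Site 2 → ℕ) × Stacks 2) → ((V → ℕ) × (F → Instr 2)) :=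
    fun q => (fun i => q.1 i, fun i => q.2 i) with hr
  have e : S = r ⁻¹' (r '' S) := by
    refine Set.Subset.antisymm (Set.subset_preimage_image _ _) ?_
    rintro ⟨η', I'⟩ ⟨⟨η, I⟩, hI, hIJ⟩
    simp only [hr, Prod.mk.injEq] at hIJ
    exact h η η' I I' (fun x hx => congrFun hIJ.1 ⟨x, hx⟩) (fun p hp => congrFun hIJ.2 ⟨p, hp⟩) hI
  rw [e]
  refine measurableSet_preimage ?_ (Set.to_countable _).measurableSet
  refine Measurable.prodMk ?_ ?_
  · exact measurable_pi_lambda _ fun i => (measurable_pi_apply _).comp measurable_fst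
  · exact measurable_pi_lambda _ fun i => (measurable_pi_apply _).comp measurable_snd

theorem initState_congr {V : Finset (Site 2)} {η η' : Site 2 → ℕ} (h : ∀ x ∈ V, η x = η' x) :
    initState 2 V η = initState 2 V η' := by
  unfold initState
  congr 1
  funext x
  by_cases hx : x ∈ V
  · simp [hx, h x hx]
  · simp [hx]

theorem run_congr {V : Finset (Site 2)} {I J : Stacks 2} (l : List (Site 2)) :
    ∀ (s : State 2), (∀ x ∈ V, ∀ k, s.2 x ≤ k → k < s.2 x + l.length → I (x, k) = J (x, k)) →
      Legal V I s l → run V I s l = run V J s l := by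
  induction l with
  | nil => intro s _ _; rfl
  | cons x t ih =>
    intro s h hl
    have h0 : topple V J x s = topple V I x s := by
      rw [topple_eq, topple_eq, h x hl.1 (s.2 x) le_rfl (by simp)]
    simp only [run]
    rw [h0]
    refine ih _ (fun y hy k hk1 hk2 => h y hy k ?_ ?_) hl.2.2
    · rw [topple_eq] at hk1
      simp only [topI, Function.update_apply] at hk1
      split_ifs at hk1 with hh
      · rw [hh]; omega
      · exact hk1
    · rw [topple_eq] at hk2
      simp only [topI, Function.update_apply] at hk2
      simp only [List.length_cons]
      split_ifs at hk2 with hh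
      · rw [hh]; omega
      · omega

theorem legal_dep (V : Finset (Site 2)) (l : List (Site 2)) (η : Site 2 → ℕ) (I J : Stacks 2) (n : ℕ)
    (hn : l.length ≤ n)
    (h : ∀ p ∈ box2 V (fun _ => 0) n, I p = J p) (hl : Legal V I (initState 2 V η) l) :
    Legal V J (initState 2 V η) l := by
  refine legal_congr V I J l _ (fun x hx k h1 h2 => h _ (mem_box2.2 ⟨hx, Nat.zero_le _, ?_⟩)) hl
  simp only [initState] at h2 ⊢; omega

theorem meas_legal (V : Finset (Site 2)) (l : List (Site 2)) :
    MeasurableSet {q : (Site 2 → ℕ) × Stacks 2 | Legal V q.2 (initState 2 V q.1) l} := by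
  refine joint_meas V (box2 V (fun _ => 0) l.length) _ ?_
  intro η η' I I' h1 h2 hl
  simp only [Set.mem_ofPred_eq] at hl ⊢
  rw [← initState_congr h1]
  exact legal_dep V l η I I' _ le_rfl h2 hl

theorem meas_Top (V : Finset (Site 2)) (y : Site 2) (n : ℕ) :
    MeasurableSet {q : (Site 2 → ℕ) × Stacks 2 | Top V q.2 q.1 y n} := by
  have : {q : (Site 2 → ℕ) × Stacks 2 | Top V q.2 q.1 y n} =
      ⋃ l : List (Site 2), {q | Legal V q.2 (initState 2 V q.1) l ∧ n ≤ l.count y} := by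
    ext q; simp [Top]
  rw [this]
  refine MeasurableSet.iUnion fun l => ?_
  by_cases h : n ≤ l.count y
  · simp only [h, and_true]; exact meas_legal V l
  · simp only [h, and_false]; exact MeasurableSet.empty

theorem fiber_meas {S : Set ((Site 2 → ℕ) × Stacks 2)} (h : MeasurableSet S) (η : Site 2 → ℕ) :
    MeasurableSet {I | (η, I) ∈ S} := measurable_prodMk_left h

theorem meas_Fin (V : Finset (Site 2)) (η : Site 2 → ℕ) (x : Site 2) :
    MeasurableSet {I | Fin_ V I η x} := by
  have : {I | Fin_ V I η x} = ⋃ l : List (Site 2), {I | Legal V I (initState 2 V η) l ∧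
      Stable V (run V I (initState 2 V η) l).1 ∧ (run V I (initState 2 V η) l).1 x = .sleeping} := by
    ext I; simp [Fin_]
  rw [this]
  refine MeasurableSet.iUnion fun l => DepOn.measurableSet (F := box2 V (fun _ => 0) l.length) ?_
  rintro I J h ⟨h1, h2, h3⟩
  have e : run V I (initState 2 V η) l = run V J (initState 2 V η) l := by
    refine run_congr l _ (fun y hy k hk1 hk2 => h _ (mem_box2.2 ⟨hy, Nat.zero_le _, ?_⟩)) h1
    simp only [initState] at hk2 ⊢; omega
  refine ⟨legal_dep V l η I J _ le_rfl h h1, ?_, ?_⟩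
  · rw [← e]; exact h2
  · rw [← e]; exact h3

/-- infinite odometer at `y` -/
def Atop (I : Stacks 2) (η : Site 2 → ℕ) (y : Site 2) : Prop := ∀ n, ∃ V, Top V I η y n

theorem odom_top (I : Stacks 2) (η : Site 2 → ℕ) : odom0 I η = ⊤ ↔ Atop I η 0 := by
  unfold odom0 Atop
  rw [iSup_eq_top]
  constructor
  · intro h n
    obtain ⟨V, hV⟩ := h n (by simp)
    rw [lt_iSup_iff] at hV
    obtain ⟨l, hl⟩ := hV
    rw [lt_iSup_iff] at hl
    obtain ⟨h1, h2⟩ := hl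
    exact ⟨V, l, h1, by exact_mod_cast h2.le⟩
  · intro h b hb
    lift b to ℕ using hb.ne
    obtain ⟨V, l, h1, h2⟩ := h (b + 1)
    refine ⟨V, lt_of_lt_of_le ?_ (le_iSup_of_le l (le_iSup_of_le h1 le_rfl))⟩
    exact_mod_cast h2

/-- joint event -/
def ATn (n : ℕ) : Set ((Site 2 → ℕ) × Stacks 2) := {q | ∃ k, Top (Bx k) q.2 q.1 0 n}

/-- joint event -/
def AT : Set ((Site 2 → ℕ) × Stacks 2) := {q | Atop q.2 q.1 0}

theorem meas_ATn (n : ℕ) : MeasurableSet (ATn n) := by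
  have : ATn n = ⋃ k, {q | Top (Bx k) q.2 q.1 0 n} := by ext q; simp [ATn]
  rw [this]
  exact MeasurableSet.iUnion fun k => meas_Top _ _ _

theorem exists_Top_iff (I : Stacks 2) (η : Site 2 → ℕ) (y : Site 2) (n : ℕ) :
    (∃ V, Top V I η y n) ↔ ∃ k, Top (Bx k) I η y n := by
  constructor
  · rintro ⟨V, h⟩
    obtain ⟨k, hk⟩ := exists_Bx V
    exact ⟨k, Top_mono hk h⟩
  · rintro ⟨k, h⟩; exact ⟨_, h⟩

theorem AT_eq : AT = ⋂ n, ATn n := by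
  ext q; simp only [AT, Atop, Set.mem_ofPred_eq, Set.mem_iInter, ATn, exists_Top_iff]

theorem meas_AT : MeasurableSet AT := by
  rw [AT_eq]; exact MeasurableSet.iInter fun n => meas_ATn n

theorem ATn_anti : Antitone ATn := by
  rintro n m h q ⟨k, hk⟩
  exact ⟨k, Top_anti h hk⟩

theorem Atop_shift (I : Stacks 2) (η : Site 2 → ℕ) (y z : Site 2) :
    Atop (shiftI z I) (shift z η) y ↔ Atop I η (y + z) := by
  unfold Atop
  refine forall_congr' fun n => ?_
  constructor
  · rintro ⟨V, h⟩
    refine ⟨V.image (· + z), (Top_shift _ V z ?_ I η y n).1 h⟩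
    intro x; simp
  · rintro ⟨V, h⟩
    refine ⟨V.image (· - z), (Top_shift V _ z ?_ I η y n).2 h⟩
    intro x
    simp only [Finset.mem_image]
    constructor
    · rintro ⟨a, ha, rfl⟩; simpa using ha
    · intro hx; exact ⟨_, hx, by simp⟩

theorem Atop_nbr (I : Stacks 2) (η : Site 2 → ℕ) (x z : Site 2) (hz : z ∈ nbrs)
    (hI : ∀ n, ∃ k ≥ n, I (x, k) = some z) (h : Atop I η x) : Atop I η (x + z) := by
  intro m
  obtain ⟨n, hn⟩ := nj_unbounded I x z hI (m + 1)
  obtain ⟨V, hV⟩ := h n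
  exact ⟨insert (x + z) V, Top_neighbour _ I η x z (ne_zero_of_nbrs hz) (by simp) n m
    (Top_mono (Finset.subset_insert _ _) hV) hn⟩

theorem site_conn (P : Site 2 → Prop) (h : ∀ x, ∀ z ∈ nbrs, P x → P (x + z)) (x y : Site 2) (hx : P x) : P y := by
  have H : ∀ x, ∀ z ∈ nbrs, P x ↔ P (x + z) := by
    intro x z hz
    refine ⟨h x z hz, fun hh => ?_⟩
    have hnz : -z ∈ nbrs := by
      rw [mem4] at hz ⊢
      rcases hz with h | h | h | h <;> subst h <;> simp
    have := h _ _ hnz hh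
    simpa using this
  have h0 : ∀ a b : ℤ, P (x + ![a, b]) := by
    intro a
    induction a using Int.induction_on with
    | zero =>
      intro b
      induction b using Int.induction_on with
      | zero => convert hx using 1; funext i; fin_cases i <;> simp
      | succ i ih =>
        have := h _ ![0, 1] (by rw [mem4]; simp) ih
        convert this using 1; funext i; fin_cases i <;> simp [add_assoc] <;> rfl
      | pred i ih =>
        have := h _ ![0, -1] (by rw [mem4]; simp) ih
        convert this using 1; funext i; fin_cases i <;> simp [add_assoc, sub_eq_add_neg] <;> rfl
    | succ i ih =>
      intro b
      have := h _ ![1, 0] (by rw [mem4]; simp) (ih b)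
      convert this using 1; funext i; fin_cases i <;> simp [add_assoc] <;> rfl
    | pred i ih =>
      intro b
      have := h _ ![-1, 0] (by rw [mem4]; simp) (ih b)
      convert this using 1; funext i; fin_cases i <;> simp [add_assoc, sub_eq_add_neg] <;> rfl
  have := h0 (y 0 - x 0) (y 1 - x 1)
  convert this using 1
  funext i; fin_cases i <;> simp

theorem ae_Atop (lam : ℝ) (hl : 0 < lam) (η : Site 2 → ℕ) :
    ∀ᵐ I ∂(muP lam hl), ∀ x y, Atop I η x ↔ Atop I η y := by
  have : ∀ᵐ I ∂(muP lam hl), ∀ (x : Site 2) (z : nbrs), ∀ n, ∃ k ≥ n, I (x, k) = some z.1 := by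
    rw [ae_all_iff]; intro x
    rw [ae_all_iff]; intro z
    exact ae_jumps lam hl x z.1 z.2
  filter_upwards [this] with I hI x y
  exact ⟨site_conn (Atop I η) (fun x z hz h => Atop_nbr I η x z hz (hI x ⟨z, hz⟩) h) x y,
    site_conn (Atop I η) (fun x z hz h => Atop_nbr I η x z hz (hI x ⟨z, hz⟩) h) y x⟩

/-- probability of infinite odometer -/
def pA (lam : ℝ) (hl : 0 < lam) (η : Site 2 → ℕ) : ℝ≥0∞ := muP lam hl {I | (η, I) ∈ AT}

theorem meas_pA (lam : ℝ) (hl : 0 < lam) : Measurable (pA lam hl) :=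
  measurable_measure_prodMk_left meas_AT

theorem AT_shift_ae (lam : ℝ) (hl : 0 < lam) (η : Site 2 → ℕ) (z : Site 2) :
    {I | (shift z η, shiftI z I) ∈ AT} =ᵐ[muP lam hl] {I | (η, I) ∈ AT} := by
  filter_upwards [ae_Atop lam hl η] with I hI
  change (Atop (shiftI z I) (shift z η) 0) = (Atop I η 0)
  rw [Atop_shift]
  exact propext (hI _ _)

theorem pA_shift (lam : ℝ) (hl : 0 < lam) (η : Site 2 → ℕ) (z : Site 2) :
    pA lam hl (shift z η) = pA lam hl η := by
  unfold pA
  rw [← measure_congr (AT_shift_ae lam hl η z), ← muP_shift_apply lam hl z (fiber_meas meas_AT _)]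
  rfl

/-- finite approximation -/
def CT (n k : ℕ) : Set ((Site 2 → ℕ) × Stacks 2) :=
  {q | ∃ l : List (Site 2), l.length ≤ k ∧ Legal (Bx k) q.2 (initState 2 (Bx k) q.1) l ∧ n ≤ l.count 0}

theorem meas_CT (n k : ℕ) : MeasurableSet (CT n k) := by
  refine joint_meas (Bx k) (box2 (Bx k) (fun _ => 0) k) _ ?_
  rintro η η' I I' h1 h2 ⟨l, h3, h4, h5⟩
  refine ⟨l, h3, ?_, h5⟩
  simp only at h4 ⊢
  rw [← initState_congr h1]
  exact legal_dep _ l η I I' k h3 h2 h4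

theorem CT_dep (n k : ℕ) (η : Site 2 → ℕ) : DepOn (box2 (Bx k) (fun _ => 0) k) {I | (η, I) ∈ CT n k} := by
  rintro I I' h2 ⟨l, h3, h4, h5⟩
  exact ⟨l, h3, legal_dep _ l η I I' k h3 h2 h4, h5⟩

theorem CT_mono (n : ℕ) : Monotone (CT n) := by
  rintro k m h q ⟨l, h1, h2, h3⟩
  exact ⟨l, h1.trans h, legal_init_mono (Bx_mono h) _ _ _ h2, h3⟩

theorem CT_iUnion (n : ℕ) : ⋃ k, CT n k = ATn n := by
  ext q
  simp only [Set.mem_iUnion]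
  constructor
  · rintro ⟨k, l, _, h2, h3⟩; exact ⟨k, l, h2, h3⟩
  · rintro ⟨k, l, h2, h3⟩
    exact ⟨max k l.length, l, le_max_right _ _, legal_init_mono (Bx_mono (le_max_left _ _)) _ _ _ h2, h3⟩

theorem exists_CT (ν : Measure ((Site 2 → ℕ) × Stacks 2)) [IsFiniteMeasure ν] (ε : ℝ≥0∞) (hε : 0 < ε) :
    ∃ n k, ν (symmDiff AT (CT n k)) ≤ ε := by
  have h1 : Tendsto (fun n => ν (ATn n \ AT)) atTop (nhds 0) := by
    have := tendsto_measure_iInter_atTop (μ := ν) (s := fun n => ATn n \ AT)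
      (fun n => ((meas_ATn n).diff meas_AT).nullMeasurableSet)
      (fun a b h => Set.sdiff_subset_sdiff_left (ATn_anti h)) ⟨0, measure_ne_top _ _⟩
    have e : ⋂ n, ATn n \ AT = ∅ := by
      rw [AT_eq]; ext q; simp only [Set.mem_iInter, Set.mem_sdiff, Set.mem_empty_iff_false, iff_false]
      intro h; exact (h 0).2 fun n => (h n).1
    rwa [e, measure_empty] at this
  have hε2 : 0 < ε / 2 := ENNReal.half_pos hε.ne'
  obtain ⟨n, hn⟩ := (h1.eventually (gt_mem_nhds hε2)).exists
  have h2 : Tendsto (fun k => ν (ATn n \ CT n k)) atTop (nhds 0) := by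
    have := tendsto_measure_iInter_atTop (μ := ν) (s := fun k => ATn n \ CT n k)
      (fun k => ((meas_ATn n).diff (meas_CT n k)).nullMeasurableSet)
      (fun a b h => Set.sdiff_subset_sdiff_right (CT_mono n h)) ⟨0, measure_ne_top _ _⟩
    have e : ⋂ k, ATn n \ CT n k = ∅ := by
      rw [← CT_iUnion]; ext q; simp only [Set.mem_iInter, Set.mem_sdiff, Set.mem_empty_iff_false, iff_false]
      intro h
      have := (h 0).1
      rw [Set.mem_iUnion] at this
      obtain ⟨k, hk⟩ := this
      exact (h k).2 hk
    rwa [e, measure_empty] at this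
  obtain ⟨k, hk⟩ := (h2.eventually (gt_mem_nhds hε2)).exists
  refine ⟨n, k, ?_⟩
  calc ν (symmDiff AT (CT n k)) ≤ ν ((ATn n \ AT) ∪ (ATn n \ CT n k)) := by
        refine measure_mono ?_
        rintro q (⟨h1, h2⟩ | ⟨h1, h2⟩)
        · right; refine ⟨?_, h2⟩; rw [AT_eq] at h1; exact Set.mem_iInter.1 h1 n
        · left; refine ⟨?_, h2⟩; rw [← CT_iUnion]; exact Set.mem_iUnion.2 ⟨k, h1⟩
    _ ≤ _ := measure_union_le _ _
    _ ≤ ε / 2 + ε / 2 := add_le_add hn.le hk.le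
    _ = ε := ENNReal.add_halves ε

theorem box2_far (k : ℕ) : Disjoint (box2 (Bx k) (fun _ => 0) k)
    ((box2 (Bx k) (fun _ => 0) k).image fun p => (p.1 + ![2 * (k : ℤ) + 1, 0], p.2)) := by
  rw [Finset.disjoint_left]
  rintro ⟨x, m⟩ h1 h2
  rw [Finset.mem_image] at h2
  obtain ⟨⟨y, m'⟩, h3, h4⟩ := h2
  simp only [Prod.mk.injEq] at h4
  have h5 := mem_Bx.1 (mem_box2.1 h1).1
  have h6 := mem_Bx.1 (mem_box2.1 h3).1
  have h7 := congrFun h4.1 0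
  simp at h7 h5 h6
  omega

theorem DepOn_shift {F : Finset (Site 2 × ℕ)} {A : Set (Stacks 2)} (h : DepOn F A) (z : Site 2) :
    DepOn (F.image fun p => (p.1 + z, p.2)) {I | shiftI z I ∈ A} := by
  intro I J hIJ hI
  refine h _ _ (fun p hp => ?_) hI
  exact hIJ _ (Finset.mem_image.2 ⟨p, hp, rfl⟩)

theorem pA_le_sq (lam : ℝ) (hl : 0 < lam) (n k : ℕ) (η : Site 2 → ℕ) (z : Site 2) (hz : z = ![2 * (k : ℤ) + 1, 0]) :
    pA lam hl η ≤ pA lam hl η * pA lam hl η + 3 * muP lam hl {I | (η, I) ∈ symmDiff AT (CT n k)} +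
      2 * muP lam hl {I | (shift z η, I) ∈ symmDiff AT (CT n k)} := by
  set e := muP lam hl {I | (η, I) ∈ symmDiff AT (CT n k)}
  set e' := muP lam hl {I | (shift z η, I) ∈ symmDiff AT (CT n k)} with he'
  have hC : ∀ η, muP lam hl {I | (η, I) ∈ CT n k} ≤ pA lam hl η + muP lam hl {I | (η, I) ∈ symmDiff AT (CT n k)} := by
    intro η
    refine le_trans (measure_mono ?_) (measure_union_le _ _)
    intro I hI
    by_cases h : (η, I) ∈ AT
    · exact Or.inl h
    · exact Or.inr (Or.inr ⟨hI, h⟩)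
  have h1 : pA lam hl η = muP lam hl ({I | (η, I) ∈ AT} ∩ {I | (shift z η, shiftI z I) ∈ AT}) := by
    have := (ae_eq_set_inter (ae_eq_refl {I | (η, I) ∈ AT}) (AT_shift_ae lam hl η z))
    rw [measure_congr this, Set.inter_self]; rfl
  have h2 : muP lam hl ({I | (η, I) ∈ CT n k} ∩ {I | (shift z η, shiftI z I) ∈ CT n k}) =
      muP lam hl {I | (η, I) ∈ CT n k} * muP lam hl {I | (shift z η, I) ∈ CT n k} := by
    have hd := DepOn_shift (CT_dep n k (shift z η)) z
    have hdis := box2_far k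
    rw [← hz] at hdis
    rw [← muP_shift_apply lam hl z (fiber_meas (meas_CT n k) (shift z η))]
    exact DepOn.indep (CT_dep n k η) hd hdis
  have h3 : pA lam hl η ≤ muP lam hl {I | (η, I) ∈ CT n k} * muP lam hl {I | (shift z η, I) ∈ CT n k} + (e + e') := by
    have e3 : e' = muP lam hl {I | (shift z η, shiftI z I) ∈ symmDiff AT (CT n k)} := by
      rw [he', ← muP_shift_apply lam hl z (fiber_meas (meas_AT.symmDiff (meas_CT n k)) (shift z η))]; rfl
    rw [h1, ← h2, e3]
    refine le_trans (measure_mono ?_) (le_trans (measure_union_le _ _) (add_le_add_right (measure_union_le _ _) _))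
    rintro I ⟨hI1, hI2⟩
    by_cases c1 : (η, I) ∈ CT n k
    · by_cases c2 : (shift z η, shiftI z I) ∈ CT n k
      · exact Or.inl ⟨c1, c2⟩
      · exact Or.inr (Or.inr (Or.inl ⟨hI2, c2⟩))
    · exact Or.inr (Or.inl (Or.inl ⟨hI1, c1⟩))
  have hp1 : pA lam hl η ≤ 1 := prob_le_one
  have he1 : e' ≤ 1 := prob_le_one
  have hC2 := hC (shift z η)
  rw [pA_shift] at hC2
  calc pA lam hl η ≤ _ := h3
    _ ≤ (pA lam hl η + e) * (pA lam hl η + e') + (e + e') := by gcongr; exact hC η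
    _ = pA lam hl η * pA lam hl η + e * (pA lam hl η + e') + pA lam hl η * e' + (e + e') := by ring
    _ ≤ pA lam hl η * pA lam hl η + e * (1 + 1) + 1 * e' + (e + e') := by gcongr
    _ = _ := by ring

theorem lintegral_shift {ν : Measure (Site 2 → ℕ)} (hν : ∀ z, Measure.map (shift z) ν = ν)
    {f : (Site 2 → ℕ) → ℝ≥0∞} (hf : Measurable f) (z : Site 2) :
    ∫⁻ η, f (shift z η) ∂ν = ∫⁻ η, f η ∂ν := by
  have hm : Measurable (shift (d := 2) z) := measurable_pi_lambda _ fun x => measurable_pi_apply _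
  conv_rhs => rw [← hν z, lintegral_map hf hm]

theorem pA_zero_one (lam : ℝ) (hl : 0 < lam) (ν : Measure (Site 2 → ℕ)) [IsProbabilityMeasure ν]
    (hν : ∀ z, Measure.map (shift z) ν = ν) : ∀ᵐ η ∂ν, pA lam hl η = 0 ∨ pA lam hl η = 1 := by
  have hp1 : ∀ η, pA lam hl η ≤ 1 := fun η => prob_le_one
  have hm := meas_pA lam hl
  have key : ∫⁻ η, pA lam hl η ∂ν ≤ ∫⁻ η, pA lam hl η * pA lam hl η ∂ν := by
    refine ENNReal.le_of_forall_pos_le_add fun ε hε _ => ?_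
    obtain ⟨n, k, hnk⟩ := exists_CT (ν.prod (muP lam hl)) (ε / 5) (ENNReal.div_pos (by simpa using hε.ne') (by norm_num))
    have hS : MeasurableSet (symmDiff AT (CT n k)) := meas_AT.symmDiff (meas_CT n k)
    rw [Measure.prod_apply hS] at hnk
    have hme : Measurable fun η => muP lam hl {I | (η, I) ∈ symmDiff AT (CT n k)} :=
      measurable_measure_prodMk_left hS
    set z : Site 2 := ![2 * (k : ℤ) + 1, 0]
    have hms : Measurable (shift (d := 2) z) := measurable_pi_lambda _ fun x => measurable_pi_apply _
    have hm2 : Measurable (fun η => pA lam hl η * pA lam hl η) := hm.mul hm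
    have hm3 : Measurable (fun η => pA lam hl η * pA lam hl η +
        3 * muP lam hl {I | (η, I) ∈ symmDiff AT (CT n k)}) := hm2.add (hme.const_mul _)
    have hm4 : Measurable (fun η => muP lam hl {I | (shift z η, I) ∈ symmDiff AT (CT n k)}) := hme.comp hms
    calc ∫⁻ η, pA lam hl η ∂ν ≤ ∫⁻ η, (pA lam hl η * pA lam hl η + 3 * muP lam hl {I | (η, I) ∈ symmDiff AT (CT n k)} +
          2 * muP lam hl {I | (shift z η, I) ∈ symmDiff AT (CT n k)}) ∂ν :=
          lintegral_mono fun η => pA_le_sq lam hl n k η z rfl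
      _ = ∫⁻ η, pA lam hl η * pA lam hl η ∂ν + 3 * ∫⁻ η, muP lam hl {I | (η, I) ∈ symmDiff AT (CT n k)} ∂ν +
          2 * ∫⁻ η, muP lam hl {I | (η, I) ∈ symmDiff AT (CT n k)} ∂ν := by
          rw [lintegral_add_left hm3, lintegral_add_left hm2,
            lintegral_const_mul _ hme, lintegral_const_mul _ hm4, lintegral_shift hν hme z]
      _ ≤ ∫⁻ η, pA lam hl η * pA lam hl η ∂ν + 3 * (ε / 5) + 2 * (ε / 5) := by
          gcongr <;> exact hnk
      _ = _ := by
          rw [add_assoc, ← add_mul]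
          congr 1
          norm_num
          exact ENNReal.mul_div_cancel (by norm_num) (by norm_num)
  have hle : ∀ η, pA lam hl η * pA lam hl η ≤ pA lam hl η := fun η => mul_le_of_le_one_right (by simp) (hp1 η)
  have hfin : ∫⁻ η, pA lam hl η * pA lam hl η ∂ν ≠ ⊤ := by
    refine ne_top_of_le_ne_top (b := 1) (by simp) ?_
    calc _ ≤ ∫⁻ _, 1 ∂ν := lintegral_mono fun η => (hle η).trans (hp1 η)
      _ = 1 := by simp
  have hae : (fun η => pA lam hl η * pA lam hl η) =ᵐ[ν] pA lam hl :=
    ae_eq_of_ae_le_of_lintegral_le (Eventually.of_forall hle) hfin hm.aemeasurable key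
  filter_upwards [hae] with η hη
  by_cases h0 : pA lam hl η = 0
  · exact Or.inl h0
  · right
    have := (ENNReal.mul_eq_left h0 ((hp1 η).trans_lt (by simp)).ne).1 hη
    exact this

theorem pA_dichotomy (lam : ℝ) (hl : 0 < lam) (ν : Measure (Site 2 → ℕ)) [IsProbabilityMeasure ν]
    (hν : IsTransErgodic ν) (hnf : ¬ Fixates 2 (ssrwStep 2) lam ν) : ∀ᵐ η ∂ν, pA lam hl η = 1 := by
  have h01 := pA_zero_one lam hl ν hν.1
  have hm := meas_pA lam hl
  rcases hν.2 {η | pA lam hl η = 1} (hm (measurableSet_singleton _)) (by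
    intro z; ext η; simp [pA_shift]) with h | h
  · exfalso
    apply hnf
    unfold Fixates
    rw [stackLaw_eq lam hl]
    have h' : ∀ᵐ η ∂ν, pA lam hl η ≠ 1 := by rw [ae_iff]; simpa using h
    filter_upwards [h01, h'] with η h1 h2
    have h3 : pA lam hl η = 0 := h1.resolve_right h2
    rw [ae_iff]
    simp only [not_not, odom_top]
    exact h3
  · rw [ae_iff, ← Set.compl_ofPred]
    exact (prob_compl_eq_zero_iff (hm (measurableSet_singleton _))).2 h

end
end ARW

end


section
open MeasureTheory ENNReal Filter
set_option linter.unusedSimpArgs false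

namespace ARW

noncomputable section
open scoped Classical

/-! ### Fixation at low density -/

theorem mass_bound (lam : ℝ) (hl : 0 < lam) (V : Finset (Site 2)) (η : Site 2 → ℕ) :
    ∑ x ∈ V, muP lam hl {I | Fin_ V I η x} ≤ ∑ x ∈ V, (η x : ℝ≥0∞) := by
  have h : ∀ x, muP lam hl {I | Fin_ V I η x} = ∫⁻ I, (if Fin_ V I η x then (1 : ℝ≥0∞) else 0) ∂(muP lam hl) := by
    intro x
    rw [← lintegral_indicator_one (meas_Fin V η x)]
    refine lintegral_congr fun I => ?_
    simp [Set.indicator_apply]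
  simp only [h]
  rw [← lintegral_finsetSum]
  · calc _ ≤ ∫⁻ _, (∑ x ∈ V, (η x : ℝ≥0∞)) ∂(muP lam hl) := lintegral_mono fun I => sum_Fin_le V I η
      _ = _ := by simp
  · intro x _
    exact Measurable.ite (meas_Fin V η x) measurable_const measurable_const

/-- probability of toppling the origin `n` times in a box -/
def hB (lam : ℝ) (hl : 0 < lam) (k n : ℕ) (η : Site 2 → ℕ) : ℝ≥0∞ := muP lam hl {I | Top (Bx k) I η 0 n}

theorem meas_hB (lam : ℝ) (hl : 0 < lam) (k n : ℕ) : Measurable (hB lam hl k n) :=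
  measurable_measure_prodMk_left (meas_Top (Bx k) 0 n)

theorem hB_shift (lam : ℝ) (hl : 0 < lam) (k n : ℕ) (x : Site 2) (V : Finset (Site 2))
    (hV : ∀ y ∈ Bx k, y + x ∈ V) (η : Site 2 → ℕ) :
    hB lam hl k n (shift x η) ≤ muP lam hl {I | Top V I η x n} := by
  unfold hB
  rw [← muP_shift_apply lam hl x 
    (A := {I | Top (Bx k) I (shift x η) 0 n}) (fiber_meas (meas_Top (Bx k) 0 n) (shift x η))]
  refine measure_mono ?_
  intro I hI
  have h1 : Top ((Bx k).image (· + x)) I η (0 + x) n := by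
    refine (Top_shift _ (Bx k) x ?_ I η 0 n).1 hI
    intro y; simp
  rw [zero_add] at h1
  refine Top_mono ?_ h1
  intro y hy
  obtain ⟨a, ha, rfl⟩ := Finset.mem_image.1 hy
  exact hV a ha

theorem hB_shift' (lam : ℝ) (hl : 0 < lam) (k n : ℕ) (x : Site 2) (V : Finset (Site 2))
    (hV : ∀ y ∈ V, y - x ∈ Bx k) (η : Site 2 → ℕ) :
    muP lam hl {I | Top V I η x n} ≤ hB lam hl k n (shift x η) := by
  unfold hB
  rw [← muP_shift_apply lam hl x 
    (A := {I | Top (Bx k) I (shift x η) 0 n}) (fiber_meas (meas_Top (Bx k) 0 n) (shift x η))]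
  refine measure_mono ?_
  intro I hI
  have h1 : Top ((Bx k).image (· + x)) I η (0 + x) n := by
    rw [zero_add]
    refine Top_mono ?_ hI
    intro y hy
    exact Finset.mem_image.2 ⟨y - x, hV y hy, by simp⟩
  exact (Top_shift _ (Bx k) x (by intro y; simp) I η 0 n).2 h1

theorem ratio_lim {A B : ℝ} (hB : 0 ≤ B) (k : ℕ)
    (h : ∀ m : ℕ, ((2 * m + 1 : ℕ) : ℝ) ^ 2 * A ≤ ((2 * (k + m) + 1 : ℕ) : ℝ) ^ 2 * B) : A ≤ B := by
  by_contra hAB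
  push Not at hAB
  have hd : 0 < A - B := by linarith
  obtain ⟨m, hm⟩ := exists_nat_gt ((4 * k + 4 * k ^ 2) * B / (A - B))
  have h1 := h m
  rw [div_lt_iff₀ hd] at hm
  push_cast at h1
  have hm0 : (0 : ℝ) ≤ m := Nat.cast_nonneg m
  have hk0 : (0 : ℝ) ≤ k := Nat.cast_nonneg k
  have e : ((2 * ((k : ℝ) + m) + 1) ^ 2 - (2 * m + 1) ^ 2) = (2 * m + 1) * (4 * k) + 4 * k ^ 2 := by ring
  have h2 : (2 * (m : ℝ) + 1) ^ 2 * (A - B) ≤ ((2 * m + 1) * (4 * k) + 4 * k ^ 2) * B := by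
    rw [← e]; linarith
  have h3 : ((2 * (m : ℝ) + 1) * (4 * k) + 4 * k ^ 2) * B ≤ (2 * m + 1) * ((4 * k + 4 * k ^ 2) * B) := by
    have : 0 ≤ (2 * (m : ℝ)) * (4 * k ^ 2) * B := by positivity
    nlinarith
  have h4 : (2 * (m : ℝ) + 1) * (A - B) ≤ (4 * k + 4 * k ^ 2) * B := by
    have : (2 * (m : ℝ) + 1) * ((2 * (m : ℝ) + 1) * (A - B)) ≤ (2 * m + 1) * ((4 * k + 4 * k ^ 2) * B) := by
      nlinarith
    exact le_of_mul_le_mul_left this (by positivity)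
  nlinarith

theorem density_bound {lam : ℝ} (hl : 0 < lam) (hl2 : lam ≤ 1 / 256) {N : ℝ} (hN : 1 ≤ N) (hNi : ∃ k : ℕ, N = k)
    (hN2 : lam * N ≤ 1 / 8) (ν : Measure (Site 2 → ℕ)) [IsProbabilityMeasure ν]
    (hν : ∀ z, Measure.map (shift z) ν = ν) {ρ : ℝ} (hρ : 0 ≤ ρ)
    (hm : ∫⁻ η, (η 0 : ℝ≥0∞) ∂ν = ENNReal.ofReal ρ) (k : ℕ) (hk : N ≤ k) :
    ENNReal.ofReal (psi lam N 0) * ∫⁻ η, hB lam hl k 1 η ∂ν ≤ ENNReal.ofReal ρ := by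
  set ψ0 := psi lam N 0
  set v := ∫⁻ η, hB lam hl k 1 η ∂ν with hv
  have hv1 : v ≤ 1 := by
    calc v ≤ ∫⁻ _, 1 ∂ν := lintegral_mono fun η => prob_le_one
      _ = 1 := by simp
  have hψ0 : 0 ≤ ψ0 := psi_nonneg hl 0
  have main : ∀ m : ℕ, (((2 * m + 1) ^ 2 : ℕ) : ℝ≥0∞) * (ENNReal.ofReal ψ0 * v) ≤
      (((2 * (k + m) + 1) ^ 2 : ℕ) : ℝ≥0∞) * ENNReal.ofReal ρ := by
    intro m
    have hpt : ∀ η, ∑ x ∈ Bx m, ENNReal.ofReal ψ0 * hB lam hl k 1 (shift x η) ≤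
        ∑ x ∈ Bx (k + m), (η x : ℝ≥0∞) := by
      intro η
      refine le_trans ?_ (mass_bound lam hl (Bx (k + m)) η)
      refine le_trans (Finset.sum_le_sum fun x hx => ?_)
        (Finset.sum_le_sum_of_subset (Bx_mono (Nat.le_add_left m k)))
      have hx' := mem_Bx.1 hx
      refine le_trans ?_ (sleep_bound hl (V := Bx (k + m)) (o := x) (Bx_mono (Nat.le_add_left m k) hx)
        (ψ := psi lam N) (psi_nonneg hl) (psi_le_one hl hl2 hN hN2) ?_ (fun y hy => psi_sub hl hN hNi y hy)
        (psi_sub0 hl hN hNi) η)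
      · refine mul_le_mul_right (hB_shift lam hl k 1 x _ ?_ η) _
        intro y hy
        have hy' := mem_Bx.1 hy
        rw [mem_Bx]; simp only [Pi.add_apply]; push_cast; omega
      · intro y hy
        unfold psi
        rw [if_neg]
        push Not
        rw [mem_Bx] at hy
        have hc : (k : ℤ) < (y 0 - x 0) ∨ (y 0 - x 0) < -(k : ℤ) ∨ (k : ℤ) < (y 1 - x 1) ∨ (y 1 - x 1) < -(k : ℤ) := by
          push_cast at hy; omega
        have hk1 : (1 : ℝ) ≤ k := hN.trans hk
        have hsq : ∀ t : ℤ, (k : ℤ) < t ∨ t < -(k : ℤ) → (k : ℝ) < (t : ℝ) ^ 2 := by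
          rintro t (h | h)
          · have : (k : ℝ) < t := by exact_mod_cast h
            nlinarith
          · have : (t : ℝ) < -(k : ℝ) := by exact_mod_cast h
            nlinarith
        unfold qq
        simp only [Pi.sub_apply]
        rcases or_assoc.2 hc with h | h
        · have := hsq _ h
          nlinarith [sq_nonneg (((y 1 - x 1 : ℤ) : ℝ))]
        · have := hsq _ h
          nlinarith [sq_nonneg (((y 0 - x 0 : ℤ) : ℝ))]
    have hInteg := lintegral_mono (μ := ν) hpt
    rw [lintegral_finsetSum, lintegral_finsetSum] at hInteg
    · have e1 : ∀ x ∈ Bx m, ∫⁻ η, ENNReal.ofReal ψ0 * hB lam hl k 1 (shift x η) ∂ν = ENNReal.ofReal ψ0 * v := by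
        intro x _
        rw [lintegral_shift (f := fun η => ENNReal.ofReal ψ0 * hB lam hl k 1 η) hν
          ((meas_hB lam hl k 1).const_mul _) x, lintegral_const_mul _ (meas_hB lam hl k 1)]
      have e2 : ∀ x ∈ Bx (k + m), ∫⁻ η, (η x : ℝ≥0∞) ∂ν = ENNReal.ofReal ρ := by
        intro x _
        rw [← hm, ← lintegral_shift (f := fun η => ((η 0 : ℕ) : ℝ≥0∞)) hν ?_ x]
        · simp [shift]
        · exact (measurable_of_countable (fun n : ℕ => (n : ℝ≥0∞))).comp (measurable_pi_apply 0)
      rw [Finset.sum_congr rfl e1, Finset.sum_congr rfl e2, Finset.sum_const, Finset.sum_const,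
        card_Bx, card_Bx, nsmul_eq_mul, nsmul_eq_mul] at hInteg
      exact hInteg
    · intro x _
      exact (measurable_of_countable (fun n : ℕ => (n : ℝ≥0∞))).comp (measurable_pi_apply x)
    · intro x _
      refine Measurable.const_mul ((meas_hB lam hl k 1).comp ?_) _
      exact measurable_pi_lambda _ fun x => measurable_pi_apply _
  have hvt : v ≠ ⊤ := ne_top_of_le_ne_top (by simp) hv1
  have hrl : ψ0 * v.toReal ≤ ρ := by
    refine ratio_lim hρ k fun m => ?_
    have h1 := ENNReal.toReal_mono (by finiteness) (main m)
    rw [ENNReal.toReal_mul, ENNReal.toReal_mul, ENNReal.toReal_mul, ENNReal.toReal_natCast,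
      ENNReal.toReal_natCast, ENNReal.toReal_ofReal hψ0, ENNReal.toReal_ofReal hρ] at h1
    push_cast at h1 ⊢
    linarith
  rw [← ENNReal.ofReal_toReal hvt, ← ENNReal.ofReal_mul hψ0]
  exact ENNReal.ofReal_le_ofReal hrl

theorem hB_tendsto (lam : ℝ) (hl : 0 < lam) (n : ℕ) (ν : Measure (Site 2 → ℕ)) [IsProbabilityMeasure ν] :
    Tendsto (fun k => ∫⁻ η, hB lam hl k n η ∂ν) atTop (nhds ((ν.prod (muP lam hl)) (ATn n))) := by
  have e : ∀ k, ∫⁻ η, hB lam hl k n η ∂ν = (ν.prod (muP lam hl)) {q | Top (Bx k) q.2 q.1 0 n} := by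
    intro k
    rw [Measure.prod_apply (meas_Top (Bx k) 0 n)]; rfl
  simp only [e]
  have e2 : ATn n = ⋃ k, {q | Top (Bx k) q.2 q.1 0 n} := by ext q; simp [ATn]
  rw [e2]
  refine tendsto_measure_iUnion_atTop ?_
  intro a b hab q hq
  exact Top_mono (Bx_mono hab) hq

theorem fixates_low {lam : ℝ} (hl : 0 < lam) (hl2 : lam ≤ 1 / 256) (ν : Measure (Site 2 → ℕ)) [IsProbabilityMeasure ν]
    (hν : IsTransErgodic ν)
    (hm : ∫⁻ η, (η 0 : ℝ≥0∞) ∂ν = ENNReal.ofReal (1 / 100 * (lam * Real.log (1 / lam)))) :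
    Fixates 2 (ssrwStep 2) lam ν := by
  by_contra hnf
  have h1 := pA_dichotomy lam hl ν hν hnf
  obtain ⟨N, hN, hNi, hN2, hlt⟩ := psi_origin hl hl2
  have hρ : 0 ≤ 1 / 100 * (lam * Real.log (1 / lam)) := by
    have : 0 ≤ Real.log (1 / lam) := Real.log_nonneg (by rw [le_div_iff₀ hl]; linarith)
    positivity
  have hAT : (ν.prod (muP lam hl)) AT = 1 := by
    rw [Measure.prod_apply meas_AT]
    have : ∫⁻ η, muP lam hl (Prod.mk η ⁻¹' AT) ∂ν = ∫⁻ _, 1 ∂ν := lintegral_congr_ae h1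
    rw [this]; simp
  have hATn : (ν.prod (muP lam hl)) (ATn 1) = 1 := by
    refine le_antisymm prob_le_one ?_
    rw [← hAT]
    refine measure_mono ?_
    rw [AT_eq]; exact Set.iInter_subset _ _
  have ht := hB_tendsto lam hl 1 ν
  rw [hATn] at ht
  have ht2 := ENNReal.Tendsto.const_mul (a := ENNReal.ofReal (psi lam N 0)) ht (Or.inl (by simp))
  have := le_of_tendsto ht2 (b := ENNReal.ofReal (1 / 100 * (lam * Real.log (1 / lam)))) (by
    obtain ⟨k0, hk0⟩ := hNi
    filter_upwards [eventually_ge_atTop k0] with k hk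
    refine density_bound hl hl2 hN ⟨k0, hk0⟩ hN2 ν hν.1 hρ hm k ?_
    rw [hk0]; exact_mod_cast hk)
  rw [mul_one, ENNReal.ofReal_le_ofReal_iff hρ] at this
  linarith

end
end ARW

end


section
open MeasureTheory ENNReal Filter
set_option linter.unusedSimpArgs false

namespace ARW

noncomputable section
open scoped Classical

/-! ### Moments of the odometer -/

theorem inv_triv (V : Finset (Site 2)) (o : Site 2) : Inv V o (fun _ => True) := fun _ _ _ _ _ _ => trivial

theorem inv_mass (V : Finset (Site 2)) (o : Site 2) (M : ℝ) : Inv V o (fun c => lin V (fun _ => 1) c.1.1 ≤ M) := by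
  intro c x hc hp i hi
  have hx := pol_some hp
  simp only [upd, topI]
  rcases i with _ | z
  · rw [lin_app_none V _ _ x hx.2]; exact hc
  · rw [lin_app_some V _ _ x z hx.1 hx.2]
    split_ifs <;> linarith

theorem odo_sub {lam : ℝ} (hl : 0 < lam) (V S : Finset (Site 2)) (o : Site 2) (g : Site 2 → ℝ)
    (hg : ∀ x ∈ V, g x - (if x ∈ S then 1 else 0) ≤ Pav (kil V g) x) (n : ℕ) (c : CS) :
    lin V g c.1.1 + lamJ lam * ∑ y ∈ S, (c.1.2 y : ℝ) ≤
      EE lam V o (fun c => lin V g c.1.1 + lamJ lam * ∑ y ∈ S, (c.1.2 y : ℝ)) n c := by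
  refine EE_sub hl (inv_triv V o) (Φ := fun c => lin V g c.1.1 + lamJ lam * ∑ y ∈ S, (c.1.2 y : ℝ))
    (fun c _ => ?_) n c trivial
  rcases hp : pol V o c with _ | x
  · rw [TT_none hp]
  · have hx := pol_some hp
    rw [TT_some hp]
    simp only [upd, topI, mul_add, Finset.sum_add_distrib]
    rw [exp_lin hl V g _ x hx.1 hx.2, ← Finset.sum_mul, sum_wt hl, one_mul]
    have e : ∑ y ∈ S, ((Function.update c.1.2 x (c.1.2 x + 1) y : ℕ) : ℝ) =
        ∑ y ∈ S, (c.1.2 y : ℝ) + (if x ∈ S then 1 else 0) := by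
      have : ∀ y, ((Function.update c.1.2 x (c.1.2 x + 1) y : ℕ) : ℝ) = (c.1.2 y : ℝ) + (if y = x then 1 else 0) := by
        intro y
        by_cases h : y = x
        · subst h; simp
        · simp [h]
      simp only [this, Finset.sum_add_distrib]
      congr 1
      rw [Finset.sum_ite_eq']
    rw [e]
    have := hg x hx.1
    have := lamJ_pos hl
    nlinarith

theorem odo_lower {lam : ℝ} (hl : 0 < lam) (V S : Finset (Site 2)) (o : Site 2) (g : Site 2 → ℝ)
    (hg : ∀ x ∈ V, g x - (if x ∈ S then 1 else 0) ≤ Pav (kil V g) x) (hg0 : ∀ x, 0 ≤ g x) (G : ℝ)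
    (hG : ∀ x, g x ≤ G) (η : Site 2 → ℕ) (hη : ∀ x, 2 ≤ η x) (n : ℕ) :
    ∑ x ∈ V, g x ≤ lamJ lam * ∑ y ∈ S, EE lam V o (fun c => (c.1.2 y : ℝ)) n (c0 V η) +
      G * lin V (fun _ => 1) (c0 V η).1.1 * EE lam V o (ind (ns V o)) n (c0 V η) := by
  set Ma := lin V (fun _ => 1) (c0 V η).1.1 with hMa
  have hG0 : 0 ≤ G := (hg0 0).trans (hG 0)
  have h1 := odo_sub hl V S o g hg n (c0 V η)
  rw [EE_add] at h1
  simp only at h1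
  rw [EE_smul] at h1
  simp only at h1
  rw [EE_sum lam hl] at h1
  have h2 : 2 * ∑ x ∈ V, g x ≤ lin V g (c0 V η).1.1 := by
    unfold lin
    rw [Finset.mul_sum]
    refine Finset.sum_le_sum fun x hx => mul_le_mul_of_nonneg_right ?_ (hg0 x)
    simp only [c0, initState, cnt, hx, if_true]
    exact_mod_cast hη x
  have h3 : ∑ y ∈ S, (((c0 V η).1.2 y : ℕ) : ℝ) = 0 := by simp [c0, initState]
  have h4 : EE lam V o (fun c => lin V g c.1.1) n (c0 V η) ≤
      EE lam V o (fun c => ∑ x ∈ V, g x + (G * Ma) * ind (ns V o) c) n (c0 V η) := by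
    refine EE_mono hl (inv_mass V o Ma) ?_ n (c0 V η) le_rfl
    intro c hc
    have hs0 : 0 ≤ ∑ x ∈ V, g x := Finset.sum_nonneg fun x _ => hg0 x
    by_cases hn : ns V o c
    · simp only [ind, hn, if_true, mul_one]
      have : lin V g c.1.1 ≤ G * lin V (fun _ => 1) c.1.1 := by
        unfold lin
        rw [Finset.mul_sum]
        refine Finset.sum_le_sum fun x _ => ?_
        have : (cnt (c.1.1 x) : ℝ) * g x ≤ cnt (c.1.1 x) * G := mul_le_mul_of_nonneg_left (hG x) (Nat.cast_nonneg _)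
        linarith
      have : G * lin V (fun _ => 1) c.1.1 ≤ G * Ma := mul_le_mul_of_nonneg_left hc hG0
      linarith
    · simp only [ind, hn, if_false, mul_zero, add_zero]
      have hst : Stable V c.1.1 := pol_none (by unfold ns at hn; push Not at hn; exact hn)
      refine Finset.sum_le_sum fun x hx => ?_
      have : (cnt (c.1.1 x) : ℝ) ≤ 1 := by exact_mod_cast cnt_le_one_of_stable (hst x hx)
      nlinarith [hg0 x]
  rw [EE_add, EE_const hl, EE_smul] at h4
  simp only at h4
  rw [h3] at h1
  linarith

theorem odo_sq {lam : ℝ} (hl : 0 < lam) (V : Finset (Site 2)) (o y : Site 2) (ψ w : Site 2 → ℝ)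
    (hψ0 : ∀ x ∈ V, 0 ≤ ψ x) (hψ : ∀ x ∈ V, Pav (kil V ψ) x ≤ ψ x - (if x = y then 1 else 0))
    (hd : ∀ x ∈ V, ∀ z ∈ nbrs, |kil V ψ (x + z) - ψ x| ≤ 8)
    (hw0 : ∀ x ∈ V, 0 ≤ w x) (hw : ∀ x ∈ V, Pav (kil V w) x ≤ w x - 1) (n : ℕ) (c : CS) :
    EE lam V o (fun c => (c.1.2 y : ℝ) ^ 2) n c ≤ ((c.1.2 y : ℝ) + lin V ψ c.1.1 / lamJ lam) ^ 2 +
      (1 + 8 / lamJ lam) ^ 2 / lamJ lam * lin V w c.1.1 := by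
  have hJ := lamJ_pos hl
  set K := (1 + 8 / lamJ lam) ^ 2 / lamJ lam with hK
  have hK0 : 0 ≤ K := by positivity
  have lin_nn : ∀ (f : Site 2 → ℝ), (∀ x ∈ V, 0 ≤ f x) → ∀ σ : Config 2, 0 ≤ lin V f σ := fun f hf σ =>
    Finset.sum_nonneg fun x hx => mul_nonneg (Nat.cast_nonneg _) (hf x hx)
  set Φ : CS → ℝ := fun c => ((c.1.2 y : ℝ) + lin V ψ c.1.1 / lamJ lam) ^ 2 + K * lin V w c.1.1 with hΦ
  refine le_trans (EE_mono hl (inv_triv V o) (Ψ := Φ) ?_ n c trivial)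
    (EE_super hl (inv_triv V o) (Φ := Φ) ?_ n c trivial)
  · intro c _
    have h1 := lin_nn ψ hψ0 c.1.1
    have h2 := lin_nn w hw0 c.1.1
    simp only [hΦ]
    have h3 : 0 ≤ lin V ψ c.1.1 / lamJ lam := by positivity
    have h4 : (0 : ℝ) ≤ c.1.2 y := Nat.cast_nonneg _
    have h5 : 0 ≤ K * lin V w c.1.1 := by positivity
    nlinarith
  · intro c _
    rcases hp : pol V o c with _ | x
    · rw [TT_none hp]
    · have hx := pol_some hp
      rw [TT_some hp]
      set B : ℝ := (c.1.2 y : ℝ) + lin V ψ c.1.1 / lamJ lam with hB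
      set δ : ℝ := if x = y then 1 else 0 with hδ
      have hB0 : 0 ≤ B := by
        have h1 := lin_nn ψ hψ0 c.1.1
        positivity
      have hm : ((Function.update c.1.2 x (c.1.2 x + 1) y : ℕ) : ℝ) = (c.1.2 y : ℝ) + δ := by
        rw [hδ]
        by_cases h : x = y
        · subst h; simp
        · simp [h, Ne.symm h]
      have hδ1 : |δ| ≤ 1 := by rw [hδ]; split_ifs <;> simp
      have hstep : ∀ i ∈ instrs, Φ (upd V o c x i) ≤
          2 * B * ((c.1.2 y : ℝ) + δ + lin V ψ (app V x i c.1.1) / lamJ lam) +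
          (- B ^ 2 + (1 + 8 / lamJ lam) ^ 2) + K * lin V w (app V x i c.1.1) := by
        intro i hi
        simp only [hΦ, upd, topI, hm]
        have hdi : |lin V ψ (app V x i c.1.1) - lin V ψ c.1.1| ≤ 8 := by
          rcases i with _ | z
          · rw [lin_app_none V _ _ x hx.2]; simp
          · rw [lin_app_some V _ _ x z hx.1 hx.2]
            have hz : z ∈ nbrs := by simpa [instrs] using hi
            have := hd x hx.1 z hz
            unfold kil at this
            convert this using 2; ring
        set B' : ℝ := (c.1.2 y : ℝ) + δ + lin V ψ (app V x i c.1.1) / lamJ lam with hB'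
        have hdd : |B' - B| ≤ 1 + 8 / lamJ lam := by
          have e : B' - B = δ + (lin V ψ (app V x i c.1.1) - lin V ψ c.1.1) / lamJ lam := by
            rw [hB', hB]; ring
          rw [e]
          refine (abs_add_le _ _).trans (add_le_add hδ1 ?_)
          rw [abs_div, abs_of_pos hJ]
          gcongr
        have h2 : (B' - B) ^ 2 ≤ (1 + 8 / lamJ lam) ^ 2 := by
          rw [← sq_abs]; gcongr
        nlinarith
      refine (Finset.sum_le_sum fun i hi => mul_le_mul_of_nonneg_left (hstep i hi) (wt_pos hl i).le).trans ?_
      have e1 : ∑ i ∈ instrs, wt lam i * (2 * B * ((c.1.2 y : ℝ) + δ + lin V ψ (app V x i c.1.1) / lamJ lam) +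
          (- B ^ 2 + (1 + 8 / lamJ lam) ^ 2) + K * lin V w (app V x i c.1.1)) =
          (2 * B * ((c.1.2 y : ℝ) + δ) + (- B ^ 2 + (1 + 8 / lamJ lam) ^ 2)) * ∑ i ∈ instrs, wt lam i +
          2 * B / lamJ lam * (∑ i ∈ instrs, wt lam i * lin V ψ (app V x i c.1.1)) +
          K * ∑ i ∈ instrs, wt lam i * lin V w (app V x i c.1.1) := by
        rw [Finset.mul_sum, Finset.mul_sum, Finset.mul_sum, ← Finset.sum_add_distrib, ← Finset.sum_add_distrib]
        refine Finset.sum_congr rfl fun i _ => ?_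
        ring
      rw [e1, sum_wt hl, exp_lin hl V ψ _ x hx.1 hx.2, exp_lin hl V w _ x hx.1 hx.2]
      have h1 := hψ x hx.1
      have h2 := hw x hx.1
      rw [← hδ] at h1
      have e2 : 2 * B / lamJ lam * (lin V ψ c.1.1 + lamJ lam * (Pav (kil V ψ) x - ψ x)) =
          2 * B * (lin V ψ c.1.1 / lamJ lam) + 2 * B * (Pav (kil V ψ) x - ψ x) := by
        field_simp
      have e3 : K * (lamJ lam * (Pav (kil V w) x - w x)) = (1 + 8 / lamJ lam) ^ 2 * (Pav (kil V w) x - w x) := by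
        rw [hK]; field_simp
      have h3 : 2 * B * (Pav (kil V ψ) x - ψ x) ≤ 2 * B * (-δ) :=
        mul_le_mul_of_nonneg_left (by linarith) (by linarith)
      have h4 : (1 + 8 / lamJ lam) ^ 2 * (Pav (kil V w) x - w x) ≤ (1 + 8 / lamJ lam) ^ 2 * (-1) :=
        mul_le_mul_of_nonneg_left (by linarith) (by positivity)
      have e4 : Φ c = B ^ 2 + K * lin V w c.1.1 := rfl
      rw [e2, mul_add K, e3, e4]
      have e5 : 2 * B * (c.1.2 y : ℝ) + 2 * B * (lin V ψ c.1.1 / lamJ lam) = 2 * B ^ 2 := by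
        rw [hB]; ring
      linarith

end
end ARW

end


section
open MeasureTheory ENNReal Filter
set_option linter.unusedSimpArgs false

namespace ARW

noncomputable section
open scoped Classical

/-! ### Concrete test functions -/

/-- quadratic bump -/
def gq (L : ℕ) (x : Site 2) : ℝ := max ((L : ℝ) ^ 2 - qq x) 0

theorem coord_sq {a r : ℝ} (h1 : -r ≤ a) (h2 : a ≤ r) : a ^ 2 ≤ r ^ 2 := by nlinarith

theorem nbr_coord {z : Site 2} (hz : z ∈ nbrs) : (-1 ≤ z 0 ∧ z 0 ≤ 1) ∧ (-1 ≤ z 1 ∧ z 1 ≤ 1) := by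
  rw [mem4] at hz
  rcases hz with h | h | h | h <;> subst h <;> simp

theorem mem_Bx_of_qq {L : ℕ} {x : Site 2} (h : qq x < (L : ℝ) ^ 2) : x ∈ Bx L := by
  unfold qq at h
  have h0 : ((x 0 : ℝ)) ^ 2 < (L : ℝ) ^ 2 := by nlinarith [sq_nonneg ((x 1 : ℝ))]
  have h1 : ((x 1 : ℝ)) ^ 2 < (L : ℝ) ^ 2 := by nlinarith [sq_nonneg ((x 0 : ℝ))]
  have h0' := abs_lt_of_sq_lt_sq' h0 (Nat.cast_nonneg L)
  have h1' := abs_lt_of_sq_lt_sq' h1 (Nat.cast_nonneg L)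
  rw [mem_Bx]
  refine ⟨⟨?_, ?_⟩, ?_, ?_⟩
  · have := h0'.1.le; exact_mod_cast this
  · have := h0'.2.le; exact_mod_cast this
  · have := h1'.1.le; exact_mod_cast this
  · have := h1'.2.le; exact_mod_cast this

theorem gq_sub (L : ℕ) (hL : 1 ≤ L) (x : Site 2) :
    gq L x - (if x ∈ Bx L then 1 else 0) ≤ Pav (kil (Bx (2 * L)) (gq L)) x := by
  have hk : ∀ y, 0 ≤ kil (Bx (2 * L)) (gq L) y := by
    intro y; unfold kil gq; split_ifs <;> simp
  by_cases h : qq x < (L : ℝ) ^ 2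
  · have hx := mem_Bx_of_qq h
    rw [if_pos hx]
    have e : gq L x = (L : ℝ) ^ 2 - qq x := by unfold gq; rw [max_eq_left]; linarith
    have e2 : Pav (fun y => (L : ℝ) ^ 2 + (-1) * qq y) x = (L : ℝ) ^ 2 - qq x - 1 := by
      rw [Pav_add, Pav_const, Pav_smul, Pav_qq]; ring
    rw [e, ← e2]
    refine Pav_mono fun z hz => ?_
    have hz' := nbr_coord hz
    rw [mem_Bx] at hx
    unfold kil
    rw [if_pos]
    · unfold gq
      refine le_trans (le_of_eq (by ring)) (le_max_left _ _)
    · rw [mem_Bx]; simp only [Pi.add_apply]; push_cast; omega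
  · have e : gq L x = 0 := by unfold gq; rw [max_eq_right]; linarith
    rw [e]
    have := Pav_nonneg hk x
    split_ifs <;> linarith

theorem sum_gq (L : ℕ) : (L : ℝ) ^ 4 / 2 ≤ ∑ x ∈ Bx (2 * L), gq L x := by
  have h1 : ∑ x ∈ Bx (L / 2), (L : ℝ) ^ 2 / 2 ≤ ∑ x ∈ Bx (2 * L), gq L x := by
    refine le_trans (Finset.sum_le_sum fun x hx => ?_)
      (Finset.sum_le_sum_of_subset_of_nonneg (Bx_mono (by omega : L / 2 ≤ 2 * L)) fun x _ _ => le_max_right _ _)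
    have hx := mem_Bx.1 hx
    refine le_trans ?_ (le_max_left _ _)
    have hh : ∀ t : ℤ, -((L / 2 : ℕ) : ℤ) ≤ t → t ≤ (L / 2 : ℕ) → (t : ℝ) ^ 2 ≤ (L / 2 : ℝ) ^ 2 := by
      intro t h1 h2
      have a1 : -(L : ℤ) ≤ 2 * t := by omega
      have a2 : 2 * t ≤ (L : ℤ) := by omega
      have b1 : -(L : ℝ) ≤ 2 * t := by exact_mod_cast a1
      have b2 : 2 * (t : ℝ) ≤ L := by exact_mod_cast a2
      exact coord_sq (by linarith) (by linarith)
    have := hh _ hx.1.1 hx.1.2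
    have := hh _ hx.2.1 hx.2.2
    unfold qq
    nlinarith
  rw [Finset.sum_const, card_Bx, nsmul_eq_mul] at h1
  refine le_trans ?_ h1
  have h2 : (L : ℝ) ≤ ((2 * (L / 2) + 1 : ℕ) : ℝ) := by exact_mod_cast (by omega : L ≤ 2 * (L / 2) + 1)
  have h3 : (L : ℝ) ^ 2 ≤ (((2 * (L / 2) + 1) ^ 2 : ℕ) : ℝ) := by
    rw [Nat.cast_pow]; gcongr
  nlinarith [sq_nonneg (L : ℝ)]

theorem four_logs' {a b c d s : ℝ} (ha : 0 < a) (hb : 0 < b) (hc : 0 < c) (hd : 0 < d) (hs : 0 < s)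
    (h : s ^ 4 ≤ a * b * (c * d)) :
    4 * Real.log s ≤ Real.log a + (Real.log b + (Real.log c + Real.log d)) := by
  have e : Real.log a + (Real.log b + (Real.log c + Real.log d)) = Real.log (a * b * (c * d)) := by
    rw [Real.log_mul (by positivity) (by positivity), Real.log_mul ha.ne' hb.ne', Real.log_mul hc.ne' hd.ne']
    ring
  have e2 : 4 * Real.log s = Real.log (s ^ 4) := by rw [Real.log_pow]; norm_num
  rw [e, e2]
  exact Real.log_le_log (by positivity) h

/-- logarithm -/
def lq (x : Site 2) : ℝ := Real.log (qq x + 1)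

theorem Pav_lq (x : Site 2) : lq x + (if x = 0 then Real.log 2 else 0) ≤ Pav lq x := by
  rw [Pav_eq]
  unfold lq
  split_ifs with h
  · subst h
    simp only [zero_add, qq]
    norm_num
    linarith
  · have hp : ∀ y : Site 2, 0 < qq y + 1 := fun y => by have := qq_nonneg y; linarith
    have := four_logs' (hp (x + ![1, 0])) (hp (x + ![-1, 0])) (hp (x + ![0, 1])) (hp (x + ![0, -1])) (hp x) ?_
    · linarith
    · simp only [qq_add]
      unfold qq
      simp only [Matrix.cons_val_zero, Matrix.cons_val_one]
      push_cast
      set a := (x 0 : ℝ)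
      set b := (x 1 : ℝ)
      have e : ((a + 1) ^ 2 + (b + 0) ^ 2 + 1) * ((a + -1) ^ 2 + (b + 0) ^ 2 + 1) *
          (((a + 0) ^ 2 + (b + 1) ^ 2 + 1) * ((a + 0) ^ 2 + (b + -1) ^ 2 + 1)) - (a ^ 2 + b ^ 2 + 1) ^ 4 =
          2 * (a ^ 2 + b ^ 2 + 1) ^ 2 + 8 * (a ^ 2 + b ^ 2 + 1) + 5 + 16 * (a * b) ^ 2 := by ring
      have : 0 ≤ 2 * (a ^ 2 + b ^ 2 + 1) ^ 2 + 8 * (a ^ 2 + b ^ 2 + 1) + 5 + 16 * (a * b) ^ 2 := by positivity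
      linarith

theorem log2_gt : (1 / 2 : ℝ) < Real.log 2 := by
  have := Real.log_two_gt_d9; linarith

/-- Green-type potential -/
def lg (L : ℕ) (y x : Site 2) : ℝ := (Real.log (40 * (L : ℝ) ^ 2) - lq (x - y)) / Real.log 2

theorem lq_le {L : ℕ} (hL : 1 ≤ L) {x y : Site 2} (hx : x ∈ Bx (2 * L + 1)) (hy : y ∈ Bx L) :
    lq (x - y) ≤ Real.log (40 * (L : ℝ) ^ 2) := by
  unfold lq
  have := qq_nonneg (x - y)
  refine Real.log_le_log (by linarith) ?_
  rw [mem_Bx] at hx hy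
  have hL' : (1 : ℝ) ≤ L := by exact_mod_cast hL
  have hh : ∀ t : ℤ, -(4 * (L : ℤ)) ≤ t → t ≤ 4 * L → (t : ℝ) ^ 2 ≤ (4 * L : ℝ) ^ 2 := by
    intro t h1 h2
    have b1 : -(4 * (L : ℝ)) ≤ t := by exact_mod_cast h1
    have b2 : (t : ℝ) ≤ 4 * L := by exact_mod_cast h2
    exact coord_sq b1 b2
  have h0 := hh (x 0 - y 0) (by push_cast at hx; omega) (by push_cast at hx; omega)
  have h1 := hh (x 1 - y 1) (by push_cast at hx; omega) (by push_cast at hx; omega)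
  unfold qq
  simp only [Pi.sub_apply]
  nlinarith

theorem Bx_succ {k : ℕ} {x z : Site 2} (hx : x ∈ Bx k) (hz : z ∈ nbrs) : x + z ∈ Bx (k + 1) := by
  have := nbr_coord hz
  rw [mem_Bx] at hx ⊢
  simp only [Pi.add_apply]; push_cast; omega

theorem lg_nonneg {L : ℕ} (hL : 1 ≤ L) {x y : Site 2} (hx : x ∈ Bx (2 * L + 1)) (hy : y ∈ Bx L) : 0 ≤ lg L y x := by
  have := lq_le hL hx hy
  have := log2_gt
  unfold lg
  exact div_nonneg (by linarith) (by linarith)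

theorem lg_super {L : ℕ} (hL : 1 ≤ L) {x y : Site 2} (hx : x ∈ Bx (2 * L)) (hy : y ∈ Bx L) :
    Pav (kil (Bx (2 * L)) (lg L y)) x ≤ lg L y x - (if x = y then 1 else 0) := by
  have h2 := log2_gt
  have h1 : Pav (kil (Bx (2 * L)) (lg L y)) x ≤ Pav (lg L y) x := by
    refine Pav_mono fun z hz => ?_
    unfold kil
    split_ifs
    · exact le_rfl
    · exact lg_nonneg hL (Bx_succ hx hz) hy
  refine h1.trans ?_
  have e : Pav (lg L y) x = (Real.log (40 * (L : ℝ) ^ 2) - Pav lq (x - y)) / Real.log 2 := by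
    rw [Pav_eq, Pav_eq]
    unfold lg
    have : ∀ z : Site 2, x + z - y = x - y + z := fun z => by abel
    simp only [this]
    ring
  rw [e]
  have h3 := Pav_lq (x - y)
  have e2 : (if x = y then (1 : ℝ) else 0) = (if x - y = 0 then Real.log 2 else 0) / Real.log 2 := by
    by_cases h : x = y
    · simp [h]; rw [div_self]; linarith
    · simp [h, sub_eq_zero]
  rw [e2]
  unfold lg
  rw [← sub_div]
  exact div_le_div_of_nonneg_right (by linarith) (by linarith)

theorem lq_step (x z : Site 2) (hz : z ∈ nbrs) : lq (x + z) ≤ lq x + Real.log 3 := by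
  unfold lq
  have := qq_nonneg x
  have := qq_nonneg (x + z)
  rw [← Real.log_mul (by linarith) (by norm_num)]
  refine Real.log_le_log (by linarith) ?_
  have := qq_nbr (x := x) hz
  linarith

theorem neg_nbrs {z : Site 2} (hz : z ∈ nbrs) : -z ∈ nbrs := by
  rw [mem4] at hz ⊢
  rcases hz with h | h | h | h <;> subst h <;> simp

theorem log3_lt : Real.log 3 ≤ 2 * Real.log 2 := by
  have : 2 * Real.log 2 = Real.log 4 := by
    rw [show (4 : ℝ) = 2 ^ 2 by norm_num, Real.log_pow]; norm_num
  rw [this]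
  exact Real.log_le_log (by norm_num) (by norm_num)

theorem log40_lt : Real.log 40 ≤ 6 * Real.log 2 := by
  have : 6 * Real.log 2 = Real.log 64 := by
    rw [show (64 : ℝ) = 2 ^ 6 by norm_num, Real.log_pow]; norm_num
  rw [this]
  exact Real.log_le_log (by norm_num) (by norm_num)

theorem lg_step {L : ℕ} (y x z : Site 2) (hz : z ∈ nbrs) : |lg L y (x + z) - lg L y x| ≤ 2 := by
  have h2 := log2_gt
  have h3 := log3_lt
  have a1 := lq_step (x - y) z hz
  have a2 := lq_step (x - y + z) (-z) (neg_nbrs hz)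
  rw [add_neg_cancel_right] at a2
  have e : x + z - y = x - y + z := by abel
  unfold lg
  rw [e, ← sub_div, abs_div, abs_of_pos (by linarith : 0 < Real.log 2), div_le_iff₀ (by linarith), abs_le]
  constructor <;> linarith

theorem lg_jump {L : ℕ} (hL : 1 ≤ L) {x y z : Site 2} (hx : x ∈ Bx (2 * L)) (hy : y ∈ Bx L) (hz : z ∈ nbrs) :
    |kil (Bx (2 * L)) (lg L y) (x + z) - lg L y x| ≤ 8 := by
  have hs := lg_step (L := L) y x z hz
  unfold kil
  split_ifs with h
  · linarith
  · have h0 := lg_nonneg hL (Bx_mono (Nat.le_succ _) hx) hy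
    rw [zero_sub, abs_neg, abs_of_nonneg h0]
    have h6 : lg L y (x + z) ≤ 6 := by
      have h2 := log2_gt
      have h4 := log40_lt
      unfold lg
      rw [div_le_iff₀ (by linarith)]
      have hL' : (1 : ℝ) ≤ L := by exact_mod_cast hL
      rw [Real.log_mul (by norm_num) (by positivity)]
      have : Real.log ((L : ℝ) ^ 2) ≤ lq (x + z - y) := by
        unfold lq
        refine Real.log_le_log (by positivity) ?_
        rw [mem_Bx] at h hy
        have hsq : ∀ t : ℤ, (L : ℤ) < t ∨ t < -(L : ℤ) → (L : ℝ) ^ 2 ≤ (t : ℝ) ^ 2 := by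
          rintro t (h | h)
          · have : (L : ℝ) < t := by exact_mod_cast h
            nlinarith
          · have : (t : ℝ) < -(L : ℝ) := by exact_mod_cast h
            nlinarith
        have hc : ((L : ℤ) < ((x + z - y) 0) ∨ ((x + z - y) 0) < -(L : ℤ)) ∨
            ((L : ℤ) < ((x + z - y) 1) ∨ ((x + z - y) 1) < -(L : ℤ)) := by
          simp only [Pi.sub_apply]
          push_cast at h
          omega
        unfold qq
        rcases hc with h | h
        · have := hsq _ h
          nlinarith [sq_nonneg ((((x + z - y) 1 : ℤ)) : ℝ)]
        · have := hsq _ h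
          nlinarith [sq_nonneg ((((x + z - y) 0 : ℤ)) : ℝ)]
      linarith
    have := abs_le.1 hs
    linarith

theorem sum_log_range (n : ℕ) : ∑ j ∈ Finset.range n, (Real.log n - Real.log ((j : ℝ) + 1)) ≤ n := by
  induction n with
  | zero => simp
  | succ n ih =>
    rcases Nat.eq_zero_or_pos n with rfl | hn
    · simp
    rw [Finset.sum_range_succ]
    have hn' : (0 : ℝ) < n := by exact_mod_cast hn
    have e : ∑ j ∈ Finset.range n, (Real.log ((n + 1 : ℕ) : ℝ) - Real.log ((j : ℝ) + 1)) =
        ∑ j ∈ Finset.range n, (Real.log n - Real.log ((j : ℝ) + 1)) + n * (Real.log ((n + 1 : ℕ) : ℝ) - Real.log n) := by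
      simp only [Finset.sum_sub_distrib, Finset.sum_const, Finset.card_range, nsmul_eq_mul]; ring
    rw [e]
    have h1 : Real.log ((n + 1 : ℕ) : ℝ) - Real.log n ≤ 1 / n := by
      rw [← Real.log_div (by positivity) hn'.ne']
      refine (Real.log_le_sub_one_of_pos (by positivity)).trans (le_of_eq ?_)
      push_cast; field_simp; ring
    have h2 : n * (Real.log ((n + 1 : ℕ) : ℝ) - Real.log n) ≤ 1 := by
      calc _ ≤ (n : ℝ) * (1 / n) := by gcongr
        _ = 1 := by field_simp
    push_cast at *
    linarith

theorem sum_Icc_abs (m : ℕ) (f : ℕ → ℝ) (hf : ∀ j < m + 1, 0 ≤ f j) :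
    ∑ t ∈ Finset.Icc (-(m : ℤ)) m, f t.natAbs ≤ 2 * ∑ j ∈ Finset.range (m + 1), f j := by
  have hsub : Finset.Icc (-(m : ℤ)) m ⊆ (Finset.range (m + 1)).image (fun j : ℕ => (j : ℤ)) ∪
      (Finset.range (m + 1)).image (fun j : ℕ => -(j : ℤ)) := by
    intro t ht
    rw [Finset.mem_Icc] at ht
    simp only [Finset.mem_union, Finset.mem_image, Finset.mem_range]
    rcases le_total 0 t with h | h
    · left; exact ⟨t.natAbs, by omega, by omega⟩
    · right; exact ⟨t.natAbs, by omega, by omega⟩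
  have hnn : ∀ t ∈ (Finset.range (m + 1)).image (fun j : ℕ => (j : ℤ)) ∪
      (Finset.range (m + 1)).image (fun j : ℕ => -(j : ℤ)), 0 ≤ f t.natAbs := by
    intro t ht
    simp only [Finset.mem_union, Finset.mem_image, Finset.mem_range] at ht
    rcases ht with ⟨j, hj, rfl⟩ | ⟨j, hj, rfl⟩
    · simpa using hf j hj
    · simpa using hf j hj
  refine (Finset.sum_le_sum_of_subset_of_nonneg hsub fun t ht _ => hnn t ht).trans ?_
  have := Finset.sum_union_inter (s₁ := (Finset.range (m + 1)).image (fun j : ℕ => (j : ℤ)))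
    (s₂ := (Finset.range (m + 1)).image (fun j : ℕ => -(j : ℤ))) (f := fun t : ℤ => f t.natAbs)
  have h0 : 0 ≤ ∑ t ∈ (Finset.range (m + 1)).image (fun j : ℕ => (j : ℤ)) ∩
    (Finset.range (m + 1)).image (fun j : ℕ => -(j : ℤ)), f t.natAbs := by
    refine Finset.sum_nonneg fun t ht => hnn t ?_
    exact Finset.mem_union_left _ (Finset.mem_inter.1 ht).1
  rw [Finset.sum_image (by intro a _ b _ h; simpa using h), Finset.sum_image (by intro a _ b _ h; simpa using h)] at this
  simp only [Int.natAbs_natCast, Int.natAbs_neg] at this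
  linarith

theorem sum_Bx (k : ℕ) (f : ℤ → ℤ → ℝ) :
    ∑ x ∈ Bx k, f (x 0) (x 1) = ∑ a ∈ Finset.Icc (-(k : ℤ)) k, ∑ b ∈ Finset.Icc (-(k : ℤ)) k, f a b := by
  rw [← Finset.sum_product']
  refine Finset.sum_nbij' (fun x => (x 0, x 1)) (fun p => ![p.1, p.2]) ?_ ?_ ?_ ?_ ?_
  · intro x hx; rw [mem_Bx] at hx; simp only [Finset.mem_product, Finset.mem_Icc]; exact hx
  · intro p hp; simp only [Finset.mem_product, Finset.mem_Icc] at hp; rw [mem_Bx]; simpa using hp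
  · intro x _; rw [site_ext]; simp
  · intro p _; simp
  · intro x _; rfl

theorem sum_one_dim (L : ℕ) (hL : 1 ≤ L) (s : ℤ) (hs : -(L : ℤ) ≤ s ∧ s ≤ L) :
    ∑ a ∈ Finset.Icc (-((2 * L : ℕ) : ℤ)) (2 * L : ℕ), (Real.log ((4 * L : ℕ) : ℝ) - Real.log (((a - s).natAbs : ℝ) + 1)) ≤
      8 * L := by
  set f : ℕ → ℝ := fun j => Real.log ((4 * L : ℕ) : ℝ) - Real.log ((j : ℝ) + 1) with hf
  have hfn : ∀ j < 4 * L, 0 ≤ f j := by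
    intro j hj
    have : Real.log ((j : ℝ) + 1) ≤ Real.log ((4 * L : ℕ) : ℝ) := by
      refine Real.log_le_log (by positivity) ?_
      exact_mod_cast hj
    simp only [hf]; linarith
  have h1 : ∑ a ∈ Finset.Icc (-((2 * L : ℕ) : ℤ)) (2 * L : ℕ), f (a - s).natAbs ≤
      ∑ t ∈ Finset.Icc (-((3 * L : ℕ) : ℤ)) (3 * L : ℕ), f t.natAbs := by
    rw [← Finset.sum_image (f := fun t : ℤ => f t.natAbs) (g := fun a => a - s)
      (s := Finset.Icc (-((2 * L : ℕ) : ℤ)) (2 * L : ℕ)) (by intro a _ b _ h; simpa using h)]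
    refine Finset.sum_le_sum_of_subset_of_nonneg ?_ fun t ht _ => hfn _ ?_
    · intro t ht
      obtain ⟨a, ha, rfl⟩ := Finset.mem_image.1 ht
      rw [Finset.mem_Icc] at ha ⊢
      push_cast at *; omega
    · rw [Finset.mem_Icc] at ht; push_cast at ht; omega
  have h2 := sum_Icc_abs (3 * L) f (fun j hj => hfn j (by omega))
  have h3 : ∑ j ∈ Finset.range (3 * L + 1), f j ≤ ∑ j ∈ Finset.range (4 * L), f j := by
    refine Finset.sum_le_sum_of_subset_of_nonneg (Finset.range_mono (by omega)) fun j hj _ => hfn j (by simpa using hj)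
  have h4 := sum_log_range (4 * L)
  have h5 : ((4 * L : ℕ) : ℝ) = 4 * L := by push_cast; ring
  simp only [hf] at *
  linarith

theorem sum_lg {L : ℕ} (hL : 1 ≤ L) {y : Site 2} (hy : y ∈ Bx L) : ∑ x ∈ Bx (2 * L), lg L y x ≤ 310 * (L : ℝ) ^ 2 := by
  have h2 := log2_gt
  have hL' : (1 : ℝ) ≤ L := by exact_mod_cast hL
  set u : ℤ → ℝ := fun t => Real.log ((4 * L : ℕ) : ℝ) - Real.log ((t.natAbs : ℝ) + 1) with hu
  have hpt : ∀ x ∈ Bx (2 * L), lg L y x ≤ 2 * (2 + (u (x 0 - y 0) + u (x 1 - y 1))) := by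
    intro x hx
    set a : ℝ := (((x 0 - y 0).natAbs : ℕ) : ℝ) with ha
    set b : ℝ := (((x 1 - y 1).natAbs : ℕ) : ℝ) with hb
    have ha0 : 0 ≤ a := Nat.cast_nonneg _
    have hb0 : 0 ≤ b := Nat.cast_nonneg _
    have eq1 : qq (x - y) = a ^ 2 + b ^ 2 := by
      unfold qq
      simp only [Pi.sub_apply, ha, hb, Nat.cast_natAbs, Int.cast_abs, sq_abs]
    have h3 : Real.log (40 * (L : ℝ) ^ 2) ≤ Real.log 5 + (2 * Real.log ((4 * L : ℕ) : ℝ) - Real.log 2) := by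
      have : Real.log 5 + (2 * Real.log ((4 * L : ℕ) : ℝ) - Real.log 2) = Real.log (40 * (L : ℝ) ^ 2) := by
        have e1 : 2 * Real.log ((4 * L : ℕ) : ℝ) = Real.log (((4 * L : ℕ) : ℝ) ^ 2) := by
          rw [Real.log_pow]; norm_num
        rw [e1, ← Real.log_div (by positivity) (by norm_num), ← Real.log_mul (by norm_num) (by positivity)]
        congr 1; push_cast; ring
      rw [this]
    have h4 : Real.log (a + 1) + Real.log (b + 1) - Real.log 2 ≤ lq (x - y) := by
      unfold lq
      rw [eq1, ← Real.log_mul (by positivity) (by positivity), ← Real.log_div (by positivity) (by norm_num)]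
      refine Real.log_le_log (by positivity) ?_
      nlinarith [sq_nonneg (a - b), sq_nonneg (a - 1), sq_nonneg (b - 1)]
    have h5 : Real.log 5 ≤ 2 := by
      rw [Real.log_le_iff_le_exp (by norm_num)]
      have := Real.exp_one_gt_d9
      have e : Real.exp 2 = Real.exp 1 * Real.exp 1 := by rw [← Real.exp_add]; norm_num
      rw [e]; nlinarith
    have hX : Real.log (40 * (L : ℝ) ^ 2) - lq (x - y) ≤ 2 + (u (x 0 - y 0) + u (x 1 - y 1)) := by
      simp only [hu]; linarith
    unfold lg
    rw [div_le_iff₀ (by linarith)]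
    by_cases hs : 0 ≤ 2 + (u (x 0 - y 0) + u (x 1 - y 1))
    · nlinarith
    · push Not at hs
      have := lq_le hL (Bx_mono (by omega) hx) hy
      linarith
  have hs0 := sum_one_dim L hL (y 0) (mem_Bx.1 hy).1
  have hs1 := sum_one_dim L hL (y 1) (mem_Bx.1 hy).2
  refine (Finset.sum_le_sum fun x hx => hpt x hx).trans ?_
  rw [sum_Bx (2 * L) (fun a b => 2 * (2 + (u (a - y 0) + u (b - y 1))))]
  have hc : (Finset.Icc (-((2 * L : ℕ) : ℤ)) (2 * L : ℕ)).card = 4 * L + 1 := by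
    rw [Int.card_Icc]; omega
  simp only [← Finset.mul_sum, Finset.sum_add_distrib, Finset.sum_const, hc, nsmul_eq_mul]
  have e0 : ∑ a ∈ Finset.Icc (-((2 * L : ℕ) : ℤ)) (2 * L : ℕ), u (a - y 0) ≤ 8 * L := hs0
  have e1 : ∑ a ∈ Finset.Icc (-((2 * L : ℕ) : ℤ)) (2 * L : ℕ), u (a - y 1) ≤ 8 * L := hs1
  push_cast at e0 e1 ⊢
  nlinarith

end
end ARW

end


section
open MeasureTheory ENNReal Filter
set_option linter.unusedSimpArgs false

namespace ARW

noncomputable section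
open scoped Classical

/-! ### Activity at density at least two -/

theorem cnt_c0 {V : Finset (Site 2)} {η : Site 2 → ℕ} {x : Site 2} (hx : x ∈ V) : cnt ((c0 V η).1.1 x) = η x := by
  simp [c0, initState, hx, cnt]

theorem lin_c0_le {V : Finset (Site 2)} {η : Site 2 → ℕ} {M : ℕ} (hη : ∀ x, η x ≤ M) {g : Site 2 → ℝ}
    (hg : ∀ x ∈ V, 0 ≤ g x) : lin V g (c0 V η).1.1 ≤ M * ∑ x ∈ V, g x := by
  unfold lin
  rw [Finset.mul_sum]
  refine Finset.sum_le_sum fun x hx => ?_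
  rw [cnt_c0 hx]
  exact mul_le_mul_of_nonneg_right (by exact_mod_cast hη x) (hg x hx)

/-- second moment constant -/
def DD (lam : ℝ) (M : ℕ) : ℝ := (310 * M / lamJ lam) ^ 2 + (1 + 8 / lamJ lam) ^ 2 / lamJ lam * (450 * M)

theorem DD_pos {lam : ℝ} (hl : 0 < lam) {M : ℕ} (hM : 2 ≤ M) : 0 < DD lam M := by
  have := lamJ_pos hl
  have : (2 : ℝ) ≤ M := by exact_mod_cast hM
  unfold DD; positivity

theorem wq_nonneg_box {L : ℕ} (hL : 1 ≤ L) {x : Site 2} (hx : x ∈ Bx (2 * L + 1)) : 0 ≤ wq (18 * (L : ℝ) ^ 2) x := by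
  rw [mem_Bx] at hx
  have hL' : (1 : ℝ) ≤ L := by exact_mod_cast hL
  have h1 : -(2 * (L : ℝ) + 1) ≤ x 0 := by exact_mod_cast hx.1.1
  have h2 : (x 0 : ℝ) ≤ 2 * (L : ℝ) + 1 := by exact_mod_cast hx.1.2
  have h3 : -(2 * (L : ℝ) + 1) ≤ x 1 := by exact_mod_cast hx.2.1
  have h4 : (x 1 : ℝ) ≤ 2 * (L : ℝ) + 1 := by exact_mod_cast hx.2.2
  have := coord_sq h1 h2
  have := coord_sq h3 h4
  unfold wq; nlinarith

theorem second_moment {lam : ℝ} (hl : 0 < lam) {L : ℕ} (hL : 1 ≤ L) {M : ℕ} {η : Site 2 → ℕ} (hη : ∀ x, η x ≤ M)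
    {y : Site 2} (hy : y ∈ Bx L) (n : ℕ) :
    EE lam (Bx (2 * L)) 0 (fun c => (c.1.2 y : ℝ) ^ 2) n (c0 (Bx (2 * L)) η) ≤ DD lam M * (L : ℝ) ^ 4 := by
  have hJ := lamJ_pos hl
  have hL' : (1 : ℝ) ≤ L := by exact_mod_cast hL
  have hsub : Bx (2 * L) ⊆ Bx (2 * L + 1) := Bx_mono (by omega)
  have hψ0 : ∀ x ∈ Bx (2 * L), 0 ≤ lg L y x := fun x hx => lg_nonneg hL (hsub hx) hy
  have hw0 : ∀ x ∈ Bx (2 * L), 0 ≤ wq (18 * (L : ℝ) ^ 2) x := fun x hx => wq_nonneg_box hL (hsub hx)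
  have := odo_sq hl (Bx (2 * L)) 0 y (lg L y) (wq (18 * (L : ℝ) ^ 2)) hψ0
    (fun x hx => lg_super hL hx hy) (fun x hx z hz => lg_jump hL hx hy hz) hw0
    (fun x hx => by
      rw [← Pav_wq]
      refine Pav_mono fun z hz => ?_
      unfold kil
      split_ifs
      · exact le_rfl
      · exact wq_nonneg_box hL (Bx_succ hx hz)) n (c0 (Bx (2 * L)) η)
  refine this.trans ?_
  have e0 : (c0 (Bx (2 * L)) η).1.2 y = 0 := rfl
  rw [e0]
  have a1 : lin (Bx (2 * L)) (lg L y) (c0 (Bx (2 * L)) η).1.1 ≤ M * (310 * (L : ℝ) ^ 2) :=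
    (lin_c0_le hη hψ0).trans (mul_le_mul_of_nonneg_left (sum_lg hL hy) (Nat.cast_nonneg _))
  have a1' : 0 ≤ lin (Bx (2 * L)) (lg L y) (c0 (Bx (2 * L)) η).1.1 :=
    Finset.sum_nonneg fun x hx => mul_nonneg (Nat.cast_nonneg _) (hψ0 x hx)
  have a2 : ∑ x ∈ Bx (2 * L), wq (18 * (L : ℝ) ^ 2) x ≤ 450 * (L : ℝ) ^ 4 := by
    have : ∑ x ∈ Bx (2 * L), wq (18 * (L : ℝ) ^ 2) x ≤ ∑ x ∈ Bx (2 * L), 18 * (L : ℝ) ^ 2 :=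
      Finset.sum_le_sum fun x _ => by unfold wq; nlinarith [sq_nonneg ((x 0 : ℤ) : ℝ), sq_nonneg ((x 1 : ℤ) : ℝ)]
    refine this.trans ?_
    rw [Finset.sum_const, card_Bx, nsmul_eq_mul]
    push_cast
    have h5 : (2 * (2 * (L : ℝ)) + 1) ^ 2 ≤ 25 * (L : ℝ) ^ 2 := by nlinarith
    nlinarith [mul_le_mul_of_nonneg_right h5 (sq_nonneg (L : ℝ))]
  have a3 : lin (Bx (2 * L)) (wq (18 * (L : ℝ) ^ 2)) (c0 (Bx (2 * L)) η).1.1 ≤ M * (450 * (L : ℝ) ^ 4) :=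
    (lin_c0_le hη hw0).trans (mul_le_mul_of_nonneg_left a2 (Nat.cast_nonneg _))
  have b1 : (((0 : ℕ) : ℝ) + lin (Bx (2 * L)) (lg L y) (c0 (Bx (2 * L)) η).1.1 / lamJ lam) ^ 2 ≤
      (310 * M / lamJ lam) ^ 2 * (L : ℝ) ^ 4 := by
    have : (310 * M / lamJ lam) ^ 2 * (L : ℝ) ^ 4 = (M * (310 * (L : ℝ) ^ 2) / lamJ lam) ^ 2 := by ring
    rw [this, Nat.cast_zero, zero_add]
    exact pow_le_pow_left₀ (by positivity) (div_le_div_of_nonneg_right a1 hJ.le) 2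
  have b2 : (1 + 8 / lamJ lam) ^ 2 / lamJ lam * lin (Bx (2 * L)) (wq (18 * (L : ℝ) ^ 2)) (c0 (Bx (2 * L)) η).1.1 ≤
      (1 + 8 / lamJ lam) ^ 2 / lamJ lam * (M * (450 * (L : ℝ) ^ 4)) :=
    mul_le_mul_of_nonneg_left a3 (by positivity)
  unfold DD
  linarith

theorem first_moment {lam : ℝ} (hl : 0 < lam) {L : ℕ} (hL : 1 ≤ L) {η : Site 2 → ℕ} (hη : ∀ x, 2 ≤ η x) :
    ∃ n, (L : ℝ) ^ 4 / 4 ≤ ∑ y ∈ Bx L, EE lam (Bx (2 * L)) 0 (fun c => (c.1.2 y : ℝ)) n (c0 (Bx (2 * L)) η) := by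
  have hJ := lamJ_pos hl
  have hJ1 : lamJ lam ≤ 1 := by have := lamS_add_lamJ hl; have := lamS_pos hl; linarith
  have hL' : (1 : ℝ) ≤ L := by exact_mod_cast hL
  set V := Bx (2 * L) with hV
  have ht := (EE_ns_tendsto hl V 0 (c0 V η)).const_mul ((L : ℝ) ^ 2 * lin V (fun _ => 1) (c0 V η).1.1)
  rw [mul_zero] at ht
  obtain ⟨n, hn⟩ := (ht.eventually_le_const (show (0 : ℝ) < (L : ℝ) ^ 4 / 4 by positivity)).exists
  refine ⟨n, ?_⟩
  have h1 := odo_lower hl V (Bx L) 0 (gq L) (fun x _ => gq_sub L hL x) (fun x => le_max_right _ _) ((L : ℝ) ^ 2)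
    (fun x => max_le (by have := qq_nonneg x; linarith) (by positivity)) η hη n
  have h2 := sum_gq L
  have h3 : 0 ≤ ∑ y ∈ Bx L, EE lam V 0 (fun c => (c.1.2 y : ℝ)) n (c0 V η) :=
    Finset.sum_nonneg fun y _ => EE_nonneg hl V 0 (fun c => Nat.cast_nonneg _) n _
  nlinarith [mul_le_mul_of_nonneg_right hJ1 h3]

theorem tail_sum {lam : ℝ} (hl : 0 < lam) {L : ℕ} (hL : 1 ≤ L) {M : ℕ} {η : Site 2 → ℕ} (hη : ∀ x, 2 ≤ η x)
    (hηM : ∀ x, η x ≤ M) (K : ℕ) (hK : 144 * (K : ℝ) ≤ (L : ℝ) ^ 2) :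
    ∃ n, (L : ℝ) ^ 2 / (288 * DD lam M) ≤
      ∑ y ∈ Bx L, EE lam (Bx (2 * L)) 0 (ind fun c => K ≤ c.1.2 y) n (c0 (Bx (2 * L)) η) := by
  obtain ⟨n, hn⟩ := first_moment hl hL hη
  refine ⟨n, ?_⟩
  have hM : 2 ≤ M := (hη 0).trans (hηM 0)
  have hD := DD_pos hl hM
  set D := DD lam M with hDdef
  have hL' : (1 : ℝ) ≤ L := by exact_mod_cast hL
  set V := Bx (2 * L) with hV
  set θ : ℝ := 1 / (72 * D * (L : ℝ) ^ 2) with hθ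
  have hθ0 : 0 < θ := by positivity
  have key : ∀ y ∈ Bx L, EE lam V 0 (fun c => (c.1.2 y : ℝ)) n (c0 V η) ≤
      ((K : ℝ) + θ * (D * (L : ℝ) ^ 4)) + 1 / (4 * θ) * EE lam V 0 (ind fun c => K ≤ c.1.2 y) n (c0 V η) := by
    intro y hy
    have h1 := EE_mono hl (inv_triv V 0) (Φ := fun c => (c.1.2 y : ℝ))
      (Ψ := fun c => ((fun _ => (K : ℝ)) c + (fun c => θ * (c.1.2 y : ℝ) ^ 2) c) +
        (fun c => 1 / (4 * θ) * ind (fun c => K ≤ c.1.2 y) c) c) (fun c _ => by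
        dsimp only
        unfold ind
        split_ifs with h
        · have e : θ * (c.1.2 y : ℝ) ^ 2 + 1 / (4 * θ) * 1 - c.1.2 y = θ * ((c.1.2 y : ℝ) - 1 / (2 * θ)) ^ 2 := by
            field_simp; ring
          have : 0 ≤ θ * ((c.1.2 y : ℝ) - 1 / (2 * θ)) ^ 2 := by positivity
          have : (0 : ℝ) ≤ K := Nat.cast_nonneg K
          linarith
        · have : (c.1.2 y : ℝ) ≤ K := by exact_mod_cast (not_le.1 h).le
          have : 0 ≤ θ * (c.1.2 y : ℝ) ^ 2 := by positivity
          linarith) n (c0 V η) trivial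
    simp only [EE_add, EE_smul, EE_const hl] at h1
    have h2 := mul_le_mul_of_nonneg_left (second_moment hl hL hηM hy n) hθ0.le
    linarith
  have h3 := Finset.sum_le_sum key
  rw [Finset.sum_add_distrib, ← Finset.mul_sum, Finset.sum_const, card_Bx, nsmul_eq_mul] at h3
  set S := ∑ y ∈ Bx L, EE lam V 0 (ind fun c => K ≤ c.1.2 y) n (c0 V η)
  have e1 : 1 / (4 * θ) = 18 * D * (L : ℝ) ^ 2 := by rw [hθ]; field_simp; norm_num
  have e2 : θ * (D * (L : ℝ) ^ 4) = (L : ℝ) ^ 2 / 72 := by rw [hθ]; field_simp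
  rw [e1, e2] at h3
  push_cast at h3
  have h5 : (2 * (L : ℝ) + 1) ^ 2 ≤ 9 * (L : ℝ) ^ 2 := by nlinarith
  have hK0 : (0 : ℝ) ≤ K := Nat.cast_nonneg K
  have h6 : (2 * (L : ℝ) + 1) ^ 2 * ((K : ℝ) + (L : ℝ) ^ 2 / 72) ≤ 9 * (L : ℝ) ^ 2 * ((K : ℝ) + (L : ℝ) ^ 2 / 72) :=
    mul_le_mul_of_nonneg_right h5 (by positivity)
  have h7 : 9 * (L : ℝ) ^ 2 * ((K : ℝ) + (L : ℝ) ^ 2 / 72) ≤ (L : ℝ) ^ 4 * (3 / 16) := by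
    nlinarith [mul_le_mul_of_nonneg_right hK (sq_nonneg (L : ℝ))]
  rw [div_le_iff₀ (by positivity)]
  have h8 : (L : ℝ) ^ 2 * (L : ℝ) ^ 2 ≤ (L : ℝ) ^ 2 * (S * (288 * D)) := by nlinarith
  exact le_of_mul_le_mul_left h8 (by positivity)

theorem hB_sum {lam : ℝ} (hl : 0 < lam) {L : ℕ} (hL : 1 ≤ L) {M : ℕ} {η : Site 2 → ℕ} (hη : ∀ x, 2 ≤ η x)
    (hηM : ∀ x, η x ≤ M) (K : ℕ) (hK : 144 * (K : ℝ) ≤ (L : ℝ) ^ 2) :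
    ENNReal.ofReal ((L : ℝ) ^ 2 / (288 * DD lam M)) ≤ ∑ y ∈ Bx L, hB lam hl (3 * L) K (shift y η) := by
  obtain ⟨n, hn⟩ := tail_sum hl hL hη hηM K hK
  refine (ENNReal.ofReal_le_ofReal hn).trans ?_
  rw [ENNReal.ofReal_sum_of_nonneg fun y _ => EE_nonneg hl _ _ (ind_nonneg _) _ _]
  refine Finset.sum_le_sum fun y hy => ?_
  rw [← bridge lam hl]
  refine le_trans (measure_mono ?_) (hB_shift' lam hl (3 * L) K y (Bx (2 * L)) (fun x hx => ?_) η)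
  · intro I hI
    obtain ⟨l, h1, h2⟩ := ch_legal (Bx (2 * L)) 0 I n (c0 (Bx (2 * L)) η)
    refine ⟨l, h1, ?_⟩
    have h3 := run_snd (Bx (2 * L)) I l (c0 (Bx (2 * L)) η).1 y
    rw [h2] at h3
    have h4 : (c0 (Bx (2 * L)) η).1.2 y = 0 := rfl
    have h5 : K ≤ (ch (Bx (2 * L)) 0 I n (c0 (Bx (2 * L)) η)).1.2 y := hI
    omega
  · rw [mem_Bx] at hx hy ⊢
    simp only [Pi.sub_apply]; push_cast at *; omega

theorem not_fixates {lam : ℝ} (hl : 0 < lam) (ν : Measure (Site 2 → ℕ)) [IsProbabilityMeasure ν]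
    (hν : ∀ z, Measure.map (shift z) ν = ν) (M : ℕ) (h2 : ∀ᵐ η ∂ν, ∀ x, 2 ≤ η x) (hM : ∀ᵐ η ∂ν, ∀ x, η x ≤ M) :
    ¬ Fixates 2 (ssrwStep 2) lam ν := by
  intro hf
  have hM2 : 2 ≤ M := by
    obtain ⟨η, h, h'⟩ := (h2.and hM).exists
    exact (h 0).trans (h' 0)
  have hD := DD_pos hl hM2
  set D := DD lam M with hDdef
  have hInteg : ∀ K L : ℕ, 1 ≤ L → 144 * (K : ℝ) ≤ (L : ℝ) ^ 2 →
      ENNReal.ofReal (1 / (2592 * D)) ≤ ∫⁻ η, hB lam hl (3 * L) K η ∂ν := by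
    intro K L hL hK
    have hL' : (1 : ℝ) ≤ L := by exact_mod_cast hL
    have h1 : ENNReal.ofReal ((L : ℝ) ^ 2 / (288 * D)) ≤ ∫⁻ η, ∑ y ∈ Bx L, hB lam hl (3 * L) K (shift y η) ∂ν := by
      have : ∫⁻ _, ENNReal.ofReal ((L : ℝ) ^ 2 / (288 * D)) ∂ν = ENNReal.ofReal ((L : ℝ) ^ 2 / (288 * D)) := by simp
      rw [← this]
      refine lintegral_mono_ae ?_
      filter_upwards [h2, hM] with η a b
      exact hB_sum hl hL a b K hK
    have hms : ∀ y : Site 2, Measurable (shift (d := 2) y) := fun y =>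
      measurable_pi_lambda _ fun x => measurable_pi_apply _
    rw [lintegral_finsetSum (μ := ν) (Bx L) (f := fun y η => hB lam hl (3 * L) K (shift y η)) fun y _ => (meas_hB lam hl (3 * L) K).comp (hms y)] at h1
    simp only [lintegral_shift hν (meas_hB lam hl (3 * L) K)] at h1
    rw [Finset.sum_const, card_Bx, nsmul_eq_mul] at h1
    set X := ∫⁻ η, hB lam hl (3 * L) K η ∂ν
    have h3 : ENNReal.ofReal (9 * (L : ℝ) ^ 2) * ENNReal.ofReal (1 / (2592 * D)) ≤ ENNReal.ofReal (9 * (L : ℝ) ^ 2) * X := by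
      rw [← ENNReal.ofReal_mul (by positivity)]
      have e : 9 * (L : ℝ) ^ 2 * (1 / (2592 * D)) = (L : ℝ) ^ 2 / (288 * D) := by field_simp; norm_num
      rw [e]
      refine h1.trans (mul_le_mul_left ?_ _)
      rw [← ENNReal.ofReal_natCast]
      refine ENNReal.ofReal_le_ofReal ?_
      push_cast; nlinarith
    exact (ENNReal.mul_le_mul_iff_right (by rw [Ne, ENNReal.ofReal_eq_zero, not_le]; positivity) ENNReal.ofReal_ne_top).1 h3
  have hATn : ∀ K, ENNReal.ofReal (1 / (2592 * D)) ≤ (ν.prod (muP lam hl)) (ATn K) := by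
    intro K
    have ht := (hB_tendsto lam hl K ν).comp (tendsto_atTop_mono (fun L : ℕ => (by omega : L ≤ 3 * L)) tendsto_id)
    refine ge_of_tendsto ht ?_
    filter_upwards [eventually_ge_atTop (144 * K + 1)] with L hL
    refine hInteg K L (by omega) ?_
    have : ((144 * K + 1 : ℕ) : ℝ) ≤ L := by exact_mod_cast hL
    push_cast at this
    have : (0 : ℝ) ≤ K := Nat.cast_nonneg K
    nlinarith
  have hAT : ENNReal.ofReal (1 / (2592 * D)) ≤ (ν.prod (muP lam hl)) AT := by
    rw [AT_eq]
    have := tendsto_measure_iInter_atTop (μ := ν.prod (muP lam hl)) (s := ATn)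
      (fun n => (meas_ATn n).nullMeasurableSet) ATn_anti ⟨0, measure_ne_top _ _⟩
    exact ge_of_tendsto this (Eventually.of_forall hATn)
  have h0 : (ν.prod (muP lam hl)) AT = 0 := by
    rw [Measure.measure_prod_null meas_AT]
    unfold Fixates at hf
    rw [stackLaw_eq lam hl] at hf
    filter_upwards [hf] with η h
    change muP lam hl (Prod.mk η ⁻¹' AT) = 0
    rw [ae_iff] at h
    convert h using 2
    ext I
    simp only [Set.mem_preimage, AT, Set.mem_ofPred_eq, not_not, odom_top, ne_eq]
  rw [h0] at hAT
  have : 0 < ENNReal.ofReal (1 / (2592 * D)) := by rw [ENNReal.ofReal_pos]; positivity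
  exact absurd hAT (not_le.2 this)

end
end ARW

end


section
open MeasureTheory ENNReal Filter
set_option linter.unusedSimpArgs false

namespace ARW

noncomputable section
open scoped Classical

/-! ### Ergodic laws of every density -/

/-- irrational rotation angle -/
def rot : UnitAddCircle := ((Real.sqrt 2 : ℝ) : UnitAddCircle)

theorem rot_order : addOrderOf rot = 0 := by
  rw [addOrderOf_eq_zero_iff']
  intro n hn h
  rw [rot, ← AddCircle.coe_nsmul, AddCircle.coe_eq_zero_iff] at h
  obtain ⟨m, hm⟩ := h
  simp only [zsmul_eq_mul, mul_one, nsmul_eq_mul] at hm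
  have hn' : (n : ℝ) ≠ 0 := by exact_mod_cast hn.ne'
  refine irrational_sqrt_two ⟨(m : ℚ) / n, ?_⟩
  push_cast
  rw [hm]; field_simp

/-- coding of the rotation -/
def code (N : ℕ) (r : ℝ) (u : UnitAddCircle) : Site 2 → ℕ :=
  fun x => N + if (x 0) • rot + u ∈ Metric.closedBall (0 : UnitAddCircle) (r / 2) then 1 else 0

theorem meas_code (N : ℕ) (r : ℝ) : Measurable (code N r) := by
  refine measurable_pi_lambda _ fun x => ?_
  unfold code
  refine Measurable.add measurable_const (Measurable.ite ?_ measurable_const measurable_const)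
  exact (measurable_const_add ((x 0) • rot)) Metric.isClosed_closedBall.measurableSet

theorem shift_code (N : ℕ) (r : ℝ) (u : UnitAddCircle) (z : Site 2) :
    shift z (code N r u) = code N r ((z 0) • rot + u) := by
  funext x
  simp only [shift, code, Pi.add_apply, add_smul, add_assoc]

/-- the law -/
def codeLaw (N : ℕ) (r : ℝ) : Measure (Site 2 → ℕ) := Measure.map (code N r) (volume : Measure UnitAddCircle)

instance instProbCircle : IsProbabilityMeasure (volume : Measure UnitAddCircle) := ⟨UnitAddCircle.measure_univ⟩

instance instProbCode (N : ℕ) (r : ℝ) : IsProbabilityMeasure (codeLaw N r) :=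
  Measure.isProbabilityMeasure_map (meas_code N r).aemeasurable

theorem codeLaw_ergodic (N : ℕ) (r : ℝ) : IsTransErgodic (codeLaw N r) := by
  have hms : ∀ y : Site 2, Measurable (shift (d := 2) y) := fun y =>
    measurable_pi_lambda _ fun x => measurable_pi_apply _
  refine ⟨fun z => ?_, fun s hs hinv => ?_⟩
  · unfold codeLaw
    rw [Measure.map_map (hms z) (meas_code N r)]
    have : shift z ∘ code N r = code N r ∘ fun u => (z 0) • rot + u := by
      funext u; exact shift_code N r u z
    rw [this, ← Measure.map_map (meas_code N r) (measurable_const_add _),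
      (measurePreserving_add_left volume ((z 0) • rot)).map_eq]
  · unfold codeLaw
    rw [Measure.map_apply (meas_code N r) hs]
    refine (AddCircle.ergodic_add_left.2 rot_order).toPreErgodic.prob_eq_zero_or_one (meas_code N r hs) ?_
    ext u
    have h1 := shift_code N r u ![1, 0]
    simp only [Matrix.cons_val_zero, one_smul] at h1
    have h2 : code N r u ∈ shift ![1, 0] ⁻¹' s ↔ code N r u ∈ s := by rw [hinv]
    rw [Set.mem_preimage, h1] at h2
    exact h2

theorem codeLaw_mean (N : ℕ) (r : ℝ) (h0 : 0 ≤ r) (h1 : r ≤ 1) :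
    ∫⁻ η, (η 0 : ℝ≥0∞) ∂(codeLaw N r) = ENNReal.ofReal (N + r) := by
  unfold codeLaw
  rw [lintegral_map (by
    exact (measurable_of_countable (fun n : ℕ => (n : ℝ≥0∞))).comp (measurable_pi_apply 0)) (meas_code N r)]
  have e : ∀ u : UnitAddCircle, ((code N r u 0 : ℕ) : ℝ≥0∞) =
      (N : ℝ≥0∞) + (Metric.closedBall (0 : UnitAddCircle) (r / 2)).indicator 1 u := by
    intro u
    simp only [code, Pi.zero_apply, zero_smul, zero_add, Set.indicator_apply, Pi.one_apply]
    push_cast; rfl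
  simp only [e]
  rw [lintegral_add_left measurable_const, lintegral_indicator_one Metric.isClosed_closedBall.measurableSet,
    AddCircle.volume_closedBall, ENNReal.ofReal_add (Nat.cast_nonneg _) h0,
    show 2 * (r / 2) = r by ring, min_eq_right h1]
  simp

theorem dens_lt_two {lam : ℝ} (hl : 0 < lam) {ρ : ℝ} (hρ : 0 ≤ ρ)
    (h : ∀ ν : Measure (Site 2 → ℕ), IsProbabilityMeasure ν → IsTransErgodic ν →
      (∫⁻ η, (η 0 : ℝ≥0∞) ∂ν) = ENNReal.ofReal ρ → Fixates 2 (ssrwStep 2) lam ν) : ρ ≤ 2 := by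
  by_contra hlt
  push Not at hlt
  have hN : 2 ≤ ⌊ρ⌋₊ := Nat.le_floor (by exact_mod_cast hlt.le)
  have hr0 : 0 ≤ ρ - ⌊ρ⌋₊ := by have := Nat.floor_le hρ; linarith
  have hr1 : ρ - ⌊ρ⌋₊ ≤ 1 := by have := Nat.lt_floor_add_one ρ; linarith
  have hm := codeLaw_mean ⌊ρ⌋₊ (ρ - ⌊ρ⌋₊) hr0 hr1
  rw [add_sub_cancel] at hm
  have hms : ∀ P : ℕ → Prop, MeasurableSet {η : Site 2 → ℕ | ∀ x, P (η x)} := by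
    intro P
    have : {η : Site 2 → ℕ | ∀ x, P (η x)} = ⋂ x, (fun η : Site 2 → ℕ => η x) ⁻¹' {n | P n} := by ext η; simp
    rw [this]
    exact MeasurableSet.iInter fun x => measurable_pi_apply x (Set.to_countable _).measurableSet
  refine not_fixates hl (codeLaw ⌊ρ⌋₊ (ρ - ⌊ρ⌋₊)) (codeLaw_ergodic _ _).1 (⌊ρ⌋₊ + 1) ?_ ?_
    (h _ inferInstance (codeLaw_ergodic _ _) hm)
  · unfold codeLaw
    rw [ae_map_iff (meas_code _ _).aemeasurable (hms fun n => 2 ≤ n)]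
    refine Eventually.of_forall fun u x => ?_
    unfold code; omega
  · unfold codeLaw
    rw [ae_map_iff (meas_code _ _).aemeasurable (hms fun n => n ≤ ⌊ρ⌋₊ + 1)]
    refine Eventually.of_forall fun u x => ?_
    unfold code; split_ifs <;> omega

theorem main_bound {lam : ℝ} (hl : 0 < lam) (hl2 : lam ≤ 1 / 256) :
    1 / 100 * (lam * Real.log (1 / lam)) ≤ critDensity 2 (ssrwStep 2) lam := by
  unfold critDensity
  refine le_csSup ⟨2, ?_⟩ ⟨?_, ?_⟩
  · rintro ρ ⟨h0, h⟩
    exact dens_lt_two hl h0 h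
  · have : 0 ≤ Real.log (1 / lam) := Real.log_nonneg (by rw [le_div_iff₀ hl]; linarith)
    positivity
  · intro ν hp he hm
    exact fixates_low hl hl2 ν he hm

end
end ARW

end

open MeasureTheory ENNReal Filter Topology ARW

theorem arw_low_sleep_dim2_lower :
    ∃ c > (0 : ℝ), ∃ lam₀ : ℝ, 0 < lam₀ ∧ lam₀ < 1 ∧ ∀ lam : ℝ, 0 < lam → lam ≤ lam₀ →
      c * (lam * Real.log (1 / lam)) ≤ critDensity 2 (ssrwStep 2) lam := by
  refine ⟨1 / 100, by norm_num, 1 / 256, by norm_num, by norm_num, fun lam hl hl2 => ?_⟩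
  exact main_bound hl hl2
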